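/- Let d ≥ 3, m ≥ 1, q ≥ 0 and r > 1. Let Y ⊂ P^m be a generic scheme consisting of q double points and r simple points. Then dim (I_Y)_d = max{ C(m+d, d) − q(m+1) − r ; 0 }; i.e. the degree-d part of the ideal of q generic double points plus r generic simple points in P^m has the expected dimension. -/

import Mathlib

open MvPolynomial

noncomputable section

/-- The degree-`t` homogeneous piece of an ideal `I` of a polynomial ring, as a
`K`-vector space; `Module.finrank K (piece K I t)` is `dim (I)_t`. -/
def piece (K : Type) [Field K] {ι : Type} (I : Ideal (MvPolynomial ι K)) (t : ℕ) :
    Submodule K (MvPolynomial ι K) :=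
  Submodule.restrictScalars K I ⊓ MvPolynomial.homogeneousSubmodule ι K t

/-- The (saturated, radical) homogeneous ideal of the projective linear subspace spanned
by the set `S` of vectors: the ideal generated by all linear forms vanishing on `S`. -/
def linIdeal (K : Type) [Field K] {ι : Type} (S : Set (ι → K)) : Ideal (MvPolynomial ι K) :=
  Ideal.span { f | f ∈ MvPolynomial.homogeneousSubmodule ι K 1 ∧ ∀ x ∈ S, MvPolynomial.eval x f = 0 }

/-- A property of points of affine space that holds on a nonempty Zariski-open set. -/
def Gen (K : Type) [Field K] {τ : Type} (Q : (τ → K) → Prop) : Prop :=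
  ∃ g : MvPolynomial τ K, g ≠ 0 ∧ ∀ P : τ → K, eval P g ≠ 0 → Q P

section Gen

variable {K : Type} [Field K] {τ : Type}

theorem Gen.mono {Q Q' : (τ → K) → Prop} (h : Gen K Q) (hQ : ∀ P, Q P → Q' P) : Gen K Q' := by
  obtain ⟨g, hg, hP⟩ := h
  exact ⟨g, hg, fun P hp => hQ P (hP P hp)⟩

theorem Gen.and {Q Q' : (τ → K) → Prop} (h : Gen K Q) (h' : Gen K Q') :
    Gen K fun P => Q P ∧ Q' P := by
  obtain ⟨g, hg, hP⟩ := h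
  obtain ⟨g', hg', hP'⟩ := h'
  refine ⟨g * g', mul_ne_zero hg hg', fun P hp => ?_⟩
  rw [map_mul] at hp
  exact ⟨hP P (left_ne_zero_of_mul hp), hP' P (right_ne_zero_of_mul hp)⟩

theorem Gen.exists [Infinite K] {Q : (τ → K) → Prop} (h : Gen K Q) : ∃ P, Q P := by
  obtain ⟨g, hg, hP⟩ := h
  by_contra! hn
  refine hg (MvPolynomial.funext fun P => ?_)
  by_contra hne
  exact hn P (hP P (by simpa using hne))

theorem Gen.ne_zero (i : τ) : Gen K fun P : τ → K => P i ≠ 0 :=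
  ⟨X i, X_ne_zero i, fun P hp => by simpa using hp⟩

theorem Gen.forall_fin {k : ℕ} {Q : Fin k → (τ → K) → Prop} (h : ∀ i, Gen K (Q i)) :
    Gen K fun P => ∀ i, Q i P := by
  choose g hg hP using h
  refine ⟨∏ i, g i, Finset.prod_ne_zero_iff.2 fun i _ => hg i, fun P hp i => hP i P ?_⟩
  rw [map_prod] at hp
  exact Finset.prod_ne_zero_iff.1 hp i (Finset.mem_univ i)

/-- The linear forms cutting out a subspace of dimension at most `r` are, up to adding `r` of
them, jointly injective. -/
theorem exists_functionals {M : Type} [AddCommGroup M] [Module K M] [FiniteDimensional K M]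
    (W : Submodule K M) {r : ℕ} (h : Module.finrank K W ≤ r) :
    ∃ Λ : M →ₗ[K] (Fin r → K), ∀ x ∈ W, Λ x = 0 → x = 0 := by
  have h1 : Module.finrank K W ≤ Module.finrank K (Fin r → K) := by simpa using h
  have h2 : Module.rank K W ≤ Module.rank K (Fin r → K) := by
    rw [← Module.finrank_eq_rank, ← Module.finrank_eq_rank]
    exact_mod_cast h1
  obtain ⟨f, hf⟩ := rank_le_iff_exists_linearMap.1 h2
  obtain ⟨g, hg⟩ := LinearMap.exists_extend f
  refine ⟨g, fun x hx h0 => ?_⟩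
  have : f ⟨x, hx⟩ = 0 := by rw [← hg]; simpa using h0
  have := hf (this.trans (map_zero f).symm)
  simpa using congrArg Subtype.val this

theorem finrank_le_of_functionals {M : Type} [AddCommGroup M] [Module K M]
    (W : Submodule K M) {r : ℕ} (Λ : M →ₗ[K] (Fin r → K)) (h : ∀ x ∈ W, Λ x = 0 → x = 0) :
    Module.finrank K W ≤ r := by
  have := LinearMap.finrank_le_finrank_of_injective (f := Λ.domRestrict W) (by
    rw [← LinearMap.ker_eq_bot, LinearMap.ker_eq_bot']
    intro x hx
    exact Subtype.ext (h x x.2 (by simpa using hx)))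
  simpa using this

theorem Gen.finrank_iInf_ker_le {M ι : Type} [AddCommGroup M] [Module K M] [FiniteDimensional K M]
    [Fintype ι] (Φ : ι → (τ → K) → M →ₗ[K] K)
    (hΦ : ∀ i x, ∃ c : MvPolynomial τ K, ∀ P, Φ i P x = eval P c) {r : ℕ} (P₀ : τ → K)
    (h : Module.finrank K (⨅ i, LinearMap.ker (Φ i P₀) : Submodule K M) ≤ r) :
    Gen K fun P => Module.finrank K (⨅ i, LinearMap.ker (Φ i P) : Submodule K M) ≤ r := by
  classical
  obtain ⟨Λ, hΛ⟩ := exists_functionals _ h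
  let F : (τ → K) → M →ₗ[K] (ι → K) × (Fin r → K) := fun P => (LinearMap.pi fun i => Φ i P).prod Λ
  have hF : ∀ P x, F P x = (fun i => Φ i P x, Λ x) := fun P x => rfl
  have hinj : LinearMap.ker (F P₀) = ⊥ := by
    rw [LinearMap.ker_eq_bot']
    intro x hx
    rw [hF, Prod.mk_eq_zero] at hx
    refine hΛ x ?_ hx.2
    simp only [Submodule.mem_iInf, LinearMap.mem_ker]
    exact fun i => congrFun hx.1 i
  obtain ⟨B, hB⟩ := LinearMap.exists_leftInverse_of_injective _ hinj
  let b := Module.finBasis K M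
  have hc : ∀ i j, ∃ c : MvPolynomial τ K, ∀ P, b.repr (B (F P (b j))) i = eval P c := by
    intro i j
    choose c hc using fun k => hΦ k (b j)
    let B₁ : (ι → K) →ₗ[K] K := (b.coord i ∘ₗ B) ∘ₗ LinearMap.inl K _ _
    refine ⟨∑ k, c k * C (B₁ (Pi.single k 1)) + C (b.coord i (B (0, Λ (b j)))), fun P => ?_⟩
    have h1 : F P (b j) = LinearMap.inl K _ _ (fun k => Φ k P (b j)) + (0, Λ (b j)) := by
      rw [hF]; simp
    have h2 : b.repr (B (F P (b j))) i =
        B₁ (fun k => Φ k P (b j)) + b.coord i (B (0, Λ (b j))) := by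
      rw [h1, map_add]; simp [B₁]
    rw [h2, LinearMap.pi_apply_eq_sum_univ B₁]
    simp only [map_add, map_sum, map_mul, eval_C, smul_eq_mul, ← hc]
    congr 1
    refine Finset.sum_congr rfl fun k _ => ?_
    congr 2
    ext j
    simp [Pi.single_apply, eq_comm]
  choose c hc using hc
  have hdet : ∀ P, eval P (Matrix.det (Matrix.of c)) = LinearMap.det (B ∘ₗ F P) := by
    intro P
    rw [← LinearMap.det_toMatrix b, RingHom.map_det]
    congr 1
    ext i j
    simp [LinearMap.toMatrix_apply, hc]
  refine ⟨Matrix.det (Matrix.of c), fun h0 => ?_, fun P hP => ?_⟩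
  · have := hdet P₀
    rw [hB, h0] at this
    simp at this
  · rw [hdet] at hP
    refine finrank_le_of_functionals _ Λ fun x hx hx0 => ?_
    simp only [Submodule.mem_iInf, LinearMap.mem_ker] at hx
    have : F P x = 0 := by rw [hF, hx0]; ext i <;> simp [hx]
    have h3 := LinearMap.ker_eq_bot.2 (LinearMap.equivOfDetNeZero _ hP).injective
    rw [LinearMap.ker_eq_bot'] at h3
    refine h3 x ?_
    change B (F P x) = 0
    rw [this, map_zero]

/-- Upper semicontinuity of the dimension of the solution space of linear conditions depending
polynomially on parameters. -/
theorem Gen.finrank_inf_le {M ι : Type} [AddCommGroup M] [Module K M] [Fintype ι]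
    (F : Submodule K M) [FiniteDimensional K F] (Φ : ι → (τ → K) → M →ₗ[K] K)
    (hΦ : ∀ i, ∀ x ∈ F, ∃ c : MvPolynomial τ K, ∀ P, Φ i P x = eval P c) {r : ℕ} (P₀ : τ → K)
    (h : Module.finrank K (F ⊓ ⨅ i, LinearMap.ker (Φ i P₀) : Submodule K M) ≤ r) :
    Gen K fun P => Module.finrank K (F ⊓ ⨅ i, LinearMap.ker (Φ i P) : Submodule K M) ≤ r := by
  have key : ∀ P, Module.finrank K (F ⊓ ⨅ i, LinearMap.ker (Φ i P) : Submodule K M) =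
      Module.finrank K (⨅ i, LinearMap.ker ((Φ i P).domRestrict F) : Submodule K F) := by
    intro P
    have : (F ⊓ ⨅ i, LinearMap.ker (Φ i P) : Submodule K M) =
        (⨅ i, LinearMap.ker ((Φ i P).domRestrict F) : Submodule K F).map F.subtype := by
      ext x
      simp [Submodule.mem_iInf, and_comm]
    rw [this]
    exact Submodule.finrank_map_subtype_eq _ _
  simp only [key] at h ⊢
  exact Gen.finrank_iInf_ker_le (fun i P => (Φ i P).domRestrict F) (fun i x => hΦ i x x.2) P₀ h

end Gen

/-- A function on affine space given by a polynomial. -/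
def PolyFun (K : Type) [Field K] {τ : Type} (F : (τ → K) → K) : Prop :=
  ∃ c : MvPolynomial τ K, ∀ P, F P = eval P c

section PolyFun
variable {K : Type} [Field K] {τ : Type}

theorem PolyFun.const (a : K) : PolyFun K fun _ : τ → K => a := ⟨C a, fun P => by simp⟩

theorem PolyFun.coord (i : τ) : PolyFun K fun P : τ → K => P i := ⟨X i, fun P => by simp⟩

theorem PolyFun.add {F G : (τ → K) → K} (hF : PolyFun K F) (hG : PolyFun K G) :
    PolyFun K fun P => F P + G P := by
  obtain ⟨c, hc⟩ := hF
  obtain ⟨e, he⟩ := hG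
  exact ⟨c + e, fun P => by simp [hc, he]⟩

theorem PolyFun.mul {F G : (τ → K) → K} (hF : PolyFun K F) (hG : PolyFun K G) :
    PolyFun K fun P => F P * G P := by
  obtain ⟨c, hc⟩ := hF
  obtain ⟨e, he⟩ := hG
  exact ⟨c * e, fun P => by simp [hc, he]⟩

theorem PolyFun.sum {ι : Type} (s : Finset ι) {F : ι → (τ → K) → K}
    (hF : ∀ i, PolyFun K (F i)) : PolyFun K fun P => ∑ i ∈ s, F i P := by
  choose c hc using hF
  exact ⟨∑ i ∈ s, c i, fun P => by simp [hc]⟩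

theorem PolyFun.eval {σ : Type} {p : σ → (τ → K) → K} (hp : ∀ i, PolyFun K (p i))
    (f : MvPolynomial σ K) : PolyFun K fun P => MvPolynomial.eval (fun i => p i P) f := by
  choose c hc using hp
  refine ⟨bind₁ c f, fun P => ?_⟩
  simp only [hc]
  rw [← MvPolynomial.coe_aeval_eq_eval P, ← MvPolynomial.coe_aeval_eq_eval]
  simp only [RingHom.coe_coe, aeval_bind₁]

theorem PolyFun.fin_cons {n : ℕ} {t : (τ → K) → K} {p : Fin n → (τ → K) → K}
    (ht : PolyFun K t) (hp : ∀ i, PolyFun K (p i)) (i : Fin (n + 1)) :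
    PolyFun K fun P => (Fin.cons (t P) (fun j => p j P) : Fin (n + 1) → K) i := by
  refine Fin.cases ?_ (fun j => ?_) i
  · simpa using ht
  · simpa using hp j

end PolyFun

section Forms
variable {K : Type} [Field K] {σ : Type}

/-- The value (`none`) and the partial derivatives (`some j`) of a polynomial at a point. -/
def jet (p : σ → K) : Option σ → MvPolynomial σ K →ₗ[K] K
  | none => (aeval p).toLinearMap
  | some j => (aeval p).toLinearMap ∘ₗ (pderiv j).toLinearMap

@[simp] theorem jet_none (p : σ → K) (f : MvPolynomial σ K) : jet p none f = eval p f := by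
  simp [jet]

@[simp] theorem jet_some (p : σ → K) (j : σ) (f : MvPolynomial σ K) :
    jet p (some j) f = eval p (pderiv j f) := by
  simp [jet]

/-- Forms of degree `d` singular at all the points `P i`. -/
def singForms {ι : Type} (d : ℕ) (P : ι → σ → K) : Submodule K (MvPolynomial σ K) :=
  homogeneousSubmodule σ K d ⊓ ⨅ x : ι × Option σ, LinearMap.ker (jet (P x.1) x.2)

theorem mem_singForms {ι : Type} {d : ℕ} {P : ι → σ → K} {f : MvPolynomial σ K} :
    f ∈ singForms d P ↔ f.IsHomogeneous d ∧
      ∀ i, eval (P i) f = 0 ∧ ∀ j, eval (P i) (pderiv j f) = 0 := by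
  simp only [singForms, Submodule.mem_inf, mem_homogeneousSubmodule, Submodule.mem_iInf,
    LinearMap.mem_ker, Prod.forall, Option.forall, jet_none, jet_some]

instance finite_homogeneousSubmodule [Finite σ] (d : ℕ) :
    FiniteDimensional K (homogeneousSubmodule σ K d) :=
  Module.Finite.iff_fg.2 (homogeneousSubmodule_fg σ K d)

instance finite_singForms [Finite σ] {ι : Type} (d : ℕ) (P : ι → σ → K) :
    FiniteDimensional K (singForms d P) :=
  Submodule.finiteDimensional_of_le inf_le_left

theorem finrank_le_of_le {M : Type} [AddCommGroup M] [Module K M] {A B F : Submodule K M}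
    [FiniteDimensional K F] (hBF : B ≤ F) (h : A ≤ B) :
    Module.finrank K A ≤ Module.finrank K B :=
  have := Submodule.finiteDimensional_of_le hBF
  Submodule.finrank_mono h

theorem finrank_le_inf_iInf_ker_add {M : Type} [AddCommGroup M] [Module K M]
    (F : Submodule K M) [FiniteDimensional K F] {ι : Type} [Fintype ι] (e : ι → M →ₗ[K] K) :
    Module.finrank K F ≤
      Module.finrank K (F ⊓ ⨅ i, LinearMap.ker (e i) : Submodule K M) + Fintype.card ι := by
  have h1 := LinearMap.finrank_range_add_finrank_ker ((LinearMap.pi e).domRestrict F)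
  have h2 : Module.finrank K (LinearMap.range ((LinearMap.pi e).domRestrict F)) ≤
      Fintype.card ι := by
    simpa using Submodule.finrank_le (LinearMap.range ((LinearMap.pi e).domRestrict F))
  have h3 : (F ⊓ ⨅ i, LinearMap.ker (e i) : Submodule K M) =
      (LinearMap.ker ((LinearMap.pi e).domRestrict F)).map F.subtype := by
    ext x
    simp [Submodule.mem_iInf, LinearMap.pi_apply, funext_iff, and_comm]
  rw [h3, Submodule.finrank_map_subtype_eq]
  omega

/-- Successively chosen functionals from a family cut the dimension down by one at each step,
until the common kernel of the whole family is reached. -/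
theorem exists_finrank_inf_ker_le {M X : Type} [AddCommGroup M] [Module K M]
    (F : Submodule K M) [FiniteDimensional K F] (e : X → M →ₗ[K] K) [Nonempty X] {b c : ℕ}
    (hb : Module.finrank K F ≤ b)
    (hc : Module.finrank K (F ⊓ ⨅ x, LinearMap.ker (e x) : Submodule K M) ≤ c) (u : ℕ) :
    ∃ x : Fin u → X,
      Module.finrank K (F ⊓ ⨅ i, LinearMap.ker (e (x i)) : Submodule K M) ≤ max (b - u) c := by
  induction u with
  | zero =>
    refine ⟨Fin.elim0, ?_⟩
    refine (finrank_le_of_le le_rfl inf_le_left).trans (hb.trans ?_)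
    simp
  | succ u ih =>
    obtain ⟨x, hx⟩ := ih
    set G : Submodule K M := F ⊓ ⨅ i, LinearMap.ker (e (x i)) with hG
    have hGF : G ≤ F := inf_le_left
    have : FiniteDimensional K G := Submodule.finiteDimensional_of_le hGF
    have key : ∀ y, (F ⊓ ⨅ i, LinearMap.ker (e ((Fin.cons y x : Fin (u + 1) → X) i)) :
        Submodule K M) ≤ G ⊓ LinearMap.ker (e y) := by
      intro y g hg
      simp only [Submodule.mem_inf, Submodule.mem_iInf, hG] at hg ⊢
      exact ⟨⟨hg.1, fun i => by simpa using hg.2 i.succ⟩, by simpa using hg.2 0⟩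
    by_cases h : ∃ y, ∃ g ∈ G, e y g ≠ 0
    · obtain ⟨y, g, hg, hne⟩ := h
      refine ⟨Fin.cons y x, ?_⟩
      have h1 : Module.finrank K (G ⊓ LinearMap.ker (e y) : Submodule K M) <
          Module.finrank K G := by
        refine Submodule.finrank_lt_finrank_of_lt (lt_of_le_of_ne inf_le_left fun h0 => hne ?_)
        rw [← h0] at hg
        exact hg.2
      have h2 := finrank_le_of_le (F := G) inf_le_left (key y)
      omega
    · push Not at h
      obtain ⟨y⟩ := ‹Nonempty X›
      refine ⟨Fin.cons y x, le_max_of_le_right (le_trans ?_ hc)⟩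
      refine finrank_le_of_le (F := F) inf_le_left fun g hg => ?_
      have hgG := (key y hg).1
      exact ⟨hgG.1, (Submodule.mem_iInf _).2 fun y => h y g hgG⟩

theorem Gen.singForms_le {τ ι : Type} [Fintype ι] [Fintype σ] {d r : ℕ}
    (p : ι → σ → (τ → K) → K) (hp : ∀ i j, PolyFun K (p i j)) (P₀ : τ → K)
    (h : Module.finrank K (singForms d fun i j => p i j P₀) ≤ r) :
    Gen K fun P => Module.finrank K (singForms d fun i j => p i j P) ≤ r := by
  refine Gen.finrank_inf_le _ (fun (x : ι × Option σ) P => jet (fun j => p x.1 j P) x.2)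
    (fun x f _ => ?_) P₀ h
  obtain ⟨i, _ | j⟩ := x
  · simp only [jet_none]
    exact PolyFun.eval (hp i) f
  · simp only [jet_some]
    exact PolyFun.eval (hp i) (pderiv j f)

theorem singForms_mono_of_surj {ι ι' : Type} {d : ℕ} (P : ι → σ → K) (P' : ι' → σ → K)
    (h : ∀ i, ∃ j, P' j = P i) : singForms d P' ≤ singForms d P := by
  intro f hf
  rw [mem_singForms] at hf ⊢
  refine ⟨hf.1, fun i => ?_⟩
  obtain ⟨j, hj⟩ := h i
  rw [← hj]
  exact hf.2 j

theorem finrank_singForms_le_of_surj [Finite σ] {ι ι' : Type} {d r : ℕ} (P : ι → σ → K)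
    (P' : ι' → σ → K) (h : ∀ i, ∃ j, P' j = P i) (hr : Module.finrank K (singForms d P) ≤ r) :
    Module.finrank K (singForms d P') ≤ r :=
  (finrank_le_of_le (F := homogeneousSubmodule σ K d) inf_le_left
    (singForms_mono_of_surj P P' h)).trans hr

variable (K) in
/-- Some choice of `q` points imposes enough singularities on forms of degree `d` in `n`
variables to leave a space of dimension at most `r`. -/
def Bd (n d q r : ℕ) : Prop :=
  ∃ P : Fin q → Fin n → K, Module.finrank K (singForms d P) ≤ r

theorem Bd.exists_of_card {n d q r : ℕ} (h : Bd K n d q r) {ι : Type} [Fintype ι]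
    (hι : Fintype.card ι = q) :
    ∃ P : ι → Fin n → K, Module.finrank K (singForms d P) ≤ r := by
  obtain ⟨P, hP⟩ := h
  subst hι
  refine ⟨fun i => P (Fintype.equivFin ι i), le_trans ?_ hP⟩
  exact finrank_le_of_le inf_le_left
    (singForms_mono_of_surj _ _ fun i => ⟨(Fintype.equivFin ι).symm i, by simp⟩)

theorem Bd.of_exists {n d q r : ℕ} {ι : Type} [Fintype ι] (hι : Fintype.card ι = q)
    (P : ι → Fin n → K) (h : Module.finrank K (singForms d P) ≤ r) : Bd K n d q r := by
  subst hι
  refine ⟨fun i => P ((Fintype.equivFin ι).symm i), le_trans ?_ h⟩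
  exact finrank_le_of_le inf_le_left
    (singForms_mono_of_surj _ _ fun i => ⟨Fintype.equivFin ι i, by simp⟩)

theorem Bd.mono {n d q r r' : ℕ} (h : Bd K n d q r) (hr : r ≤ r') : Bd K n d q r' := by
  obtain ⟨P, hP⟩ := h
  exact ⟨P, hP.trans hr⟩

theorem Bd.gen {n d q r : ℕ} (h : Bd K n d q r) {τ ι : Type} [Fintype ι]
    (hι : Fintype.card ι = q) (x : ι × Fin n → τ) (hx : Function.Injective x) :
    Gen K fun P : τ → K => Module.finrank K (singForms d fun i j => P (x (i, j))) ≤ r := by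
  obtain ⟨Q, hQ⟩ := h.exists_of_card hι
  refine Gen.singForms_le (fun i j P => P (x (i, j))) (fun i j => PolyFun.coord _)
    (Function.extend x (fun y => Q y.1 y.2) 0) ?_
  have : (fun i j => Function.extend x (fun y => Q y.1 y.2) 0 (x (i, j))) = Q := by
    ext i j
    rw [hx.extend_apply]
  rwa [this]

end Forms

section Decomp
variable {K : Type} [Field K]

theorem finrank_le_of_mapsTo {M N : Type} [AddCommGroup M] [Module K M] [AddCommGroup N]
    [Module K N] {W : Submodule K M} {W' : Submodule K N} [FiniteDimensional K W'] (T : M →ₗ[K] N)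
    (h : ∀ x ∈ W, T x ∈ W') (hinj : ∀ x ∈ W, T x = 0 → x = 0) :
    Module.finrank K W ≤ Module.finrank K W' := by
  refine LinearMap.finrank_le_finrank_of_injective (f := T.restrict h) ?_
  rw [← LinearMap.ker_eq_bot, LinearMap.ker_eq_bot']
  intro x hx
  exact Subtype.ext (hinj x x.2 (congrArg Subtype.val hx))

theorem finrank_le_of_surjOn {M N : Type} [AddCommGroup M] [Module K M] [AddCommGroup N]
    [Module K N] {W : Submodule K M} {W' : Submodule K N} [FiniteDimensional K W] (T : M →ₗ[K] N)
    (h : ∀ y ∈ W', ∃ x ∈ W, T x = y) :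
    Module.finrank K W' ≤ Module.finrank K W :=
  (Submodule.finrank_mono (t := W.map T) fun y hy => h y hy).trans (Submodule.finrank_map_le _ _)

theorem finrank_le_add_of_maps {M N N' : Type} [AddCommGroup M] [Module K M] [AddCommGroup N]
    [Module K N] [AddCommGroup N'] [Module K N'] {W : Submodule K M} {A : Submodule K N}
    {B : Submodule K N'} [FiniteDimensional K W] [FiniteDimensional K A] [FiniteDimensional K B]
    (T : M →ₗ[K] N) (T' : M →ₗ[K] N') (hA : ∀ x ∈ W, T x ∈ A) (hB : ∀ x ∈ W, T x = 0 → T' x ∈ B)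
    (hinj : ∀ x ∈ W, T x = 0 → T' x = 0 → x = 0) :
    Module.finrank K W ≤ Module.finrank K A + Module.finrank K B := by
  rw [← LinearMap.finrank_range_add_finrank_ker (T.restrict hA)]
  refine add_le_add (Submodule.finrank_le _) ?_
  let S : LinearMap.ker (T.restrict hA) →ₗ[K] B :=
    ((T' ∘ₗ W.subtype) ∘ₗ (LinearMap.ker (T.restrict hA)).subtype).codRestrict B fun x =>
      hB x.1 x.1.2 (congrArg Subtype.val x.2)
  refine LinearMap.finrank_le_finrank_of_injective (f := S) ?_
  rw [← LinearMap.ker_eq_bot, LinearMap.ker_eq_bot']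
  intro x hx
  exact Subtype.ext (Subtype.ext (hinj x.1 x.1.2 (congrArg Subtype.val x.2)
    (congrArg Subtype.val hx)))

theorem exists_rename_add_X_mul {n : ℕ} (f : MvPolynomial (Fin (n + 1)) K) :
    ∃ g, f = rename Fin.succ (aeval (Fin.cons 0 X : Fin (n + 1) → MvPolynomial (Fin n) K) f) +
      X 0 * g := by
  induction f using MvPolynomial.induction_on with
  | C a => exact ⟨0, by simp [algebraMap_eq]⟩
  | add p q hp hq =>
    obtain ⟨g, hg⟩ := hp
    obtain ⟨g', hg'⟩ := hq
    refine ⟨g + g', ?_⟩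
    nth_rewrite 1 [hg, hg']
    simp only [map_add]
    ring
  | mul_X p i hp =>
    obtain ⟨g, hg⟩ := hp
    refine Fin.cases ?_ (fun j => ?_) i
    · exact ⟨p, by simp [mul_comm]⟩
    · refine ⟨g * X j.succ, ?_⟩
      nth_rewrite 1 [hg]
      simp only [map_mul, aeval_X, Fin.cons_succ, rename_X]
      ring

theorem IsHomogeneous.of_X_mul {σ : Type} {i : σ} {g : MvPolynomial σ K} {d : ℕ}
    (h : (X i * g).IsHomogeneous (d + 1)) : g.IsHomogeneous d := by
  intro m hm
  have h1 : coeff (Finsupp.single i 1 + m) (X i * g) ≠ 0 := by rwa [coeff_X_mul]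
  have := h h1
  simp only [map_add, Finsupp.weight_single, Pi.one_apply, smul_eq_mul] at this
  omega

theorem exists_decomp {n d : ℕ} {f : MvPolynomial (Fin (n + 1)) K} (hf : f.IsHomogeneous (d + 1)) :
    ∃ (φ : MvPolynomial (Fin n) K) (g : MvPolynomial (Fin (n + 1)) K),
      φ.IsHomogeneous (d + 1) ∧ g.IsHomogeneous d ∧ f = rename Fin.succ φ + X 0 * g := by
  obtain ⟨g, hg⟩ := exists_rename_add_X_mul f
  set φ := aeval (Fin.cons 0 X : Fin (n + 1) → MvPolynomial (Fin n) K) f with hφ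
  have h1 : φ.IsHomogeneous (d + 1) := by
    have := hf.aeval (Fin.cons 0 X : Fin (n + 1) → MvPolynomial (Fin n) K) (n := 1) (fun i => by
      refine Fin.cases ?_ (fun j => ?_) i
      · simpa using isHomogeneous_zero _ _ _
      · simpa using isHomogeneous_X _ _)
    rwa [one_mul] at this
  refine ⟨φ, g, h1, IsHomogeneous.of_X_mul (i := 0) ?_, hg⟩
  have h2 : X 0 * g = f - rename Fin.succ φ := by
    nth_rewrite 1 [hg]
    ring
  rw [h2]
  exact hf.sub h1.rename_isHomogeneous

@[simp] theorem eval_cons_rename {n : ℕ} (t : K) (p : Fin n → K) (φ : MvPolynomial (Fin n) K) :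
    eval (Fin.cons t p : Fin (n + 1) → K) (rename Fin.succ φ) = eval p φ := by
  rw [eval_rename]
  congr 1

@[simp] theorem pderiv_succ_rename {n : ℕ} (j : Fin n) (φ : MvPolynomial (Fin n) K) :
    pderiv j.succ (rename Fin.succ φ) = rename Fin.succ (pderiv j φ) :=
  pderiv_rename (Fin.succ_injective n) j φ

@[simp] theorem pderiv_zero_rename {n : ℕ} (φ : MvPolynomial (Fin n) K) :
    pderiv 0 (rename Fin.succ φ : MvPolynomial (Fin (n + 1)) K) = 0 := by
  induction φ using MvPolynomial.induction_on with
  | C a => simp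
  | add p q hp hq => simp [hp, hq]
  | mul_X p i hp => simp [hp, pderiv_X, Derivation.leibniz]

theorem eval_eq_zero_of_forall_cons [Infinite K] {n : ℕ} {g : MvPolynomial (Fin (n + 1)) K} {d : ℕ}
    (hg : g.IsHomogeneous (d + 1))
    (h : ∀ p : Fin n → K, eval (Fin.cons 0 p : Fin (n + 1) → K) g = 0) :
    ∃ g', g'.IsHomogeneous d ∧ g = X 0 * g' := by
  obtain ⟨φ, g', _, hg', rfl⟩ := exists_decomp hg
  have : φ = 0 := MvPolynomial.funext fun p => by simpa using h p
  exact ⟨g', hg', by simp [this]⟩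

end Decomp

section LinearChange
variable {K : Type} [Field K] {n : ℕ}

/-- Substitution of linear forms. -/
def linSubst (A : (Fin n → K) →ₗ[K] (Fin n → K)) : MvPolynomial (Fin n) K →ₐ[K]
    MvPolynomial (Fin n) K :=
  aeval fun i => ∑ j, C (A (Pi.single j 1) i) * X j

theorem eval_linSubst (A : (Fin n → K) →ₗ[K] (Fin n → K)) (p : Fin n → K)
    (f : MvPolynomial (Fin n) K) : eval p (linSubst A f) = eval (A p) f := by
  have h : ∀ i, ∑ j, A (Pi.single j 1) i * p j = A p i := by
    intro i
    have := LinearMap.pi_apply_eq_sum_univ (LinearMap.proj i ∘ₗ A) p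
    simp only [LinearMap.comp_apply, LinearMap.proj_apply, smul_eq_mul] at this
    rw [this]
    refine Finset.sum_congr rfl fun j _ => ?_
    rw [mul_comm]
    congr 2
    refine congrFun (congrArg A ?_) i
    ext k
    simp [Pi.single_apply, eq_comm]
  induction f using MvPolynomial.induction_on with
  | C a => simp [linSubst, algebraMap_eq]
  | add p q hp hq => simp [hp, hq]
  | mul_X q i hq => rw [map_mul, map_mul, hq, map_mul]; simp [linSubst, h]

theorem pderiv_linSubst (A : (Fin n → K) →ₗ[K] (Fin n → K)) (j : Fin n)
    (f : MvPolynomial (Fin n) K) :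
    pderiv j (linSubst A f) = ∑ i, C (A (Pi.single j 1) i) * linSubst A (pderiv i f) := by
  induction f using MvPolynomial.induction_on with
  | C a => simp [linSubst, algebraMap_eq]
  | add p q hp hq => simp [hp, hq, mul_add, Finset.sum_add_distrib]
  | mul_X q i hq =>
    have hX : pderiv j (linSubst A (X i)) = C (A (Pi.single j 1) i) := by
      simp [linSubst, pderiv_X, Pi.single_apply]
    simp only [map_mul, Derivation.leibniz, hq, hX, smul_eq_mul, map_add, mul_add,
      Finset.sum_add_distrib, pderiv_X, Pi.single_apply, Finset.mul_sum]
    congr 1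
    · simp only [mul_ite, mul_zero, apply_ite (linSubst A), map_zero]
      simp [mul_comm]
    · exact Finset.sum_congr rfl fun k _ => by ring

theorem linSubst_isHomogeneous (A : (Fin n → K) →ₗ[K] (Fin n → K)) {f : MvPolynomial (Fin n) K}
    {d : ℕ} (hf : f.IsHomogeneous d) : (linSubst A f).IsHomogeneous d := by
  have := hf.aeval (fun i => ∑ j, C (A (Pi.single j 1) i) * X j) (n := 1) (fun i =>
    IsHomogeneous.sum _ _ _ fun j _ => by
      simpa using (isHomogeneous_C _ _).mul (isHomogeneous_X K j))
  rwa [one_mul] at this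

theorem finrank_singForms_linearEquiv [Infinite K] {ι : Type} {d : ℕ}
    (A : (Fin n → K) ≃ₗ[K] (Fin n → K)) (P : ι → Fin n → K) :
    Module.finrank K (singForms d fun i => A (P i)) ≤ Module.finrank K (singForms d P) := by
  refine finrank_le_of_mapsTo (linSubst A.toLinearMap).toLinearMap (fun f hf => ?_)
    (fun f _ h0 => MvPolynomial.funext fun p => ?_)
  · rw [mem_singForms] at hf ⊢
    refine ⟨linSubst_isHomogeneous _ hf.1, fun i => ⟨?_, fun j => ?_⟩⟩
    · simpa [eval_linSubst] using (hf.2 i).1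
    · have := (hf.2 i).2
      simp only [AlgHom.toLinearMap_apply, pderiv_linSubst, map_sum, map_mul, eval_linSubst,
        LinearEquiv.coe_coe, this, mul_zero, Finset.sum_const_zero]
  · have := congrArg (eval (A.symm p)) h0
    simpa [eval_linSubst] using this

theorem exists_linearEquiv_zero_coord {ε : ℕ} (hε : ε ≤ n) (P : Fin ε → Fin (n + 1) → K) :
    ∃ A : (Fin (n + 1) → K) ≃ₗ[K] (Fin (n + 1) → K), ∀ i, A (P i) 0 = 0 := by
  obtain ⟨l, hl0, hl⟩ : ∃ l : Fin (n + 1) → K, l ≠ 0 ∧ ∀ i, ∑ j, P i j * l j = 0 := by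
    have : ¬ Function.Injective (Matrix.toLin' (Matrix.of P)) := fun h => by
      have := LinearMap.finrank_le_finrank_of_injective h
      simp at this
      omega
    rw [← LinearMap.ker_eq_bot, LinearMap.ker_eq_bot'] at this
    push Not at this
    obtain ⟨l, hl, hl0⟩ := this
    refine ⟨l, hl0, fun i => ?_⟩
    have := congrFun hl i
    simpa [Matrix.mulVec, dotProduct] using this
  obtain ⟨k, hk⟩ := Function.ne_iff.1 hl0
  let A : (Fin (n + 1) → K) →ₗ[K] (Fin (n + 1) → K) := LinearMap.pi fun i =>
    if i = 0 then ∑ j, l j • LinearMap.proj j else if i = k then LinearMap.proj 0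
      else LinearMap.proj i
  have hA0 : ∀ x, A x 0 = ∑ j, x j * l j := by
    intro x
    simp [A, mul_comm]
  have hinj : Function.Injective A := by
    rw [← LinearMap.ker_eq_bot, LinearMap.ker_eq_bot']
    intro x hx
    have h1 : ∀ i, i ≠ k → x i = 0 := by
      intro i hi
      by_cases h0 : i = 0
      · subst h0
        have := congrFun hx k
        simpa [A, hi, Ne.symm hi] using this
      · have := congrFun hx i
        simpa [A, h0, hi] using this
    have h2 := congrFun hx 0
    rw [hA0, Finset.sum_eq_single k (fun i _ hi => by simp [h1 i hi]) (by simp)] at h2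
    ext i
    by_cases hi : i = k
    · subst hi
      exact (mul_eq_zero.1 h2).resolve_right hk
    · exact h1 i hi
  refine ⟨LinearEquiv.ofInjectiveEndo A hinj, fun i => ?_⟩
  simpa [hA0] using hl i

end LinearChange

section Horace
variable {K : Type} [Field K] [Infinite K]

theorem exists_trace {n d u a ε : ℕ} (h : Bd K n (d + 1) u a) :
    ∃ (U : Fin u → Fin n → K) (E : Fin ε → Fin n → K),
      Module.finrank K (singForms (d + 1) U ⊓ ⨅ i, LinearMap.ker (jet (E i) none) :
        Submodule K (MvPolynomial (Fin n) K)) ≤ a - ε := by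
  obtain ⟨U, hU⟩ := h
  obtain ⟨E, hE⟩ := exists_finrank_inf_ker_le (singForms (d + 1) U)
    (fun p : Fin n → K => jet p none) hU (c := 0) (by
      rw [Nat.le_zero, Submodule.finrank_eq_zero, eq_bot_iff]
      intro f hf
      refine MvPolynomial.funext fun p => ?_
      have := (Submodule.mem_iInf _).1 hf.2 p
      simpa using this) ε
  exact ⟨U, E, by simpa using hE⟩

theorem exists_residual {n e u ε z b c : ℕ} (hε : ε ≤ n) (hb : Bd K (n + 1) (e + 1) (ε + z) b)
    (hc : Bd K (n + 1) e z c) :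
    ∃ (U : Fin u → Fin n → K) (E : Fin ε → Fin n → K) (Z : Fin z → Fin (n + 1) → K),
      Module.finrank K ((singForms (e + 1) Z ⊓ ⨅ x : Fin ε × Option (Fin n),
          LinearMap.ker (jet (Fin.cons 0 (E x.1) : Fin (n + 1) → K) (x.2.map Fin.succ))) ⊓
        ⨅ i, LinearMap.ker (jet (Fin.cons 0 (U i) : Fin (n + 1) → K) none) :
        Submodule K (MvPolynomial (Fin (n + 1)) K)) ≤ max (b + ε - u) c := by
  -- general points of the pool, the first family being forced into the hyperplane
  have h1 : Gen K fun P : (Fin ε × Fin n) ⊕ (Fin z × Fin (n + 1)) → K =>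
      Module.finrank K (singForms (e + 1) fun (i : Fin ε ⊕ Fin z) =>
        Sum.elim (fun i => (Fin.cons 0 fun j => P (Sum.inl (i, j)) : Fin (n + 1) → K))
          (fun i j => P (Sum.inr (i, j))) i) ≤ b := by
    obtain ⟨Q, hQ⟩ := hb.exists_of_card (ι := Fin ε ⊕ Fin z) (by simp)
    obtain ⟨A, hA⟩ := exists_linearEquiv_zero_coord hε fun i => Q (Sum.inl i)
    refine Gen.singForms_le
      (fun (i : Fin ε ⊕ Fin z) (j : Fin (n + 1)) (P : _ → K) =>
        Sum.elim (fun i => (Fin.cons 0 fun j => P (Sum.inl (i, j)) : Fin (n + 1) → K))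
          (fun i j => P (Sum.inr (i, j))) i j) ?_
      (Sum.elim (fun x => A (Q (Sum.inl x.1)) x.2.succ) (fun x => A (Q (Sum.inr x.1)) x.2)) ?_
    · rintro (i | i) j
      · exact PolyFun.fin_cons (PolyFun.const 0) (fun j => PolyFun.coord _) j
      · exact PolyFun.coord _
    · refine finrank_singForms_le_of_surj (fun i => A (Q i)) _ (fun i => ⟨i, ?_⟩)
        ((finrank_singForms_linearEquiv A Q).trans hQ)
      obtain i | i := i
      · ext j
        refine Fin.cases ?_ (fun j => ?_) j
        · simp [hA]
        · simp
      · ext j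
        simp
  have h2 : Gen K fun P : (Fin ε × Fin n) ⊕ (Fin z × Fin (n + 1)) → K =>
      Module.finrank K (singForms e fun (i : Fin z) j => P (Sum.inr (i, j))) ≤ c :=
    hc.gen (by simp) Sum.inr Sum.inr_injective
  have h3 : Gen K fun P : (Fin ε × Fin n) ⊕ (Fin z × Fin (n + 1)) → K =>
      ∀ i : Fin z, P (Sum.inr (i, 0)) ≠ 0 := Gen.forall_fin fun i => Gen.ne_zero _
  obtain ⟨P, ⟨hP1, hP2⟩, hP3⟩ := ((h1.and h2).and h3).exists
  set E : Fin ε → Fin n → K := fun i j => P (Sum.inl (i, j)) with hE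
  set Z : Fin z → Fin (n + 1) → K := fun i j => P (Sum.inr (i, j)) with hZ
  set G : Submodule K (MvPolynomial (Fin (n + 1)) K) := singForms (e + 1) Z ⊓
    ⨅ x : Fin ε × Option (Fin n),
      LinearMap.ker (jet (Fin.cons 0 (E x.1) : Fin (n + 1) → K) (x.2.map Fin.succ)) with hG
  have : FiniteDimensional K G := Submodule.finiteDimensional_of_le inf_le_left
  have hmem : ∀ g, g ∈ G ↔ g ∈ singForms (e + 1) Z ∧ ∀ i,
      eval (Fin.cons 0 (E i) : Fin (n + 1) → K) g = 0 ∧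
      ∀ j : Fin n, eval (Fin.cons 0 (E i) : Fin (n + 1) → K) (pderiv j.succ g) = 0 := by
    intro g
    simp [hG, Submodule.mem_iInf, Option.forall]
  have hGb : Module.finrank K G ≤ b + ε := by
    refine (finrank_le_inf_iInf_ker_add G fun i : Fin ε =>
      jet (Fin.cons 0 (E i) : Fin (n + 1) → K) (some 0)).trans ?_
    rw [Fintype.card_fin]
    refine Nat.add_le_add_right (le_trans ?_ hP1) ε
    refine finrank_le_of_le inf_le_left fun g hg => ?_
    rw [Submodule.mem_inf, hmem, mem_singForms, Submodule.mem_iInf] at hg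
    rw [mem_singForms]
    refine ⟨hg.1.1.1, ?_⟩
    rintro (i | i)
    · refine ⟨(hg.1.2 i).1, fun j => ?_⟩
      refine Fin.cases ?_ (fun j => ?_) j
      · simpa using hg.2 i
      · exact (hg.1.2 i).2 j
    · exact hg.1.1.2 i
  have hGc : Module.finrank K (G ⊓ ⨅ p : Fin n → K,
      LinearMap.ker (jet (Fin.cons 0 p : Fin (n + 1) → K) none) :
      Submodule K (MvPolynomial (Fin (n + 1)) K)) ≤ c := by
    refine le_trans ?_ hP2
    refine finrank_le_of_surjOn (LinearMap.mulLeft K (X 0)) fun g hg => ?_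
    simp only [Submodule.mem_inf, hmem, mem_singForms, Submodule.mem_iInf, LinearMap.mem_ker,
      jet_none] at hg
    obtain ⟨g', hg', rfl⟩ := eval_eq_zero_of_forall_cons hg.1.1.1 hg.2
    refine ⟨g', mem_singForms.2 ⟨hg', fun i => ?_⟩, rfl⟩
    have h0 : eval (Z i) g' = 0 := by
      have := (hg.1.1.2 i).1
      simpa [hZ, hP3 i] using this
    refine ⟨h0, fun j => ?_⟩
    have := (hg.1.1.2 i).2 j
    simp only [Derivation.leibniz, smul_eq_mul, map_add, map_mul, h0, zero_mul, add_zero,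
      eval_X] at this
    exact (mul_eq_zero.1 this).resolve_left (hP3 i)
  obtain ⟨U, hU⟩ := exists_finrank_inf_ker_le G _ hGb hGc u
  exact ⟨U, E, Z, hU⟩

/-- The degenerate position: the first-order limit of the singularity conditions when the points
`E` move into the hyperplane containing `U`. -/
theorem Bd.of_degenerate {n e u ε z a b : ℕ} (U : Fin u → Fin n → K) (E : Fin ε → Fin n → K)
    (Z : Fin z → Fin (n + 1) → K) (hZ : ∀ i, Z i 0 ≠ 0)
    (ha : Module.finrank K (singForms (e + 2) U ⊓ ⨅ i, LinearMap.ker (jet (E i) none) :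
      Submodule K (MvPolynomial (Fin n) K)) ≤ a)
    (hb : Module.finrank K ((singForms (e + 1) Z ⊓ ⨅ x : Fin ε × Option (Fin n),
          LinearMap.ker (jet (Fin.cons 0 (E x.1) : Fin (n + 1) → K) (x.2.map Fin.succ))) ⊓
        ⨅ i, LinearMap.ker (jet (Fin.cons 0 (U i) : Fin (n + 1) → K) none) :
        Submodule K (MvPolynomial (Fin (n + 1)) K)) ≤ b) :
    Bd K (n + 1) (e + 2) (u + (ε + z)) (a + b) := by
  let F : Submodule K (MvPolynomial (Fin n) K × MvPolynomial (Fin (n + 1)) K) :=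
    (homogeneousSubmodule (Fin n) K (e + 2)).prod (homogeneousSubmodule (Fin (n + 1)) K (e + 1))
  have : FiniteDimensional K F := by
    refine FiniteDimensional.of_injective
      (LinearMap.codRestrict (homogeneousSubmodule (Fin n) K (e + 2))
        (LinearMap.fst K _ _ ∘ₗ F.subtype)
        (fun x => x.2.1) |>.prod (LinearMap.codRestrict
          (homogeneousSubmodule (Fin (n + 1)) K (e + 1)) (LinearMap.snd K _ _ ∘ₗ F.subtype) fun x => x.2.2)) fun x y hxy => ?_
    have h1 := congrArg (fun z => (z.1 : MvPolynomial (Fin n) K)) hxy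
    have h2 := congrArg (fun z => (z.2 : MvPolynomial (Fin (n + 1)) K)) hxy
    exact Subtype.ext (Prod.ext h1 h2)
  let f₁ : (MvPolynomial (Fin n) K × MvPolynomial (Fin (n + 1)) K) →ₗ[K]
      MvPolynomial (Fin n) K := LinearMap.fst K _ _
  let f₂ : (MvPolynomial (Fin n) K × MvPolynomial (Fin (n + 1)) K) →ₗ[K]
      MvPolynomial (Fin (n + 1)) K := LinearMap.snd K _ _
  let ET (t : Unit → K) (i : Fin ε) : Fin (n + 1) → K := Fin.cons (t ()) (E i)
  let Φ (x : (Fin ε × Option (Fin n)) ⊕ Fin ε ⊕ (Fin u × Option (Fin n)) ⊕ Fin u ⊕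
      (Fin z × Option (Fin n)) ⊕ Fin z) (t : Unit → K) :
      (MvPolynomial (Fin n) K × MvPolynomial (Fin (n + 1)) K) →ₗ[K] K :=
    match x with
    | .inl x => jet (E x.1) x.2 ∘ₗ f₁ + jet (ET t x.1) (x.2.map Fin.succ) ∘ₗ f₂
    | .inr (.inl i) => jet (ET t i) none ∘ₗ f₂ + t () • jet (ET t i) (some 0) ∘ₗ f₂
    | .inr (.inr (.inl x)) => jet (U x.1) x.2 ∘ₗ f₁
    | .inr (.inr (.inr (.inl i))) => jet (Fin.cons 0 (U i) : Fin (n + 1) → K) none ∘ₗ f₂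
    | .inr (.inr (.inr (.inr (.inl x)))) => t () • jet (Fin.tail (Z x.1)) x.2 ∘ₗ f₁ +
        Z x.1 0 • jet (Z x.1) (x.2.map Fin.succ) ∘ₗ f₂
    | .inr (.inr (.inr (.inr (.inr i)))) =>
        jet (Z i) none ∘ₗ f₂ + Z i 0 • jet (Z i) (some 0) ∘ₗ f₂
  have hΦ : ∀ x, ∀ y ∈ F, ∃ c : MvPolynomial Unit K, ∀ t, Φ x t y = eval t c := by
    rintro x ⟨φ, g⟩ -
    have hET : ∀ i j, PolyFun K fun t : Unit → K => ET t i j := fun i j =>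
      PolyFun.fin_cons (PolyFun.coord ()) (fun j => PolyFun.const _) j
    have hjet : ∀ i (o : Option (Fin (n + 1))), PolyFun K fun t => jet (ET t i) o g := by
      rintro i (_ | j)
      · simp only [jet_none]
        exact PolyFun.eval (hET i) g
      · simp only [jet_some]
        exact PolyFun.eval (hET i) _
    rcases x with x | i | x | i | x | i
    · exact (PolyFun.const (jet (E x.1) x.2 φ)).add (hjet x.1 (x.2.map Fin.succ))
    · exact (hjet i none).add ((PolyFun.coord ()).mul (hjet i (some 0)))
    · exact PolyFun.const (jet (U x.1) x.2 φ)
    · exact PolyFun.const (jet (Fin.cons 0 (U i) : Fin (n + 1) → K) none g)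
    · exact ((PolyFun.coord ()).mul (PolyFun.const (jet (Fin.tail (Z x.1)) x.2 φ))).add
        (PolyFun.const (Z x.1 0 • jet (Z x.1) (x.2.map Fin.succ) g))
    · exact PolyFun.const (jet (Z i) none g + Z i 0 • jet (Z i) (some 0) g)
  have hgen : Gen K fun t : Unit → K =>
      Module.finrank K (F ⊓ ⨅ x, LinearMap.ker (Φ x t) :
        Submodule K (MvPolynomial (Fin n) K × MvPolynomial (Fin (n + 1)) K)) ≤ a + b := by
    refine Gen.finrank_inf_le F Φ hΦ 0 ?_
    set A : Submodule K (MvPolynomial (Fin n) K) :=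
      singForms (e + 2) U ⊓ ⨅ i, LinearMap.ker (jet (E i) none) with hA
    set B : Submodule K (MvPolynomial (Fin (n + 1)) K) :=
      ((singForms (e + 1) Z ⊓ ⨅ x : Fin ε × Option (Fin n),
          LinearMap.ker (jet (Fin.cons 0 (E x.1) : Fin (n + 1) → K) (x.2.map Fin.succ))) ⊓
        ⨅ i, LinearMap.ker (jet (Fin.cons 0 (U i) : Fin (n + 1) → K) none)) with hB
    have : FiniteDimensional K A := Submodule.finiteDimensional_of_le inf_le_left
    have : FiniteDimensional K B :=
      Submodule.finiteDimensional_of_le (inf_le_left.trans inf_le_left)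
    set W : Submodule K (MvPolynomial (Fin n) K × MvPolynomial (Fin (n + 1)) K) :=
      F ⊓ ⨅ x, LinearMap.ker (Φ x 0) with hW
    have : FiniteDimensional K W := Submodule.finiteDimensional_of_le inf_le_left
    have hWF : ∀ y ∈ W, y.1.IsHomogeneous (e + 2) ∧ y.2.IsHomogeneous (e + 1) := fun y hy => hy.1
    have hWΦ : ∀ y ∈ W, ∀ x, Φ x 0 y = 0 := fun y hy x => (Submodule.mem_iInf _).1 hy.2 x
    have hEval : ∀ y ∈ W, ∀ i, eval (Fin.cons 0 (E i) : Fin (n + 1) → K) y.2 = 0 := by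
      intro y hy i
      have := hWΦ y hy (.inr (.inl i))
      simpa [Φ, ET, f₂] using this
    have hAW : ∀ y ∈ W, f₁ y ∈ A := by
      intro y hy
      simp only [hA, Submodule.mem_inf, mem_singForms, Submodule.mem_iInf, LinearMap.mem_ker]
      refine ⟨⟨(hWF y hy).1, fun i => ⟨?_, fun j => ?_⟩⟩, fun i => ?_⟩
      · simpa [Φ, f₁] using hWΦ y hy (.inr (.inr (.inl (i, none))))
      · simpa [Φ, f₁] using hWΦ y hy (.inr (.inr (.inl (i, some j))))
      · have := hWΦ y hy (.inl (i, none))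
        simpa [Φ, f₁, f₂, ET, hEval y hy i] using this
    have hBW : ∀ y ∈ W, f₁ y = 0 → f₂ y ∈ B := by
      intro y hy hy0
      have hy1 : y.1 = 0 := hy0
      simp only [hB, Submodule.mem_inf, mem_singForms, Submodule.mem_iInf, LinearMap.mem_ker]
      have hZ0 : ∀ i, eval (Z i) y.2 = 0 := fun i => by
        have := hWΦ y hy (.inr (.inr (.inr (.inr (.inl (i, none))))))
        simpa [Φ, f₁, f₂, hy1, hZ i] using this
      refine ⟨⟨⟨(hWF y hy).2, fun i => ⟨hZ0 i, fun j => ?_⟩⟩, ?_⟩, fun i => ?_⟩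
      · refine Fin.cases ?_ (fun j => ?_) j
        · have := hWΦ y hy (.inr (.inr (.inr (.inr (.inr i)))))
          simpa [Φ, f₂, hZ0 i, hZ i] using this
        · have := hWΦ y hy (.inr (.inr (.inr (.inr (.inl (i, some j))))))
          simpa [Φ, f₁, f₂, hy1, hZ i] using this
      · rintro x
        have := hWΦ y hy (.inl x)
        simpa [Φ, f₁, f₂, hy1, ET] using this
      · simpa [Φ, f₂] using hWΦ y hy (.inr (.inr (.inr (.inl i))))
    exact (finrank_le_add_of_maps f₁ f₂ hAW hBW fun y _ h1 h2 => Prod.ext h1 h2).trans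
      (add_le_add ha hb)
  obtain ⟨t, ht, ht0⟩ := (hgen.and (Gen.ne_zero ())).exists
  refine Bd.of_exists (ι := Fin u ⊕ Fin ε ⊕ Fin z) (by simp)
    (Sum.elim (fun i => Fin.cons 0 (U i)) (Sum.elim (ET t) Z)) (le_trans ?_ ht)
  have : FiniteDimensional K (F ⊓ ⨅ x, LinearMap.ker (Φ x t) :
      Submodule K (MvPolynomial (Fin n) K × MvPolynomial (Fin (n + 1)) K)) :=
    Submodule.finiteDimensional_of_le inf_le_left
  refine finrank_le_of_surjOn
    (t () • (rename (Fin.succ : Fin n → Fin (n + 1))).toLinearMap ∘ₗ f₁ +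
      LinearMap.mulLeft K (X 0) ∘ₗ f₂) fun f hf => ?_
  rw [mem_singForms] at hf
  obtain ⟨hfd, hf⟩ := hf
  obtain ⟨φ₀, g, hφ, hg, rfl⟩ := exists_decomp hfd
  obtain ⟨φ, hφ', rfl⟩ : ∃ φ : MvPolynomial (Fin n) K, φ.IsHomogeneous (e + 2) ∧
      φ₀ = C (t ()) * φ :=
    ⟨C (t ())⁻¹ * φ₀, by simpa using (isHomogeneous_C (Fin n) (t ())⁻¹).mul hφ, by
      rw [← mul_assoc, ← C_mul, mul_inv_cancel₀ ht0, C_1, one_mul]⟩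
  have hU := fun i => hf (.inl i)
  have hE := fun i => hf (.inr (.inl i))
  have hZf := fun i => hf (.inr (.inr i))
  simp only [Sum.elim_inl, Sum.elim_inr] at hU hE hZf
  refine ⟨(φ, g), ⟨⟨hφ', hg⟩, (Submodule.mem_iInf _).2 fun x => ?_⟩, by
    simp [f₁, f₂, smul_eq_C_mul]⟩
  have hZφ : ∀ i (ψ : MvPolynomial (Fin n) K),
      eval (Z i) (rename Fin.succ ψ) = eval (Fin.tail (Z i)) ψ := by
    intro i ψ
    rw [eval_rename]
    rfl
  rw [LinearMap.mem_ker]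
  rcases x with ⟨i, _ | j⟩ | i | ⟨i, _ | j⟩ | i | ⟨i, _ | j⟩ | i
  · have := (hE i).1
    simp [ET] at this
    simp [Φ, f₁, f₂, ET]
    refine mul_left_cancel₀ ht0 ?_
    linear_combination this
  · have := (hE i).2 j.succ
    simp [ET, pderiv_X, Derivation.leibniz] at this
    simp [Φ, f₁, f₂, ET]
    refine mul_left_cancel₀ ht0 ?_
    linear_combination this
  · have := (hE i).2 0
    simp [ET, pderiv_X, Derivation.leibniz] at this
    simp [Φ, f₁, f₂, ET]
    linear_combination this
  · refine (mul_eq_zero.1 (?_ : t () * _ = 0)).resolve_left ht0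
    have := (hU i).1
    simp at this
    simp [Φ, f₁, f₂]
    tauto
  · refine (mul_eq_zero.1 (?_ : t () * _ = 0)).resolve_left ht0
    have := (hU i).2 j.succ
    simp [pderiv_X, Derivation.leibniz] at this
    simp [Φ, f₁, f₂]
    tauto
  · have := (hU i).2 0
    simp [pderiv_X, Derivation.leibniz] at this
    simp [Φ, f₁, f₂]
    tauto
  · have := (hZf i).1
    simp [hZφ] at this
    simp [Φ, f₁, f₂]
    linear_combination this
  · have := (hZf i).2 j.succ
    simp [hZφ, pderiv_X, Derivation.leibniz] at this
    simp [Φ, f₁, f₂]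
    linear_combination this
  · have := (hZf i).2 0
    simp [pderiv_X, Derivation.leibniz] at this
    simp [Φ, f₁, f₂]
    linear_combination this

/-- The differential Horace method: `u` points are specialised to a hyperplane, `ε` further points
approach it. -/
theorem Bd.horace {n e u ε z a b c : ℕ} (hε : ε ≤ n) (ha : Bd K n (e + 2) u a)
    (hb : Bd K (n + 1) (e + 1) (ε + z) b) (hc : Bd K (n + 1) e z c) :
    Bd K (n + 1) (e + 2) (u + (ε + z)) ((a - ε) + max (b + ε - u) c) := by
  let τ := (Fin u × Fin n) ⊕ (Fin ε × Fin n) ⊕ (Fin z × Fin (n + 1))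
  let pU : (τ → K) → Fin u → Fin n → K := fun P i j => P (Sum.inl (i, j))
  let pE : (τ → K) → Fin ε → Fin n → K := fun P i j => P (Sum.inr (Sum.inl (i, j)))
  let pZ : (τ → K) → Fin z → Fin (n + 1) → K := fun P i j => P (Sum.inr (Sum.inr (i, j)))
  let A : (τ → K) → Submodule K (MvPolynomial (Fin n) K) := fun P =>
    singForms (e + 2) (pU P) ⊓ ⨅ i, LinearMap.ker (jet (pE P i) none)
  let B : (τ → K) → Submodule K (MvPolynomial (Fin (n + 1)) K) := fun P =>
    (singForms (e + 1) (pZ P) ⊓ ⨅ x : Fin ε × Option (Fin n),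
        LinearMap.ker (jet (Fin.cons 0 (pE P x.1) : Fin (n + 1) → K) (x.2.map Fin.succ))) ⊓
      ⨅ i, LinearMap.ker (jet (Fin.cons 0 (pU P i) : Fin (n + 1) → K) none)
  have hA : Gen K fun P => Module.finrank K (A P) ≤ a - ε := by
    obtain ⟨U, E, h⟩ := exists_trace (ε := ε) ha
    refine (Gen.finrank_inf_le (r := a - ε) (homogeneousSubmodule (Fin n) K (e + 2))
      (fun (x : (Fin u × Option (Fin n)) ⊕ Fin ε) P =>
        Sum.elim (fun x => jet (pU P x.1) x.2) (fun i => jet (pE P i) none) x) ?_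
      (Sum.elim (fun x => U x.1 x.2) (Sum.elim (fun x => E x.1 x.2) 0)) ?_).mono ?_
    · rintro (⟨i, _ | j⟩ | i) f _
      · simp only [Sum.elim_inl, jet_none]
        exact PolyFun.eval (fun j => PolyFun.coord _) _
      · simp only [Sum.elim_inl, jet_some]
        exact PolyFun.eval (fun j => PolyFun.coord _) _
      · simp only [Sum.elim_inr, jet_none]
        exact PolyFun.eval (fun j => PolyFun.coord _) _
    · rwa [iInf_sum, ← inf_assoc]
    · intro P hP
      rwa [iInf_sum, ← inf_assoc] at hP
  have hB : Gen K fun P => Module.finrank K (B P) ≤ max (b + ε - u) c := by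
    obtain ⟨U, E, Z, h⟩ := exists_residual (u := u) hε hb hc
    refine (Gen.finrank_inf_le (r := max (b + ε - u) c)
      (homogeneousSubmodule (Fin (n + 1)) K (e + 1))
      (fun (x : ((Fin z × Option (Fin (n + 1))) ⊕ (Fin ε × Option (Fin n))) ⊕ Fin u) P =>
        Sum.elim (Sum.elim (fun x => jet (pZ P x.1) x.2) (fun x =>
          jet (Fin.cons 0 (pE P x.1) : Fin (n + 1) → K) (x.2.map Fin.succ)))
          (fun i => jet (Fin.cons 0 (pU P i) : Fin (n + 1) → K) none) x) ?_
      (Sum.elim (fun x => U x.1 x.2) (Sum.elim (fun x => E x.1 x.2) fun x => Z x.1 x.2)) ?_).mono ?_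
    · rintro ((⟨i, _ | j⟩ | ⟨i, _ | j⟩) | i) f _
      · simp only [Sum.elim_inl, jet_none]
        exact PolyFun.eval (fun j => PolyFun.coord _) _
      · simp only [Sum.elim_inl, jet_some]
        exact PolyFun.eval (fun j => PolyFun.coord _) _
      · simp only [Sum.elim_inl, Sum.elim_inr, Option.map_none, jet_none]
        exact PolyFun.eval (PolyFun.fin_cons (PolyFun.const 0) fun j => PolyFun.coord _) _
      · simp only [Sum.elim_inl, Sum.elim_inr, Option.map_some, jet_some]
        exact PolyFun.eval (PolyFun.fin_cons (PolyFun.const 0) fun j => PolyFun.coord _) _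
      · simp only [Sum.elim_inr, jet_none]
        exact PolyFun.eval (PolyFun.fin_cons (PolyFun.const 0) fun j => PolyFun.coord _) _
    · rwa [iInf_sum, iInf_sum, ← inf_assoc, ← inf_assoc]
    · intro P hP
      rwa [iInf_sum, iInf_sum, ← inf_assoc, ← inf_assoc] at hP
  have hZ : Gen K fun P => ∀ i, pZ P i 0 ≠ 0 := Gen.forall_fin fun i => Gen.ne_zero _
  obtain ⟨P, ⟨hPA, hPB⟩, hPZ⟩ := ((hA.and hB).and hZ).exists
  exact Bd.of_degenerate (pU P) (pE P) (pZ P) hPZ hPA hPB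

end Horace

section Basic
variable {K : Type} [Field K]

theorem finrank_homogeneousSubmodule (n d : ℕ) :
    Module.finrank K (homogeneousSubmodule (Fin n) K d) = (n + d - 1).choose d := by
  rw [homogeneousSubmodule_eq_finsupp_supported]
  have h : {m : Fin n →₀ ℕ | m.degree = d} =
      (↑(Finset.univ.finsuppAntidiag d : Finset (Fin n →₀ ℕ)) : Set (Fin n →₀ ℕ)) := by
    ext m
    simp [Finset.mem_finsuppAntidiag, Finsupp.degree_eq_sum]
  rw [h]
  have := Module.finrank_eq_card_basis (basisRestrictSupport K
    (↑(Finset.univ.finsuppAntidiag d : Finset (Fin n →₀ ℕ)) : Set (Fin n →₀ ℕ)))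
  have h2 := Fintype.card_coe (Finset.univ.finsuppAntidiag d : Finset (Fin n →₀ ℕ))
  rw [Finset.card_finsuppAntidiag_nat_eq_choose, Finset.card_univ, Fintype.card_fin] at h2
  exact this.trans h2

theorem finrank_singForms_le {ι : Type} (n d : ℕ) (P : ι → Fin n → K) :
    Module.finrank K (singForms d P) ≤ (n + d - 1).choose d := by
  rw [← finrank_homogeneousSubmodule (K := K)]
  exact finrank_le_of_le le_rfl inf_le_left

theorem Bd.no_points (n d : ℕ) : Bd K n d 0 ((n + d - 1).choose d) :=
  ⟨Fin.elim0, finrank_singForms_le _ _ _⟩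

theorem Bd.of_eq_zero {n d q : ℕ} (P : Fin q → Fin n → K)
    (h : ∀ f : MvPolynomial (Fin n) K, f.IsHomogeneous d → (∀ i, eval (P i) f = 0 ∧
      ∀ j, eval (P i) (pderiv j f) = 0) → f = 0) : Bd K n d q 0 := by
  refine ⟨P, ?_⟩
  have : singForms d P = ⊥ := by
    rw [eq_bot_iff]
    intro f hf
    rw [mem_singForms] at hf
    exact h f hf.1 hf.2
  rw [this, finrank_bot]

theorem Bd.degree_zero (n q : ℕ) : Bd K n 0 (q + 1) 0 := by
  refine Bd.of_eq_zero 0 fun f hf h => ?_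
  obtain ⟨a, rfl⟩ : ∃ a, f = C a := ⟨_, totalDegree_eq_zero_iff_eq_C.1 (by
    simpa using hf.totalDegree_le)⟩
  have := (h 0).1
  simp only [eval_C] at this
  simp [this]

theorem Bd.degree_one (n q : ℕ) : Bd K n 1 (q + 1) 0 := by
  refine Bd.of_eq_zero 0 fun f hf h => ?_
  have h1 : ∀ j, pderiv j f = 0 := by
    intro j
    have h2 : (pderiv j f).IsHomogeneous 0 := hf.pderiv
    obtain ⟨a, ha⟩ : ∃ a, pderiv j f = C a := ⟨_, totalDegree_eq_zero_iff_eq_C.1 (by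
      simpa using h2.totalDegree_le)⟩
    have h3 := (h 0).2 j
    rw [ha, eval_C] at h3
    rw [ha, h3, C_0]
  have h4 := hf.sum_X_mul_pderiv
  simpa [h1] using h4.symm

theorem Bd.one_variable (d q : ℕ) : Bd K 1 d (q + 1) 0 := by
  refine Bd.of_eq_zero (fun _ _ => 1) fun f hf h => ?_
  obtain ⟨g, rfl⟩ : ∃ a : K, f = C a * X 0 ^ d := by
    refine ⟨coeff (Finsupp.single 0 d) f, ?_⟩
    ext m
    have hm : m = Finsupp.single 0 (m 0) := by
      exact Finsupp.ext fun i => by rw [Subsingleton.elim i 0, Finsupp.single_eq_same]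
    by_cases hd : m 0 = d
    · rw [hm, hd, coeff_C_mul, coeff_X_pow]; simp
    · rw [hf.coeff_eq_zero, coeff_C_mul, coeff_X_pow, if_neg, mul_zero]
      · rw [hm]
        intro h0
        exact hd (Finsupp.single_injective _ h0).symm
      · rw [hm]; simpa using hd
  have := (h 0).1
  simp only [map_mul, eval_C, map_pow, eval_X, one_pow, mul_one] at this
  simp [this]

theorem Bd.add_points {n d q r : ℕ} (h : Bd K n d q r) (k : ℕ) : Bd K n d (q + k) r := by
  obtain ⟨P, hP⟩ := h
  refine Bd.of_exists (ι := Fin q ⊕ Fin k) (by simp) (Sum.elim P 0) ?_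
  exact finrank_singForms_le_of_surj P _ (fun i => ⟨Sum.inl i, rfl⟩) hP

theorem Bd.add_points_sub [Infinite K] {n d q r : ℕ} (h : Bd K n d q r) (k : ℕ) :
    Bd K n d (q + k) (r - k) := by
  obtain ⟨P, hP⟩ := h
  obtain ⟨E, hE⟩ := exists_finrank_inf_ker_le (singForms d P) (fun p : Fin n → K => jet p none)
    hP (c := 0) (by
      have : (singForms d P ⊓ ⨅ p : Fin n → K, LinearMap.ker (jet p none)) = ⊥ := by
        rw [eq_bot_iff]
        intro f hf
        simp only [Submodule.mem_inf, Submodule.mem_iInf, LinearMap.mem_ker, jet_none] at hf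
        exact MvPolynomial.funext fun p => by simpa using hf.2 p
      rw [this, finrank_bot]) k
  refine Bd.of_exists (ι := Fin q ⊕ Fin k) (by simp) (Sum.elim P E)
    (le_trans ?_ (hE.trans (by simp)))
  refine finrank_le_of_le (F := homogeneousSubmodule _ K d) (inf_le_left.trans inf_le_left) ?_
  intro f hf
  rw [mem_singForms] at hf
  simp only [Submodule.mem_inf, mem_singForms, Submodule.mem_iInf, LinearMap.mem_ker, jet_none]
  exact ⟨⟨hf.1, fun i => hf.2 (Sum.inl i)⟩, fun i => (hf.2 (Sum.inr i)).1⟩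

/-- By Euler's identity, a form of positive degree vanishes where all its derivatives do. -/
theorem eval_eq_zero_of_pderiv [CharZero K] {σ : Type} [Fintype σ] {d : ℕ} (hd : d ≠ 0)
    {f : MvPolynomial σ K} (hf : f.IsHomogeneous d) {p : σ → K}
    (h : ∀ j, eval p (pderiv j f) = 0) : eval p f = 0 := by
  have := congrArg (eval p) hf.sum_X_mul_pderiv
  simpa [h, hd] using this.symm

theorem Bd.drop_points [CharZero K] {n d q k r : ℕ} (hd : d ≠ 0) (h : Bd K n d (q + k) r) :
    Bd K n d q (r + n * k) := by
  obtain ⟨P, hP⟩ := h.exists_of_card (ι := Fin q ⊕ Fin k) (by simp)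
  refine ⟨fun i => P (Sum.inl i), (finrank_le_inf_iInf_ker_add _
    fun x : Fin k × Fin n => jet (P (Sum.inr x.1)) (some x.2)).trans ?_⟩
  rw [Fintype.card_prod, Fintype.card_fin, Fintype.card_fin, mul_comm k n]
  refine Nat.add_le_add_right (le_trans ?_ hP) _
  refine finrank_le_of_le (F := homogeneousSubmodule _ K d) inf_le_left ?_
  intro f hf
  simp only [Submodule.mem_inf, mem_singForms, Submodule.mem_iInf, LinearMap.mem_ker, jet_some,
    Prod.forall] at hf
  rw [mem_singForms]
  refine ⟨hf.1.1, Sum.rec hf.1.2 fun i => ⟨eval_eq_zero_of_pderiv hd hf.1.1 (hf.2 i), hf.2 i⟩⟩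

theorem Bd.binary [Infinite K] (d q : ℕ) : Bd K 2 d q (d + 1 - 2 * q) := by
  induction d using Nat.strong_induction_on generalizing q with
  | _ d ih =>
    obtain _ | q := q
    · simpa [add_comm 2 d] using Bd.no_points (K := K) 2 d
    obtain _ | _ | e := d
    · exact (Bd.degree_zero _ _).mono (Nat.zero_le _)
    · exact (Bd.degree_one _ _).mono (Nat.zero_le _)
    have := Bd.horace (n := 1) (ε := 0) (by simp) (Bd.one_variable (K := K) (e + 2) 0)
      (ih (e + 1) (by omega) (0 + q)) (ih e (by omega) q)
    rw [show q + 1 = 0 + 1 + (0 + q) by omega]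
    exact this.mono (by omega)

theorem Bd.quadric [Infinite K] (n q : ℕ) : Bd K n 2 q ((n + 1 - q).choose 2) := by
  induction n generalizing q with
  | zero =>
    refine Bd.mono (r := 0) (Bd.of_eq_zero (fun _ => Fin.elim0) fun f hf _ => ?_) (Nat.zero_le _)
    rw [eq_C_of_isEmpty f] at hf ⊢
    by_contra h0
    have := hf.inj_right (isHomogeneous_C _ _) h0
    omega
  | succ n ih =>
    by_cases hq : q ≤ n
    · have h0 : Bd K (n + 1) 1 (0 + 0) (n + 1) := by
        simpa using Bd.no_points (K := K) (n + 1) 1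
      have h1 : Bd K (n + 1) 0 0 1 := by
        simpa using Bd.no_points (K := K) (n + 1) 0
      have := Bd.horace (Nat.zero_le n) (ih q) h0 h1
      refine this.mono ?_
      obtain ⟨k, rfl⟩ := Nat.exists_eq_add_of_le hq
      simp only [show q + k + 1 + 1 - q = k + 1 + 1 by omega, show q + k + 1 - q = k + 1 by omega,
        Nat.choose_succ_succ (k + 1) 1,
        Nat.choose_one_right]
      simp
      omega
    · obtain ⟨k, rfl⟩ := Nat.exists_eq_add_of_lt (not_le.1 hq)
      have := Bd.horace (n := n) (ε := 0) (Nat.zero_le n) (ih n)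
        (Bd.degree_one (n + 1) (0 + 0)) (Bd.degree_zero (n + 1) 0)
      refine Bd.mono (r := 0) ?_ (Nat.zero_le _)
      rw [show n + k + 1 = n + (0 + (0 + 1)) + k by omega]
      exact (this.add_points k).mono (by simp)

end Basic

section Saturated
variable {K : Type} [Field K]

variable (K) in
/-- Double points impose the expected number of conditions on forms of degree `d` in `n` variables,
with a defect of at most two when none or almost none should remain. -/
def Sat (n d : ℕ) : Prop :=
  ∀ q, Bd K n d q (max ((n + d - 1).choose d - n * q) 2)

theorem Sat.of_critical [CharZero K] {n d : ℕ} (hn : n ≠ 0) (hd : d ≠ 0)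
    (hC : 2 ≤ (n + d - 1).choose d)
    (h : ∀ q, (n + d - 1).choose d ≤ n * q + n + 1 → n * q + 2 ≤ (n + d - 1).choose d + n →
      Bd K n d q (max ((n + d - 1).choose d - n * q) 2)) : Sat K n d := by
  intro q
  set c := (n + d - 1).choose d
  have h1 := Nat.div_add_mod (c - 2) n
  have h2 := Nat.mod_lt (c - 2) (Nat.pos_of_ne_zero hn)
  set q₀ := (c - 2) / n
  obtain hq | hq := le_or_gt q q₀
  · obtain ⟨k, hk⟩ := Nat.exists_eq_add_of_le hq
    have := h q₀ (by omega) (by omega)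
    rw [hk] at this
    refine this.drop_points hd |>.mono ?_
    rw [hk, mul_add] at h1
    rw [mul_add]
    omega
  · obtain ⟨k, rfl⟩ := Nat.exists_eq_add_of_lt hq
    have := h (q₀ + 1) (by rw [mul_add]; omega) (by rw [mul_add]; omega)
    rw [show q₀ + k + 1 = q₀ + 1 + k by ring]
    refine (this.add_points k).mono ?_
    rw [mul_add, mul_add, mul_add]
    omega

theorem Sat.horace [Infinite K] {n e q : ℕ} (hn : 2 ≤ n) (h1 : Sat K n (e + 2))
    (h2 : Sat K (n + 1) (e + 1))
    (h3 : ∀ z, (n + 1) * (n + e + 1).choose (e + 1) + 2 ≤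
      (n + 1) * n * z + (n + e + 2).choose (e + 2) + (n + 1) + (n + 1) * (n - 1) ^ 2 →
      Bd K (n + 1) e z 0)
    (hA : n ^ 2 + 2 * n + 2 ≤ (n + e + 1).choose (e + 2))
    (hz : (n + e + 2).choose (e + 2) + (n + 1) + (n + 1) * (n - 1) ^ 2 ≤
      (n + 1) * (n + e + 1).choose (e + 1) + 2)
    (hq : (n + e + 2).choose (e + 2) ≤ (n + 1) * q + (n + 1) + 1)
    (hq' : (n + 1) * q + 2 ≤ (n + e + 2).choose (e + 2) + (n + 1)) :
    Bd K (n + 1) (e + 2) q (max ((n + e + 2).choose (e + 2) - (n + 1) * q) 2) := by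
  have hP : (n + e + 2).choose (e + 2) =
    (n + e + 1).choose (e + 1) + (n + e + 1).choose (e + 2) := Nat.choose_succ_succ _ _
  have h1' := h1
  have h2' := h2
  simp only [Sat, show n + (e + 2) - 1 = n + e + 1 by omega,
    show n + 1 + (e + 1) - 1 = n + e + 1 by omega] at h1' h2'
  set c := (n + e + 2).choose (e + 2)
  set c₁ := (n + e + 1).choose (e + 1)
  set cₙ := (n + e + 1).choose (e + 2)
  have hc : c₁ ≤ (n + 1) * q := by nlinarith
  have e1 := Nat.div_add_mod ((n + 1) * q - c₁) n
  have e2 := Nat.mod_lt ((n + 1) * q - c₁) (show 0 < n by omega)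
  set u := ((n + 1) * q - c₁) / n
  set ε := ((n + 1) * q - c₁) % n
  have e3 : n * u + ε + c₁ = (n + 1) * q := by omega
  have hm : n = n - 1 + 1 := by omega
  generalize n - 1 = m at *
  clear_value u ε
  subst hm
  have hu : m + 2 ≤ u := by
    by_contra! hlt
    have : (m + 1) * u ≤ (m + 1) * (m + 1) := Nat.mul_le_mul_left _ (by omega)
    nlinarith
  have hε : ε ≤ m := by omega
  have hsum : u + ε ≤ q := by
    by_contra! hlt
    have h5 : (m + 1 + 1) * ((m + 1) * (q + 1)) ≤ (m + 1 + 1) * ((m + 1) * (u + ε)) :=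
      Nat.mul_le_mul_left _ (Nat.mul_le_mul_left _ hlt)
    have h6 : (m + 1 + 1) * ((m + 1) * u + ε + c₁) = (m + 1 + 1) * ((m + 1 + 1) * q) := by rw [e3]
    have h7 : (m + 1 + 1) * (m * ε) ≤ (m + 1 + 1) * (m * m) :=
      Nat.mul_le_mul_left _ (Nat.mul_le_mul_left _ hε)
    nlinarith
  obtain ⟨z, rfl⟩ := Nat.exists_eq_add_of_le hsum
  have h4 := h3 z (by
    have h6 : (m + 1 + 1) * ((m + 1) * u + ε + c₁) = (m + 1 + 1) * ((m + 1 + 1) * (u + ε + z)) := by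
      rw [e3]
    have h7 : (m + 1 + 1) * (m * ε) ≤ (m + 1 + 1) * (m * m) :=
      Nat.mul_le_mul_left _ (Nat.mul_le_mul_left _ hε)
    nlinarith)
  rw [add_assoc u]
  refine (Bd.horace (show ε ≤ m + 1 by omega) (h1' u) (h2' (ε + z)) h4).mono ?_
  rw [add_assoc u ε z] at e3
  have h8 : (m + 1 + 1) * (u + (ε + z)) = (m + 1 + 1) * u + (m + 1 + 1) * (ε + z) := by ring
  have h9 : (m + 1 + 1) * u = (m + 1) * u + u := by ring
  omega

/-- The binomial inequality that makes the splitting of the points possible. -/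
theorem choose_bound_succ {n e : ℕ} (hn : 1 ≤ n)
    (h : (e + 2) * (n * (n + 1)) ≤ (n + e).choose e * (n - 1)) :
    (e + 3) * (n * (n + 1)) ≤ (n + e + 1).choose (e + 1) * (n - 1) := by
  have h1 : (n + e + 1) * (n + e).choose e = (n + e + 1).choose (e + 1) * (e + 1) :=
    Nat.add_one_mul_choose_eq _ _
  refine Nat.le_of_mul_le_mul_left (c := e + 1) ?_ (Nat.succ_pos e)
  have h2 : (n + e + 1) * ((e + 2) * (n * (n + 1))) ≤
    (n + e + 1) * ((n + e).choose e * (n - 1)) := Nat.mul_le_mul_left _ h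
  have h3 : (e + 1) * (e + 3) ≤ (n + e + 1) * (e + 2) := by nlinarith
  have h4 := Nat.mul_le_mul_right (n * (n + 1)) h3
  calc _ = (e + 1) * (e + 3) * (n * (n + 1)) := by ring
    _ ≤ _ := h4
    _ = (n + e + 1) * ((e + 2) * (n * (n + 1))) := by ring
    _ ≤ _ := h2
    _ = (n + e + 1) * (n + e).choose e * (n - 1) := by ring
    _ = _ := by rw [h1]; ring

theorem choose_bound {n e e₀ : ℕ} (hn : 1 ≤ n) (he : e₀ ≤ e)
    (h : (e₀ + 2) * (n * (n + 1)) ≤ (n + e₀).choose e₀ * (n - 1)) :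
    (e + 2) * (n * (n + 1)) ≤ (n + e).choose e * (n - 1) := by
  induction e, he using Nat.le_induction with
  | base => exact h
  | succ e _ ih => exact choose_bound_succ hn ih

theorem Sat.step [CharZero K] {n e : ℕ} (hn : 2 ≤ n) (h1 : Sat K n (e + 2))
    (h2 : Sat K (n + 1) (e + 1)) (h3 : Sat K (n + 1) e)
    (hB : (e + 2) * (n * (n + 1)) ≤ (n + e).choose e * (n - 1)) : Sat K (n + 1) (e + 2) := by
  have r1 : (n + e + 1) * (n + e).choose e = (n + e + 1).choose (e + 1) * (e + 1) :=
    Nat.add_one_mul_choose_eq _ _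
  have r2 : (n + e + 2) * (n + e + 1).choose (e + 1) = (n + e + 2).choose (e + 2) * (e + 2) :=
    Nat.add_one_mul_choose_eq _ _
  have hP : (n + e + 2).choose (e + 2) =
    (n + e + 1).choose (e + 1) + (n + e + 1).choose (e + 2) := Nat.choose_succ_succ _ _
  have h3' := h3
  simp only [Sat, show n + 1 + e - 1 = n + e by omega] at h3'
  have key : (n + e + 2).choose (e + 2) + n * (n + e).choose e + n ^ 2 * (n + 1) ≤
      (n + 1) * (n + e + 1).choose (e + 1) := by
    obtain ⟨m, rfl⟩ : ∃ m, n = m + 1 := ⟨n - 1, by omega⟩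
    simp only [Nat.add_sub_cancel] at hB
    refine Nat.le_of_mul_le_mul_left (c := e + 2) ?_ (by omega)
    have := Nat.mul_le_mul_left (m + 1) hB
    nlinarith
  have hA : n ^ 2 + 2 * n + 2 ≤ (n + e + 1).choose (e + 2) := by
    obtain ⟨m, rfl⟩ : ∃ m, n = m + 1 := ⟨n - 1, by omega⟩
    simp only [Nat.add_sub_cancel] at hB
    have r3 : (m + 1) * (m + 1 + e + 1).choose (e + 1) =
        (m + 1 + e + 1).choose (e + 2) * (e + 2) := by
      rw [hP] at r2
      linarith
    set x := (m + 1 + e + 1).choose (e + 2)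
    have r4 : (m + 1) * ((m + 1 + e + 1) * (m + 1 + e).choose e) = x * (e + 2) * (e + 1) := by
      rw [← r3, r1]; ring
    have r5 := Nat.mul_le_mul_left ((m + 1) * (m + 1 + e + 1)) hB
    have r6 : (e + 2) * ((m + 1) * (m + 1 + e + 1) * ((m + 1) * (m + 1 + 1))) ≤
        (e + 2) * (x * (e + 1) * m) := by nlinarith
    have r7 := Nat.le_of_mul_le_mul_left r6 (by omega)
    have hm : 1 ≤ m := by omega
    refine Nat.le_of_mul_le_mul_left (c := (e + 1) * m) ?_ (by positivity)
    have r8 : (e + 1) * (m * ((m + 1) ^ 2 + 2 * (m + 1) + 2)) ≤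
        (e + 1 + (m + 1)) * ((m + 1) * ((m + 1) * (m + 1 + 1))) :=
      Nat.mul_le_mul (by omega) (by nlinarith)
    nlinarith
  have hz : (n + 1) + (n + 1) * (n - 1) ^ 2 ≤ n ^ 2 * (n + 1) + 2 := by
    obtain ⟨m, rfl⟩ : ∃ m, n = m + 1 := ⟨n - 1, by omega⟩
    simp only [Nat.add_sub_cancel]
    nlinarith
  refine Sat.of_critical (by omega) (by omega) ?_ ?_
  · rw [show n + 1 + (e + 2) - 1 = n + e + 2 by omega, hP]
    exact (Nat.le_add_left 2 _).trans (hA.trans (Nat.le_add_left _ _))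
  · rw [show n + 1 + (e + 2) - 1 = n + e + 2 by omega]
    refine fun q hq hq' => Sat.horace hn h1 h2 (fun z hz => ?_) hA
      (by linarith [Nat.zero_le (n * (n + e).choose e)]) hq hq'
    have hz2 : (n + e).choose e + 2 * (n + 1) ≤ (n + 1) * z + 2 := by
      obtain ⟨m, rfl⟩ : ∃ m, n = m + 1 := ⟨n - 1, by omega⟩
      simp only [Nat.add_sub_cancel] at hz
      refine Nat.le_of_mul_le_mul_left (c := m + 1) ?_ (by omega)
      nlinarith
    have : 2 ≤ z := by nlinarith [Nat.choose_pos (Nat.le_add_left e n)]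
    obtain ⟨w, rfl⟩ := Nat.exists_eq_add_of_le' this
    refine ((h3' w).add_points_sub 2).mono ?_
    have : (n + 1) * (w + 2) = (n + 1) * w + 2 * (n + 1) := by ring
    omega

end Saturated

section Induction
variable {K : Type} [Field K]

/-- The dimension bound available by induction for forms of degree `d` in `n` variables singular at
`q` general points. -/
def bound (n d q : ℕ) : ℕ :=
  if d = 2 then (n + 1 - q).choose 2 else if n = 2 then d + 1 - 2 * q else
  if n * q + 2 < (n + d - 1).choose d then (n + d - 1).choose d - n * q else
  2 - (q - ((n + d - 1).choose d - 2 + (n - 1)) / n)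

theorem Sat.binary [Infinite K] (d : ℕ) : Sat K 2 d := fun q => (Bd.binary d q).mono (by
  rw [show 2 + d - 1 = d + 1 by omega, Nat.choose_succ_self_right]
  exact le_max_left _ _)

theorem Sat.bd [Infinite K] {n d : ℕ} (hn : n ≠ 0) (h : d ≠ 2 → Sat K n d) (q : ℕ) :
    Bd K n d q (bound n d q) := by
  unfold bound
  split_ifs with h1 h2 h3
  · subst h1
    exact Bd.quadric n q
  · subst h2
    exact Bd.binary d q
  · exact (h h1 q).mono (by omega)
  · set c := (n + d - 1).choose d
    have h4 := Nat.div_add_mod (c - 2 + (n - 1)) n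
    have h5 := Nat.mod_lt (c - 2 + (n - 1)) (Nat.pos_of_ne_zero hn)
    set s := (c - 2 + (n - 1)) / n
    have hs : s ≤ q := by
      by_contra! hlt
      have := Nat.mul_le_mul_left n hlt
      rw [Nat.mul_succ] at this
      omega
    obtain ⟨k, rfl⟩ := Nat.exists_eq_add_of_le hs
    exact ((h h1 s).add_points_sub k).mono (by omega)

/-- A numerical check that `u` points on a hyperplane and `ε` further ones to be specialised to it
reduce `q` points to lower degree and dimension. -/
def Splits (n e q u ε : ℕ) : Prop :=
  u + ε ≤ q ∧ ε ≤ n ∧ (bound n (e + 2) u - ε) +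
    max (bound (n + 1) (e + 1) (q - u) + ε - u) (bound (n + 1) e (q - u - ε)) ≤
      max ((n + e + 2).choose (e + 2) - (n + 1) * q) 2

instance (n e q u ε : ℕ) : Decidable (Splits n e q u ε) := by unfold Splits; infer_instance

theorem Splits.bd [Infinite K] {n e q u ε : ℕ} (h : Splits n e q u ε) (hn : n ≠ 0)
    (h1 : Sat K n (e + 2)) (h2 : e + 1 ≠ 2 → Sat K (n + 1) (e + 1))
    (h3 : e ≠ 2 → Sat K (n + 1) e) :
    Bd K (n + 1) (e + 2) q (max ((n + e + 2).choose (e + 2) - (n + 1) * q) 2) := by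
  obtain ⟨hq, hε, hle⟩ := h
  obtain ⟨z, rfl⟩ := Nat.exists_eq_add_of_le hq
  rw [show u + ε + z - u = ε + z by omega, show ε + z - ε = z by omega] at hle
  refine Bd.mono ?_ hle
  rw [add_assoc]
  exact Bd.horace hε (Sat.bd hn (fun _ => h1) u) (Sat.bd (by omega) h2 _) (Sat.bd (by omega) h3 _)

theorem Sat.of_two [CharZero K] {n e : ℕ} (q₀ : ℕ)
    (hq : (n + 1) * q₀ + 2 ≤ (n + e + 2).choose (e + 2) ∧
      (n + e + 2).choose (e + 2) < (n + 1) * q₀ + (n + 1) + 2)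
    (h : ∀ q, q = q₀ ∨ q = q₀ + 1 →
      Bd K (n + 1) (e + 2) q (max ((n + e + 2).choose (e + 2) - (n + 1) * q) 2)) :
    Sat K (n + 1) (e + 2) := by
  refine Sat.of_critical (by omega) (by omega) ?_ ?_
  · rw [show n + 1 + (e + 2) - 1 = n + e + 2 by omega]
    omega
  · rw [show n + 1 + (e + 2) - 1 = n + e + 2 by omega]
    intro q hq1 hq2
    refine h q ?_
    have l1 : q₀ ≤ q := by
      by_contra! hlt
      have := Nat.mul_le_mul_left (n + 1) hlt
      rw [Nat.mul_succ] at this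
      omega
    have l2 : q ≤ q₀ + 1 := by
      by_contra! hlt
      have := Nat.mul_le_mul_left (n + 1) hlt
      rw [Nat.mul_succ, Nat.mul_succ] at this
      omega
    omega

theorem Sat.of_splits [CharZero K] {n e : ℕ} (q₀ u ε u' ε' : ℕ)
    (h1 : Sat K n (e + 2)) (h2 : e + 1 ≠ 2 → Sat K (n + 1) (e + 1))
    (h3 : e ≠ 2 → Sat K (n + 1) e)
    (h : n ≠ 0 ∧ ((n + 1) * q₀ + 2 ≤ (n + e + 2).choose (e + 2) ∧
      (n + e + 2).choose (e + 2) < (n + 1) * q₀ + (n + 1) + 2) ∧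
      Splits n e q₀ u ε ∧ Splits n e (q₀ + 1) u' ε') :
    Sat K (n + 1) (e + 2) :=
  Sat.of_two q₀ h.2.1 fun q hq => by
    obtain rfl | rfl := hq
    · exact h.2.2.1.bd h.1 h1 h2 h3
    · exact h.2.2.2.bd h.1 h1 h2 h3

theorem Sat.quartic_eight [CharZero K] (hc : ∀ n, 2 ≤ n → Sat K n 3) (h7 : Sat K 7 4)
    (h : Bd K 6 4 21 0) : Sat K 8 4 := by
  have h3 : ∀ {n} q, 2 ≤ n → Bd K n 3 q (bound n 3 q) := fun {n} q hn =>
    Sat.bd (by omega) (fun _ => hc n hn) q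
  have b7 : Bd K 7 4 30 0 := by
    refine (Bd.horace (ε := 0) (z := 9) (by omega) h (h3 _ (by omega)) (Bd.quadric 7 9)).mono ?_
    decide +kernel
  have b8 : Bd K 8 4 41 2 := by
    refine (Bd.horace (ε := 0) (z := 11) (by omega) b7 (h3 _ (by omega)) (Bd.quadric 8 11)).mono ?_
    decide +kernel
  refine Sat.of_two (n := 7) (e := 2) 41 (by decide +kernel) fun q hq => ?_
  obtain rfl | rfl := hq
  · exact b8.mono (le_max_right _ _)
  · exact Splits.bd (u := 29) (ε := 5) (by decide +kernel) (by omega) h7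
      (fun _ => hc 8 (by omega)) (by simp)

theorem Sat.quartic_step [CharZero K] {n : ℕ} (hn : 10 ≤ n) (h1 : Sat K n 4)
    (h2 : Sat K (n + 1) 3) : Sat K (n + 1) 4 := by
  have e2 : (n + 2).choose 2 * 2 = (n + 2) * (n + 1) := by
    rw [← Nat.add_one_mul_choose_eq (n + 1) 1, Nat.choose_one_right]
  have e3 : (n + 3).choose 3 * 6 = (n + 3) * ((n + 2) * (n + 1)) := by
    have := Nat.add_one_mul_choose_eq (n + 2) 2
    simp only [add_assoc, Nat.reduceAdd] at this
    rw [← e2, ← mul_assoc, this]; ring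
  have e4 : (n + 4).choose 4 * 24 = (n + 4) * ((n + 3) * ((n + 2) * (n + 1))) := by
    have := Nat.add_one_mul_choose_eq (n + 3) 3
    simp only [add_assoc, Nat.reduceAdd] at this
    rw [← e3, ← mul_assoc, this]; ring
  have hP : (n + 4).choose 4 = (n + 3).choose 3 + (n + 3).choose 4 := Nat.choose_succ_succ _ _
  obtain ⟨m, rfl⟩ := Nat.exists_eq_add_of_le' hn
  set c := (m + 10 + 4).choose 4
  set c₁ := (m + 10 + 3).choose 3
  refine Sat.of_critical (by omega) (by omega) ?_ ?_
  · rw [show m + 10 + 1 + 4 - 1 = m + 10 + 4 by omega]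
    nlinarith
  · rw [show m + 10 + 1 + 4 - 1 = m + 10 + 4 by omega]
    refine fun q hq hq' => Sat.horace (e := 2) (by omega) h1 h2 (fun z hz => ?_) ?_ ?_ hq hq'
    · refine (Bd.quadric _ _).mono (le_of_eq (Nat.choose_eq_zero_of_lt ?_))
      simp only [show m + 10 - 1 = m + 9 by omega] at hz
      change (m + 10 + 1) * c₁ + 2 ≤ (m + 10 + 1) * (m + 10) * z + c + _ + _ at hz
      by_contra! hlt
      have := Nat.mul_le_mul_left ((m + 10 + 1) * (m + 10)) (show z ≤ m + 10 by omega)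
      nlinarith
    · change _ ≤ (m + 10 + 3).choose 4
      nlinarith
    · simp only [show m + 10 - 1 = m + 9 by omega]
      change c + _ + _ ≤ (m + 10 + 1) * c₁ + 2
      nlinarith

theorem Sat.of_cubic [CharZero K] (hc : ∀ n, 2 ≤ n → Sat K n 3) (hq : Bd K 6 4 21 0) {n d : ℕ}
    (hn : 2 ≤ n) (hd : 3 ≤ d) : Sat K n d := by
  induction n, hn using Nat.le_induction generalizing d with
  | base => exact Sat.binary d
  | succ n hn ih =>
    induction d using Nat.strong_induction_on with
    | _ d ihd =>
      obtain rfl | hd := hd.eq_or_lt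
      · exact hc _ (by omega)
      obtain ⟨e, rfl⟩ := Nat.exists_eq_add_of_le' (show 2 ≤ d by omega)
      have h1 : Sat K n (e + 2) := ih (by omega)
      have h2 : e + 1 ≠ 2 → Sat K (n + 1) (e + 1) := fun _ => ihd _ (by omega) (by omega)
      have h3 : e ≠ 2 → Sat K (n + 1) e := fun _ => ihd _ (by omega) (by omega)
      by_cases hB : 3 ≤ e ∧ (e + 2) * (n * (n + 1)) ≤ (n + e).choose e * (n - 1)
      · exact Sat.step hn h1 (h2 (by omega)) (h3 (by omega)) hB.2
      have he : 2 ≤ e := by omega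
      obtain rfl | rfl | hn4 : n = 2 ∨ n = 3 ∨ 4 ≤ n := by omega
      · have : e < 11 := by
          by_contra! hle
          exact hB ⟨by omega, choose_bound (by omega) hle (by decide +kernel)⟩
        interval_cases e
        · exact Sat.of_splits 4 2 0 2 0 h1 h2 h3 (by decide +kernel)
        · exact Sat.of_splits 6 2 0 2 0 h1 h2 h3 (by decide +kernel)
        · exact Sat.of_splits 8 2 0 3 0 h1 h2 h3 (by decide +kernel)
        · exact Sat.of_splits 11 3 0 3 0 h1 h2 h3 (by decide +kernel)
        · exact Sat.of_splits 14 3 0 3 1 h1 h2 h3 (by decide +kernel)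
        · exact Sat.of_splits 17 3 0 4 0 h1 h2 h3 (by decide +kernel)
        · exact Sat.of_splits 21 4 0 4 1 h1 h2 h3 (by decide +kernel)
        · exact Sat.of_splits 25 4 1 4 2 h1 h2 h3 (by decide +kernel)
        · exact Sat.of_splits 29 4 1 5 1 h1 h2 h3 (by decide +kernel)
      · have : e < 5 := by
          by_contra! hle
          exact hB ⟨by omega, choose_bound (by omega) hle (by decide +kernel)⟩
        interval_cases e
        · exact Sat.of_splits 8 4 0 4 1 h1 h2 h3 (by decide +kernel)
        · exact Sat.of_splits 13 6 0 6 1 h1 h2 h3 (by decide +kernel)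
        · exact Sat.of_splits 20 8 0 8 2 h1 h2 h3 (by decide +kernel)
      · have : e = 2 := by
          by_contra! hne
          refine hB ⟨by omega, choose_bound (e₀ := 3) (by omega) (by omega) ?_⟩
          obtain ⟨m, rfl⟩ := Nat.exists_eq_add_of_le' hn4
          have e2 : (m + 4 + 2).choose 2 * 2 = (m + 4 + 2) * (m + 4 + 1) := by
            rw [← Nat.add_one_mul_choose_eq (m + 4 + 1) 1, Nat.choose_one_right]
          have e3 := Nat.add_one_mul_choose_eq (m + 4 + 2) 2
          change (m + 4 + 3) * _ = (m + 4 + 3).choose 3 * 3 at e3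
          have e4 : (m + 4 + 3).choose 3 * 6 = (m + 7) * ((m + 6) * (m + 5)) := by nlinarith
          rw [show m + 4 - 1 = m + 3 by omega]
          refine Nat.le_of_mul_le_mul_left (c := 6) ?_ (by omega)
          rw [← mul_assoc 6 (Nat.choose _ _), mul_comm 6 (Nat.choose _ _), e4]
          ring_nf
          nlinarith
        subst this
        obtain h10 | h10 := le_or_gt 10 n
        · exact Sat.quartic_step h10 h1 (h2 (by omega))
        · interval_cases n
          · exact Sat.of_splits 13 8 0 8 1 h1 h2 h3 (by decide +kernel)
          · exact Sat.of_splits 20 13 0 14 0 h1 h2 h3 (by decide +kernel)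
          · exact Sat.of_splits 29 20 0 21 0 h1 h2 h3 (by decide +kernel)
          · exact Sat.quartic_eight hc h1 hq
          · exact Sat.of_splits 54 40 1 41 0 h1 h2 h3 (by decide +kernel)
          · exact Sat.of_splits 71 54 4 54 7 h1 h2 h3 (by decide +kernel)

end Induction

/-! ### Solving sparse integral linear systems

A linear form in variables indexed by `ℕ` is stored as the list of its coefficients. The
continuation-passing functions below force the evaluation of intermediate results. -/

section Elimination

def forceNat {β : Type} (n : ℕ) (k : ℕ → β) : β :=
  match n with
  | 0 => k 0
  | m + 1 => k (m + 1)

def forceInt {β : Type} (v : ℤ) (z : β) (k : ℤ → β) : β :=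
  match v with
  | .ofNat n => match n with
    | 0 => z
    | m + 1 => k (.ofNat (m + 1))
  | .negSucc n => forceNat n fun n => k (.negSucc n)

/-- Evaluate a sparse form, discarding its zero coefficients. -/
def forceRow {β : Type} : List (ℕ × ℤ) → (List (ℕ × ℤ) → β) → β
  | [], k => k []
  | (c, v) :: t, k => forceInt v (forceRow t k) fun v => forceNat c fun c =>
      forceRow t fun t => k ((c, v) :: t)

def forceRows {β : Type} : List (List (ℕ × ℤ)) → (List (List (ℕ × ℤ)) → β) → β
  | [], k => k []
  | r :: rs, k => forceRow r fun r => forceRows rs fun rs => k (r :: rs)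

def scaleRow (a : ℤ) : List (ℕ × ℤ) → List (ℕ × ℤ)
  | [] => []
  | (c, v) :: t => (c, Int.mul a v) :: scaleRow a t

/-- Given the combinations `f s = a * r + b * s`, those of the sparse form with an additional
leading entry. -/
def combEntry (a b : ℤ) (c : ℕ) (v : ℤ) (f : List (ℕ × ℤ) → List (ℕ × ℤ)) :
    List (ℕ × ℤ) → List (ℕ × ℤ)
  | [] => (c, Int.mul a v) :: f []
  | (d, w) :: s =>
    bif c.blt d then (c, Int.mul a v) :: f ((d, w) :: s)
    else bif d.blt c then (d, Int.mul b w) :: combEntry a b c v f s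
    else (c, Int.add (Int.mul a v) (Int.mul b w)) :: f s

/-- The combination `a * r + b * s` of two sparse forms sorted by variable. -/
def combRow (a b : ℤ) : List (ℕ × ℤ) → List (ℕ × ℤ) → List (ℕ × ℤ)
  | [] => scaleRow b
  | (c, v) :: r => combEntry a b c v (combRow a b r)

def addEntry (c : ℕ) (v : ℤ) : List (ℕ × ℤ) → List (ℕ × ℤ)
  | [] => [(c, v)]
  | (d, w) :: t =>
    bif c.blt d then (c, v) :: (d, w) :: t
    else bif c.beq d then (c, v + w) :: t
    else (d, w) :: addEntry c v t

def sortRow : List (ℕ × ℤ) → List (ℕ × ℤ)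
  | [] => []
  | (c, v) :: t => addEntry c v (sortRow t)

/-- Insert a form into an echelon family. -/
def insRow : List (List (ℕ × ℤ)) → List (ℕ × ℤ) → List (List (ℕ × ℤ))
  | es, [] => es
  | [], r => [r]
  | [] :: es, r => insRow es r
  | ((d, w) :: u) :: es, (c, v) :: t =>
    bif c.blt d then ((c, v) :: t) :: ((d, w) :: u) :: es
    else bif d.blt c then ((d, w) :: u) :: insRow es ((c, v) :: t)
    else forceNat (Int.gcd v w) fun g => forceInt (w / g) [] fun a =>
      forceInt (-(v / g)) [] fun b =>
      forceRow (combRow a b t u) fun r => ((d, w) :: u) :: insRow es r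

/-- The set, encoded in binary, of the variables that an echelon family forces to vanish. -/
def solved : List (List (ℕ × ℤ)) → ℕ
  | [] => 0
  | [] :: es => solved es
  | ((c, v) :: t) :: es => forceNat (solved es) fun m =>
    bif !v.natAbs.beq 0 && t.all fun q => m.testBit q.1 then m ||| 2 ^ c else m

def sortIns (a : ℕ) : List ℕ → List ℕ
  | [] => [a]
  | b :: l => bif a.ble b then a :: b :: l else b :: sortIns a l

def sortList : List ℕ → List ℕ
  | [] => []
  | a :: l => sortIns a (sortList l)

def encode (n : ℕ) : List ℕ → ℕ
  | [] => 0
  | a :: l => a + n * encode n l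

def decode (n : ℕ) : ℕ → ℕ → List ℕ
  | 0, _ => []
  | d + 1, c => c % n :: decode n d (c / n)

/-- The contraction of a symmetric array with `e` copies of the point `p`, as a sparse form;
the entries in `z` are known to vanish. -/
def contrRow (n : ℕ) (z : List ℕ → Bool) (p : List (ℕ × ℤ)) : ℕ → ℤ → List ℕ → List (ℕ × ℤ)
  | 0, a, l => bif z (sortList l) then [] else [(encode n (sortList l), a)]
  | e + 1, a, l => p.flatMap fun t => contrRow n z p e (a * t.2) (t.1 :: l)

def contr {K : Type} [Field K] (y : List ℕ → K) (p : List (ℕ × ℤ)) : ℕ → List ℕ → K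
  | 0, l => y l
  | e + 1, l => (p.map fun t => (t.2 : K) * contr y p e (t.1 :: l)).sum

/-- The nondecreasing lists of length `d` with entries less than `n`. -/
def sortedLists (n : ℕ) : ℕ → List (List ℕ)
  | 0 => [[]]
  | d + 1 => (sortedLists n d).flatMap fun l =>
      (List.range (l.headD (n - 1) + 1)).map fun i => i :: l

def contrRows (n d : ℕ) (z : List ℕ → Bool) (P : List (List (ℕ × ℤ))) : List (List (ℕ × ℤ)) :=
  P.flatMap fun p => (List.range n).map fun k =>
    sortRow (contrRow n z p d 1 [k])

def allSolved (n d : ℕ) (z : List ℕ → Bool) (m : ℕ) : Bool :=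
  (sortedLists n d).all fun l => z l || m.testBit (encode n l)

/-- Whether a symmetric array of order `d + 1` that vanishes at the entries in `z` and has
vanishing contractions with the points in `P` is found to be zero. -/
def checkZero (n d : ℕ) (z : List ℕ → Bool) (P : List (List (ℕ × ℤ))) : Bool :=
  forceRows (contrRows n d z P) fun rs => forceRows (rs.foldl insRow []) fun es =>
    forceNat (solved es) fun m => allSolved n (d + 1) z m

end Elimination

section Soundness

variable {K : Type} [Field K]

def rowVal (x : ℕ → K) : List (ℕ × ℤ) → K
  | [] => 0
  | (c, v) :: t => v * x c + rowVal x t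

theorem eq_of_blt_eq_false {c d : ℕ} (h : c.blt d = false) (h' : d.blt c = false) : c = d := by
  rw [← Bool.not_eq_true, Nat.blt_eq] at h h'
  omega

theorem forceNat_eq {β : Type} (n : ℕ) (k : ℕ → β) : forceNat n k = k n := by
  cases n <;> rfl

theorem forceInt_eq {β : Type} (v : ℤ) (z : β) (k : ℤ → β) :
    forceInt v z k = if v = 0 then z else k v := by
  unfold forceInt
  rcases v with (_ | m) | n
  · simp
  · simp only [Int.ofNat_eq_natCast]
    rw [if_neg (by omega)]
  · simp only [forceNat_eq]
    rw [if_neg (Int.negSucc_ne_zero n)]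

theorem forceRow_eq {β : Type} (r : List (ℕ × ℤ)) (k : List (ℕ × ℤ) → β) :
    forceRow r k = k (r.filter fun t => t.2 ≠ 0) := by
  induction r generalizing k with
  | nil => rfl
  | cons t r ih =>
    obtain ⟨c, v⟩ := t
    simp only [forceRow, forceInt_eq, forceNat_eq, ih]
    split_ifs with h <;> simp [h]

theorem forceRows_eq {β : Type} (rs : List (List (ℕ × ℤ))) (k : List (List (ℕ × ℤ)) → β) :
    forceRows rs k = k (rs.map fun r => r.filter fun t => t.2 ≠ 0) := by
  induction rs generalizing k with
  | nil => rfl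
  | cons r rs ih => simp only [forceRows, forceRow_eq, ih, List.map_cons]

variable (x : ℕ → K)

theorem rowVal_filter (r : List (ℕ × ℤ)) : rowVal x (r.filter fun t => t.2 ≠ 0) = rowVal x r := by
  induction r with
  | nil => rfl
  | cons t r ih =>
    obtain ⟨c, v⟩ := t
    by_cases h : v = 0
    · simpa [h, rowVal] using ih
    · simp only [ne_eq, decide_not] at ih
      simp [h, rowVal, ih]

theorem rowVal_map_filter {rs : List (List (ℕ × ℤ))} (h : ∀ r ∈ rs, rowVal x r = 0) :
    ∀ r ∈ rs.map (fun r => r.filter fun t => t.2 ≠ 0), rowVal x r = 0 := by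
  intro r hr
  obtain ⟨s, hs, rfl⟩ := List.mem_map.1 hr
  rw [rowVal_filter, h s hs]

theorem rowVal_append (r s : List (ℕ × ℤ)) : rowVal x (r ++ s) = rowVal x r + rowVal x s := by
  induction r with
  | nil => simp [rowVal]
  | cons t r ih => simp [rowVal, ih, add_assoc]

theorem int_mul_eq (a b : ℤ) : Int.mul a b = a * b := rfl

theorem int_add_eq (a b : ℤ) : Int.add a b = a + b := rfl

theorem rowVal_scaleRow (a : ℤ) (r : List (ℕ × ℤ)) : rowVal x (scaleRow a r) = a * rowVal x r := by
  induction r with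
  | nil => simp [rowVal, scaleRow]
  | cons t r ih =>
    simp only [rowVal, scaleRow, ih, int_mul_eq]
    push_cast
    ring

theorem rowVal_combEntry (a b : ℤ) (c : ℕ) (v : ℤ) {f : List (ℕ × ℤ) → List (ℕ × ℤ)} {A : K}
    (hf : ∀ s, rowVal x (f s) = A + b * rowVal x s) (s : List (ℕ × ℤ)) :
    rowVal x (combEntry a b c v f s) = a * (v * x c) + A + b * rowVal x s := by
  induction s with
  | nil =>
    simp only [combEntry, rowVal, hf, int_mul_eq]
    push_cast
    ring
  | cons t s ih =>
    obtain ⟨d, w⟩ := t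
    simp only [combEntry]
    rcases h : c.blt d with _ | _
    · rcases h' : d.blt c with _ | _
      · obtain rfl := eq_of_blt_eq_false h h'
        simp only [cond_false, rowVal, hf, int_mul_eq, int_add_eq]
        push_cast
        ring
      · simp only [cond_false, cond_true, rowVal, ih, int_mul_eq]
        push_cast
        ring
    · simp only [cond_true, rowVal, hf, int_mul_eq]
      push_cast
      ring

theorem rowVal_combRow (a b : ℤ) (r s : List (ℕ × ℤ)) :
    rowVal x (combRow a b r s) = a * rowVal x r + b * rowVal x s := by
  induction r generalizing s with
  | nil => simp [combRow, rowVal_scaleRow, rowVal]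
  | cons t r ih => rw [combRow, rowVal_combEntry x a b _ _ ih, rowVal, mul_add]

theorem rowVal_addEntry (c : ℕ) (v : ℤ) (r : List (ℕ × ℤ)) :
    rowVal x (addEntry c v r) = v * x c + rowVal x r := by
  induction r with
  | nil => simp [addEntry, rowVal]
  | cons t r ih =>
    obtain ⟨d, w⟩ := t
    simp only [addEntry]
    rcases h : c.blt d with _ | _
    · rcases h' : c.beq d with _ | _
      · simp only [cond_false, rowVal, ih]
        ring
      · obtain rfl := Nat.eq_of_beq_eq_true h'
        simp only [cond_false, cond_true, rowVal]
        push_cast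
        ring
    · simp [rowVal]

theorem rowVal_sortRow (r : List (ℕ × ℤ)) : rowVal x (sortRow r) = rowVal x r := by
  induction r with
  | nil => rfl
  | cons t r ih => simp [sortRow, rowVal_addEntry, rowVal, ih]

theorem rowVal_insRow (es : List (List (ℕ × ℤ))) (r : List (ℕ × ℤ)) (hes : ∀ e ∈ es, rowVal x e = 0)
    (hr : rowVal x r = 0) : ∀ e ∈ insRow es r, rowVal x e = 0 := by
  induction es generalizing r with
  | nil =>
    rcases r with _ | ⟨⟨c, v⟩, t⟩
    · simp [insRow]
    · simpa [insRow] using hr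
  | cons e es ih =>
    have hes' : ∀ e ∈ es, rowVal x e = 0 := fun e he => hes e (List.mem_cons_of_mem _ he)
    rcases r with _ | ⟨⟨c, v⟩, t⟩
    · rcases e with _ | ⟨⟨d, w⟩, u⟩ <;> simpa [insRow] using hes
    rcases e with _ | ⟨⟨d, w⟩, u⟩
    · exact ih _ hes' hr
    have he : rowVal x ((d, w) :: u) = 0 := hes _ (List.mem_cons_self)
    simp only [insRow]
    rcases h : c.blt d with _ | _
    · rcases h' : d.blt c with _ | _
      · obtain rfl := eq_of_blt_eq_false h h'
        simp only [cond_false, forceNat_eq, forceInt_eq, forceRow_eq]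
        split_ifs
        · simp
        · simp
        refine List.forall_mem_cons.2 ⟨he, ih _ hes' ?_⟩
        rw [rowVal_filter, rowVal_combRow]
        obtain ⟨v', hv⟩ := Int.gcd_dvd_left v w
        obtain ⟨w', hw⟩ := Int.gcd_dvd_right v w
        simp only [rowVal] at hr he
        generalize Int.gcd v w = g at hv hw
        rcases eq_or_ne (g : ℤ) 0 with h0 | h0
        · simp [h0]
        rw [hv, hw, Int.mul_ediv_cancel_left _ h0, Int.mul_ediv_cancel_left _ h0]
        rw [hv] at hr
        rw [hw] at he
        push_cast at hr he ⊢
        linear_combination (w' : K) * hr - (v' : K) * he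
      · simp only [cond_false, cond_true]
        exact List.forall_mem_cons.2 ⟨he, ih _ hes' hr⟩
    · exact List.forall_mem_cons.2 ⟨hr, hes⟩

theorem rowVal_foldl_insRow (rs es : List (List (ℕ × ℤ))) (hes : ∀ e ∈ es, rowVal x e = 0)
    (hrs : ∀ r ∈ rs, rowVal x r = 0) : ∀ e ∈ rs.foldl insRow es, rowVal x e = 0 := by
  induction rs generalizing es with
  | nil => exact hes
  | cons r rs ih =>
    exact ih _ (rowVal_insRow x es r hes (hrs r List.mem_cons_self))
      fun r hr => hrs r (List.mem_cons_of_mem _ hr)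

theorem rowVal_eq_zero {r : List (ℕ × ℤ)} (h : ∀ t ∈ r, x t.1 = 0) : rowVal x r = 0 := by
  induction r with
  | nil => rfl
  | cons t r ih =>
    rw [rowVal, h t List.mem_cons_self, ih fun t ht => h t (List.mem_cons_of_mem _ ht)]
    simp

theorem eq_zero_of_solved [CharZero K] (es : List (List (ℕ × ℤ))) (hes : ∀ e ∈ es, rowVal x e = 0)
    (c : ℕ) (hc : (solved es).testBit c = true) : x c = 0 := by
  induction es generalizing c with
  | nil => simp [solved] at hc
  | cons e es ih =>
    have ih' := ih fun e he => hes e (List.mem_cons_of_mem _ he)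
    rcases e with _ | ⟨⟨d, w⟩, u⟩
    · exact ih' c hc
    rw [solved, forceNat_eq] at hc
    rcases h : (!w.natAbs.beq 0 && u.all fun q => (solved es).testBit q.1) with _ | _
    · rw [h] at hc
      exact ih' c hc
    · rw [h, cond_true, Nat.testBit_or, Nat.testBit_two_pow, Bool.or_eq_true] at hc
      rcases hc with hc | hc
      · exact ih' c hc
      · simp only [decide_eq_true_eq] at hc
        subst hc
        rw [Bool.and_eq_true, List.all_eq_true] at h
        have he : rowVal x ((d, w) :: u) = 0 := hes _ List.mem_cons_self
        rw [rowVal, rowVal_eq_zero x fun t ht => ih' _ (h.2 t ht), add_zero] at he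
        have hw : w ≠ 0 := by
          rintro rfl
          simp at h
        exact (mul_eq_zero.1 he).resolve_left (by exact_mod_cast hw)

theorem sortIns_perm (a : ℕ) (l : List ℕ) : (sortIns a l).Perm (a :: l) := by
  induction l with
  | nil => exact List.Perm.refl _
  | cons b l ih =>
    rw [sortIns]
    rcases a.ble b with _ | _
    · exact (ih.cons b).trans (List.Perm.swap _ _ _)
    · exact List.Perm.refl _

theorem sortList_perm (l : List ℕ) : (sortList l).Perm l := by
  induction l with
  | nil => exact List.Perm.refl _
  | cons a l ih => exact (sortIns_perm a _).trans (ih.cons a)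

theorem decode_encode (n : ℕ) (l : List ℕ) (hl : ∀ a ∈ l, a < n) :
    decode n l.length (encode n l) = l := by
  induction l with
  | nil => rfl
  | cons a l ih =>
    have ha : a < n := hl a List.mem_cons_self
    simp only [List.length_cons, decode, encode]
    rw [Nat.add_mul_mod_self_left, Nat.mod_eq_of_lt ha, Nat.add_mul_div_left _ _ (by omega),
      Nat.div_eq_of_lt ha, zero_add, ih fun a ha => hl a (List.mem_cons_of_mem _ ha)]

theorem pairwise_sortIns (a : ℕ) (l : List ℕ) (hl : l.Pairwise (· ≤ ·)) :
    (sortIns a l).Pairwise (· ≤ ·) := by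
  induction l with
  | nil => simp [sortIns]
  | cons b l ih =>
    rw [sortIns]
    rw [List.pairwise_cons] at hl
    rcases h : a.ble b with _ | _
    · have hba : b ≤ a := by
        rw [← Bool.not_eq_true, Nat.ble_eq] at h
        omega
      refine List.pairwise_cons.2 ⟨fun c hc => ?_, ih hl.2⟩
      rcases List.mem_cons.1 ((sortIns_perm a l).mem_iff.1 hc) with rfl | hc
      · exact hba
      · exact hl.1 c hc
    · have hab := Nat.le_of_ble_eq_true h
      refine List.pairwise_cons.2 ⟨fun c hc => ?_, List.pairwise_cons.2 hl⟩
      rcases List.mem_cons.1 hc with rfl | hc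
      · exact hab
      · exact hab.trans (hl.1 c hc)

theorem pairwise_sortList (l : List ℕ) : (sortList l).Pairwise (· ≤ ·) := by
  induction l with
  | nil => exact List.Pairwise.nil
  | cons a l ih => exact pairwise_sortIns a _ ih

theorem mem_sortedLists (n : ℕ) (l : List ℕ) (hl : l.Pairwise (· ≤ ·)) (hn : ∀ a ∈ l, a < n) :
    l ∈ sortedLists n l.length := by
  induction l with
  | nil => simp [sortedLists]
  | cons a l ih =>
    rw [List.pairwise_cons] at hl
    rw [List.forall_mem_cons] at hn
    simp only [sortedLists, List.length_cons, List.mem_flatMap, List.mem_map, List.mem_range]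
    refine ⟨l, ih hl.2 hn.2, a, ?_, rfl⟩
    rcases l with _ | ⟨b, l⟩
    · simp only [List.headD_nil]
      omega
    · have := hl.1 b List.mem_cons_self
      simp only [List.headD_cons]
      omega

variable {n : ℕ} {z : List ℕ → Bool} {y : List ℕ → K} {p : List (ℕ × ℤ)}

theorem rowVal_contrRow (d : ℕ) (hp : ∀ t ∈ p, t.1 < n) (hy : ∀ l l', l.Perm l' → y l = y l')
    (hz : ∀ l, l.length = d → (∀ a ∈ l, a < n) → z l = true → y l = 0) (e : ℕ) (a : ℤ) (l : List ℕ)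
    (hl : ∀ a ∈ l, a < n) (hd : l.length + e = d) :
    rowVal (fun c => y (decode n d c)) (contrRow n z p e a l) = a * contr y p e l := by
  induction e generalizing a l with
  | zero =>
    have hs := sortList_perm l
    have hs' : (sortList l).length = d := by rw [hs.length_eq]; exact hd
    have hsn : ∀ a ∈ sortList l, a < n := fun a ha => hl a (hs.mem_iff.1 ha)
    rw [contrRow, contr, ← hy _ _ hs]
    rcases h : z (sortList l) with _ | _
    · rw [cond_false, rowVal, rowVal, add_zero]
      conv_lhs => rw [← hs', decode_encode n _ hsn]
    · rw [cond_true, hz _ hs' hsn h, rowVal, mul_zero]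
  | succ e ih =>
    rw [contrRow, contr]
    have : ∀ q : List (ℕ × ℤ), (∀ t ∈ q, t.1 < n) →
        rowVal (fun c => y (decode n d c))
          (q.flatMap fun t => contrRow n z p e (a * t.2) (t.1 :: l)) =
        a * (q.map fun t => (t.2 : K) * contr y p e (t.1 :: l)).sum := by
      intro q hq
      induction q with
      | nil => simp [rowVal]
      | cons t q ihq =>
        rw [List.flatMap_cons, rowVal_append, ihq fun t ht => hq t (List.mem_cons_of_mem _ ht),
          ih _ _ (List.forall_mem_cons.2 ⟨hq t List.mem_cons_self, hl⟩) (by simp; omega)]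
        simp only [List.map_cons, List.sum_cons]
        push_cast
        ring
    exact this p hp

/-- A symmetric array satisfying a system of contraction equations that passes the
elimination check vanishes. -/
theorem eq_zero_of_checkZero [CharZero K] {d : ℕ} {P : List (List (ℕ × ℤ))}
    (hP : ∀ p ∈ P, ∀ t ∈ p, t.1 < n) (hy : ∀ l l', l.Perm l' → y l = y l')
    (hz : ∀ l, l.length = d + 1 → (∀ a ∈ l, a < n) → z l = true → y l = 0)
    (hc : ∀ p ∈ P, ∀ k < n, contr y p d [k] = 0) (h : checkZero n d z P = true)
    (l : List ℕ) (hl : l.length = d + 1) (hln : ∀ a ∈ l, a < n) : y l = 0 := by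
  have hs := sortList_perm l
  have hs' : (sortList l).length = d + 1 := by rw [hs.length_eq, hl]
  have hsn : ∀ a ∈ sortList l, a < n := fun a ha => hln a (hs.mem_iff.1 ha)
  rw [checkZero, forceRows_eq, forceRows_eq, forceNat_eq, allSolved, List.all_eq_true] at h
  have h1 := h (sortList l) (by rw [← hs']; exact mem_sortedLists n _ (pairwise_sortList l) hsn)
  rw [← hy _ _ hs]
  rw [Bool.or_eq_true] at h1
  rcases h1 with h1 | h1
  · exact hz _ hs' hsn h1
  · have := eq_zero_of_solved (fun c => y (decode n (d + 1) c)) _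
      (rowVal_map_filter _ (rowVal_foldl_insRow _ _ [] (by simp)
        (rowVal_map_filter _ fun r hr => ?_))) _ h1
    · rw [← hs', decode_encode n _ hsn] at this
      exact this
    · simp only [contrRows, List.mem_flatMap, List.mem_map, List.mem_range] at hr
      obtain ⟨p, hp, k, hk, rfl⟩ := hr
      rw [rowVal_sortRow, rowVal_contrRow (d + 1) (hP p hp) hy hz _ _ _
        (by simpa using hk) (by simp; omega), hc p hp k hk, mul_zero]

end Soundness

section Tensors
variable {K : Type} [Field K] {σ ι : Type} [Fintype σ]

/-- The quadratic contraction of a cubic tensor with a vector. -/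
def contr3 (p : σ → K) (k : σ) : (σ → σ → σ → K) →ₗ[K] K where
  toFun T := ∑ i, ∑ j, p i * p j * T i j k
  map_add' T T' := by simp [mul_add, Finset.sum_add_distrib]
  map_smul' c T := by
    simp only [Pi.smul_apply, smul_eq_mul, RingHom.id_apply, Finset.mul_sum]
    exact Finset.sum_congr rfl fun i _ => Finset.sum_congr rfl fun j _ => by ring

theorem contr3_apply (p : σ → K) (k : σ) (T : σ → σ → σ → K) :
    contr3 p k T = ∑ i, ∑ j, p i * p j * T i j k := rfl

/-- Pull back a cubic tensor along a map of index sets. -/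
def resT {α : Type} (f : α → σ) : (σ → σ → σ → K) →ₗ[K] (α → α → α → K) where
  toFun T i j k := T (f i) (f j) (f k)
  map_add' _ _ := rfl
  map_smul' _ _ := rfl

@[simp] theorem resT_apply {σ α : Type} (f : α → σ) (T : σ → σ → σ → K) (i j k : α) :
    resT f T i j k = T (f i) (f j) (f k) := rfl

theorem contr3_comp {α : Type} [Fintype α] {f : α → σ} (hf : Function.Injective f) (p : σ → K)
    (c : α) (T : σ → σ → σ → K)
    (h : ∀ a b, a ∉ Set.range f ∨ b ∉ Set.range f → p a * p b * T a b (f c) = 0) :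
    contr3 p (f c) T = contr3 (p ∘ f) c (resT f T) := by
  rw [contr3_apply, contr3_apply]
  symm
  refine Fintype.sum_of_injective f hf _ _ (fun i hi => ?_) fun i => ?_
  · exact Finset.sum_eq_zero fun j _ => h i j (Or.inl hi)
  · exact Fintype.sum_of_injective f hf _ _ (fun j hj => h _ _ (Or.inr hj)) fun j => rfl

/-- Symmetric cubic tensors with prescribed zeros `z`, i.e. cubic forms, that are singular at the
points `P i`. -/
def singT (z : σ → σ → σ → Bool) (P : ι → σ → K) : Submodule K (σ → σ → σ → K) where
  carrier := { T | (∀ i j k, T i j k = T j i k ∧ T i j k = T i k j) ∧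
    (∀ i j k, z i j k = true → T i j k = 0) ∧ ∀ i k, contr3 (P i) k T = 0 }
  add_mem' {T T'} hT hT' := by
    refine ⟨fun i j k => ?_, fun i j k h => ?_, fun i k => ?_⟩
    · simp [← (hT.1 i j k).1, ← (hT'.1 i j k).1, ← (hT.1 i j k).2, ← (hT'.1 i j k).2]
    · simp [hT.2.1 i j k h, hT'.2.1 i j k h]
    · rw [map_add, hT.2.2, hT'.2.2, add_zero]
  zero_mem' := ⟨fun i j k => by simp, fun i j k _ => by simp, fun i k => by simp⟩
  smul_mem' c {T} hT := by
    refine ⟨fun i j k => ?_, fun i j k h => ?_, fun i k => ?_⟩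
    · simp [← (hT.1 i j k).1, ← (hT.1 i j k).2]
    · simp [hT.2.1 i j k h]
    · rw [map_smul, hT.2.2, smul_zero]

theorem mem_singT {z : σ → σ → σ → Bool} {P : ι → σ → K} {T : σ → σ → σ → K} :
    T ∈ singT z P ↔ (∀ i j k, T i j k = T j i k ∧ T i j k = T i k j) ∧
      (∀ i j k, z i j k = true → T i j k = 0) ∧ ∀ i k, contr3 (P i) k T = 0 := Iff.rfl

variable (K) in
/-- There are points `P i`, supported on the coordinates selected by `s i`, such that the cubic
forms with zeros `z` that are singular at the points form a space of dimension at most `r`. -/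
def TBd (s : ι → σ → Bool) (z : σ → σ → σ → Bool) (r : ℕ) : Prop :=
  ∃ P : ι → σ → K, (∀ i a, s i a = false → P i a = 0) ∧ Module.finrank K (singT z P) ≤ r

/-- Set to zero the coordinates that are not selected by `s`. -/
def mask (s : ι → σ → Bool) (Q : ι → σ → K) (i : ι) (a : σ) : K := if s i a then Q i a else 0

theorem TBd.gen {s : ι → σ → Bool} {z : σ → σ → σ → Bool} {r : ℕ} (h : TBd K s z r) [Fintype ι]
    {τ : Type} (x : ι × σ → τ) (hx : Function.Injective x) :
    Gen K fun Q : τ → K =>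
      Module.finrank K (singT z (mask s fun i a => Q (x (i, a)))) ≤ r := by
  obtain ⟨P, hP, hr⟩ := h
  have key : ∀ P : ι → σ → K, singT z P = singT z (fun i : Empty => i.elim) ⊓
      ⨅ y : ι × σ, LinearMap.ker (contr3 (P y.1) y.2) := by
    intro P
    ext T
    simp [mem_singT, Submodule.mem_iInf, and_assoc]
  refine Gen.mono (Gen.finrank_inf_le (r := r) (singT z fun i : Empty => i.elim)
    (fun (y : ι × σ) Q => contr3 (mask s (fun i a => Q (x (i, a))) y.1) y.2)
    (fun y T _ => ?_) (Function.extend x (fun y => P y.1 y.2) 0) ?_) fun Q hQ => by rwa [key]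
  · have h1 : ∀ i, PolyFun K fun Q : τ → K => mask s (fun i a => Q (x (i, a))) y.1 i := by
      intro i
      unfold mask
      split_ifs
      exacts [PolyFun.coord _, PolyFun.const 0]
    simp only [contr3_apply]
    exact PolyFun.sum _ fun i => PolyFun.sum _ fun j => ((h1 i).mul (h1 j)).mul (PolyFun.const _)
  · rw [← key]
    have : mask s (fun i a => Function.extend x (fun y => P y.1 y.2) 0 (x (i, a))) = P := by
      ext i a
      unfold mask
      simp only [hx.extend_apply]
      split_ifs with h
      · rfl
      · exact (hP i a (by simpa using h)).symm
    rwa [this]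

theorem TBd.congr {s : ι → σ → Bool} {z : σ → σ → σ → Bool} {r : ℕ} (h : TBd K s z r)
    {σ' ι' : Type} [Fintype σ'] (e : ι' ≃ ι) (f : σ' ≃ σ) {s' : ι' → σ' → Bool}
    {z' : σ' → σ' → σ' → Bool} (hs : ∀ i a, s (e i) (f a) = s' i a)
    (hz : ∀ i j k, z (f i) (f j) (f k) = z' i j k) : TBd K s' z' r := by
  obtain ⟨P, hP, hr⟩ := h
  refine ⟨fun i a => P (e i) (f a), fun i a h => hP _ _ (by rw [hs, h]), le_trans ?_ hr⟩
  refine finrank_le_of_mapsTo (resT f.symm) (fun T hT => ?_) fun T _ h0 => ?_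
  · rw [mem_singT] at hT ⊢
    refine ⟨fun i j k => hT.1 _ _ _, fun i j k h => hT.2.1 _ _ _ ?_, fun i k => ?_⟩
    · rw [← hz]; simpa using h
    · have := hT.2.2 (e.symm i) (f.symm k)
      rw [contr3_comp f.symm.injective _ _ _ fun a b h => by simp at h] at this
      rwa [show (fun a => P (e (e.symm i)) (f a)) ∘ f.symm = P i by ext a; simp] at this
  · ext i j k
    simpa using congrFun (congrFun (congrFun h0 (f i)) (f j)) (f k)

end Tensors

section CubicInduction
variable {K : Type} [Field K]

variable (K) in
/-- Cubics singular at `k` general points. -/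
def Cub (n k r : ℕ) : Prop :=
  TBd K (fun (_ : Fin k) (_ : Fin n) => true) (fun _ _ _ => false) r

variable (K) in
/-- Cubics vanishing on a coordinate subspace of codimension three and singular at `k` general
points of this subspace and at `x` general points. -/
def CubOn (n k x r : ℕ) : Prop :=
  TBd K (fun (i : Fin k ⊕ Fin x) (a : Fin n ⊕ Fin 3) => i.isRight || a.isLeft)
    (fun a b c => a.isLeft && b.isLeft && c.isLeft) r

/-- The coordinates of the second of two subspaces of codimension three. -/
def notMid {α β γ : Type} : (α ⊕ β) ⊕ γ → Bool := Sum.elim Sum.isLeft fun _ => true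

/-- The coordinates of the third of three subspaces. -/
def notFirst {α β γ : Type} : (α ⊕ β) ⊕ γ → Bool := Sum.elim Sum.isRight fun _ => true

variable (K) in
/-- The only cubic vanishing on two coordinate subspaces of codimension three and singular at `y`
and `z` general points of these and at three general points is zero. -/
def CubOnTwo (n y z : ℕ) : Prop :=
  TBd K (fun (i : (Fin y ⊕ Fin z) ⊕ Fin 3) (a : (Fin n ⊕ Fin 3) ⊕ Fin 3) =>
      Sum.elim (Sum.elim (fun _ => a.isLeft) fun _ => notMid a) (fun _ => true) i)
    (fun a b c => a.isLeft && b.isLeft && c.isLeft || notMid a && notMid b && notMid c) 0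

variable (K) in
/-- The only cubic vanishing on three disjoint subspaces of codimension three and singular at
three general points of each of them is zero. -/
def CubOnThree : Prop :=
  TBd K (fun (i : (Fin 3 ⊕ Fin 3) ⊕ Fin 3) (a : (Fin 3 ⊕ Fin 3) ⊕ Fin 3) =>
      Sum.elim (Sum.elim (fun _ => a.isLeft) fun _ => notMid a) (fun _ => notFirst a) i)
    (fun a b c => a.isLeft && b.isLeft && c.isLeft || notMid a && notMid b && notMid c ||
      notFirst a && notFirst b && notFirst c) 0

theorem Cub.step [Infinite K] {n k x r₀ r₁ : ℕ} (hA : Cub K n k r₀) (hP : CubOn K n k x r₁) :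
    Cub K (n + 3) (k + x) (r₀ + r₁) := by
  obtain ⟨Q, h1, h2⟩ := ((TBd.gen hP id Function.injective_id).and
    (TBd.gen hA (Prod.map Sum.inl Sum.inl)
      (Sum.inl_injective.prodMap Sum.inl_injective))).exists
  suffices h : TBd K (fun (_ : Fin k ⊕ Fin x) (_ : Fin n ⊕ Fin 3) => true)
      (fun _ _ _ => false) (r₀ + r₁) from
    h.congr finSumFinEquiv.symm finSumFinEquiv.symm (fun _ _ => rfl) fun _ _ _ => rfl
  refine ⟨mask (fun i a => i.isRight || a.isLeft) fun i a => Q (i, a), fun i a h => by simp at h,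
    (finrank_le_add_of_maps (resT Sum.inl) LinearMap.id
    (fun T hT => ?_) (fun T hT h0 => ?_) fun T _ _ h => h).trans (Nat.add_le_add h2 h1)⟩
  · rw [mem_singT] at hT ⊢
    refine ⟨fun i j k => hT.1 _ _ _, fun i j k h => by simp at h, fun i k => ?_⟩
    have := hT.2.2 (Sum.inl i) (Sum.inl k)
    rw [contr3_comp Sum.inl_injective _ _ _ fun a b h => by
      rcases a with a | a <;> rcases b with b | b <;> simp [mask] at h ⊢] at this
    exact this
  · rw [mem_singT] at hT ⊢
    refine ⟨hT.1, fun i j k h => ?_, hT.2.2⟩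
    rcases i with i | i <;> rcases j with j | j <;> rcases k with k | k <;> simp at h
    exact congrFun (congrFun (congrFun h0 i) j) k

theorem CubOn.step [Infinite K] {n k x y r : ℕ} (hP : CubOn K n k x r) (hT : CubOnTwo K n y x) :
    CubOn K (n + 3) (k + y) (x + 3) r := by
  have hf : Function.Injective (Sum.map Sum.inl id : Fin n ⊕ Fin 3 → (Fin n ⊕ Fin 3) ⊕ Fin 3) :=
    Sum.map_injective.2 ⟨Sum.inl_injective, Function.injective_id⟩
  obtain ⟨Q, h1, h2⟩ := ((TBd.gen hP (τ := ((Fin k ⊕ Fin y) ⊕ (Fin x ⊕ Fin 3)) ×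
      ((Fin n ⊕ Fin 3) ⊕ Fin 3)) (Prod.map (Sum.map Sum.inl Sum.inl) (Sum.map Sum.inl id))
      ((Sum.map_injective.2 ⟨Sum.inl_injective, Sum.inl_injective⟩).prodMap hf)).and
    (TBd.gen hT (Prod.map (Sum.elim (Sum.map Sum.inr Sum.inl) (Sum.inr ∘ Sum.inr)) id)
      (Function.Injective.prodMap (by
        rintro ((i | i) | i) ((j | j) | j) <;> simp) Function.injective_id))).exists
  let s : (Fin k ⊕ Fin y) ⊕ (Fin x ⊕ Fin 3) → (Fin n ⊕ Fin 3) ⊕ Fin 3 → Bool := fun i a =>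
    Sum.elim (Sum.elim (fun _ => a.isLeft && notMid a) fun _ => a.isLeft)
      (Sum.elim (fun _ => notMid a) fun _ => true) i
  suffices h : TBd K (fun (i : (Fin k ⊕ Fin y) ⊕ (Fin x ⊕ Fin 3)) (a : (Fin n ⊕ Fin 3) ⊕ Fin 3) =>
      i.isRight || a.isLeft) (fun a b c => a.isLeft && b.isLeft && c.isLeft) r from
    h.congr ((Equiv.sumCongr finSumFinEquiv finSumFinEquiv).symm)
      ((Equiv.sumCongr finSumFinEquiv (Equiv.refl _)).symm)
      (fun i a => by rcases i with i | i <;> rcases a with a | a <;> rfl)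
      fun a b c => by
        rcases a with a | a <;> rcases b with b | b <;> rcases c with c | c <;> rfl
  refine ⟨mask s fun i a => Q (i, a), fun i a h => ?_,
    (finrank_le_add_of_maps (resT (Sum.map Sum.inl id)) LinearMap.id
    (fun T hT => ?_) (fun T hT h0 => ?_) fun T _ _ h => h).trans (Nat.add_le_add h1 h2)⟩
  · rcases i with (i | i) | (i | i) <;> rcases a with a | a <;> simp [mask, s] at h ⊢
  · rw [mem_singT] at hT ⊢
    refine ⟨fun i j k => hT.1 _ _ _, fun a b c h => hT.2.1 _ _ _ ?_, fun i c => ?_⟩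
    · rcases a with a | a <;> rcases b with b | b <;> rcases c with c | c <;> simp at h ⊢
    · have := hT.2.2 (Sum.map Sum.inl Sum.inl i) (Sum.map Sum.inl id c)
      rw [contr3_comp hf _ _ _ fun a b h => by
        rcases i with i | i <;> rcases a with (a | a) | a <;> rcases b with (b | b) | b <;>
          simp [mask, s, notMid] at h ⊢] at this
      rw [← this]
      congr 2
      ext a
      rcases i with i | i <;> rcases a with a | a <;> simp [mask, s, notMid]
  · rw [mem_singT] at hT ⊢
    refine ⟨hT.1, fun a b c h => ?_, fun i c => ?_⟩
    · rw [Bool.or_eq_true] at h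
      rcases h with h | h
      · exact hT.2.1 _ _ _ h
      · rcases a with (a | a) | a <;> rcases b with (b | b) | b <;> rcases c with (c | c) | c <;>
          simp [notMid] at h
        · exact congrFun (congrFun (congrFun h0 (.inl a)) (.inl b)) (.inl c)
        · exact congrFun (congrFun (congrFun h0 (.inl a)) (.inl b)) (.inr c)
        · exact congrFun (congrFun (congrFun h0 (.inl a)) (.inr b)) (.inl c)
        · exact congrFun (congrFun (congrFun h0 (.inl a)) (.inr b)) (.inr c)
        · exact congrFun (congrFun (congrFun h0 (.inr a)) (.inl b)) (.inl c)
        · exact congrFun (congrFun (congrFun h0 (.inr a)) (.inl b)) (.inr c)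
        · exact congrFun (congrFun (congrFun h0 (.inr a)) (.inr b)) (.inl c)
        · exact congrFun (congrFun (congrFun h0 (.inr a)) (.inr b)) (.inr c)
    · rw [← hT.2.2 (Sum.elim (Sum.map Sum.inr Sum.inl) (Sum.inr ∘ Sum.inr) i) c]
      congr 2
      ext a
      rcases i with (i | i) | i <;> rfl

theorem CubOnTwo.step [Infinite K] {n y z : ℕ} (hP : CubOnTwo K n y z) (hT : CubOnThree K) :
    CubOnTwo K (n + 3) (y + 3) (z + 3) := by
  let ν : (Fin n ⊕ Fin 3) ⊕ Fin 3 → ((Fin n ⊕ Fin 3) ⊕ Fin 3) ⊕ Fin 3 :=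
    Sum.map (Sum.map Sum.inl id) id
  let ρ : (Fin 3 ⊕ Fin 3) ⊕ Fin 3 → ((Fin n ⊕ Fin 3) ⊕ Fin 3) ⊕ Fin 3 :=
    Sum.map (Sum.map Sum.inr id) id
  have hν : Function.Injective ν := Sum.map_injective.2 ⟨Sum.map_injective.2
    ⟨Sum.inl_injective, Function.injective_id⟩, Function.injective_id⟩
  have hρ : Function.Injective ρ := Sum.map_injective.2 ⟨Sum.map_injective.2
    ⟨Sum.inr_injective, Function.injective_id⟩, Function.injective_id⟩
  obtain ⟨Q, h1, h2⟩ := ((TBd.gen hP (τ := (((Fin y ⊕ Fin 3) ⊕ (Fin z ⊕ Fin 3)) ⊕ Fin 3) ×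
      (((Fin n ⊕ Fin 3) ⊕ Fin 3) ⊕ Fin 3))
      (Prod.map (Sum.map (Sum.map Sum.inl Sum.inl) id) ν)
      (Function.Injective.prodMap (Sum.map_injective.2 ⟨Sum.map_injective.2
        ⟨Sum.inl_injective, Sum.inl_injective⟩, Function.injective_id⟩) hν)).and
    (TBd.gen hT (Prod.map (Sum.map (Sum.map Sum.inr Sum.inr) id) ρ)
      (Function.Injective.prodMap (Sum.map_injective.2 ⟨Sum.map_injective.2
        ⟨Sum.inr_injective, Sum.inr_injective⟩, Function.injective_id⟩) hρ))).exists
  let inN : ((Fin n ⊕ Fin 3) ⊕ Fin 3) ⊕ Fin 3 → Bool := Sum.elim notMid fun _ => true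
  let inR : ((Fin n ⊕ Fin 3) ⊕ Fin 3) ⊕ Fin 3 → Bool := Sum.elim notFirst fun _ => true
  let s : ((Fin y ⊕ Fin 3) ⊕ (Fin z ⊕ Fin 3)) ⊕ Fin 3 →
      ((Fin n ⊕ Fin 3) ⊕ Fin 3) ⊕ Fin 3 → Bool := fun i a =>
    Sum.elim (Sum.elim (Sum.elim (fun _ => a.isLeft && inN a) fun _ => a.isLeft && inR a)
      (Sum.elim (fun _ => notMid a && inN a) fun _ => notMid a && inR a)) (fun _ => inN a) i
  suffices h : TBd K (fun (i : ((Fin y ⊕ Fin 3) ⊕ (Fin z ⊕ Fin 3)) ⊕ Fin 3)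
      (a : ((Fin n ⊕ Fin 3) ⊕ Fin 3) ⊕ Fin 3) =>
      Sum.elim (Sum.elim (fun _ => a.isLeft) fun _ => notMid a) (fun _ => true) i)
      (fun a b c => a.isLeft && b.isLeft && c.isLeft || notMid a && notMid b && notMid c) 0 from
    h.congr ((Equiv.sumCongr (Equiv.sumCongr finSumFinEquiv finSumFinEquiv) (Equiv.refl _)).symm)
      ((Equiv.sumCongr (Equiv.sumCongr finSumFinEquiv (Equiv.refl _)) (Equiv.refl _)).symm)
      (fun i a => by
        rcases i with (i | i) | i <;> rcases a with (a | a) | a <;> rfl)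
      fun a b c => by
        rcases a with (a | a) | a <;> rcases b with (b | b) | b <;> rcases c with (c | c) | c <;>
          rfl
  refine ⟨mask s fun i a => Q (i, a), fun i a h => ?_,
    (finrank_le_add_of_maps (resT ν) (resT ρ)
    (fun T hT => ?_) (fun T hT h0 => ?_) fun T hT h0 h0' => ?_).trans (Nat.add_le_add h1 h2)⟩
  · rcases i with ((i | i) | (i | i)) | i <;> rcases a with (a | a) | a <;>
      simp [mask, s, notMid] at h ⊢
  · rw [mem_singT] at hT ⊢
    refine ⟨fun i j k => hT.1 _ _ _, fun a b c h => hT.2.1 _ _ _ ?_, fun i c => ?_⟩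
    · rcases a with (a | a) | a <;> rcases b with (b | b) | b <;> rcases c with (c | c) | c <;>
        exact h
    · have := hT.2.2 (Sum.map (Sum.map Sum.inl Sum.inl) id i) (ν c)
      rw [contr3_comp hν _ _ _ fun a b h => by
        rcases i with (i | i) | i <;> rcases a with ((a | a) | a) | a <;>
          rcases b with ((b | b) | b) | b <;>
          simp [mask, s, notMid, inN, ν] at h ⊢] at this
      rw [← this]
      congr 2
      ext a
      rcases i with (i | i) | i <;> rcases a with (a | a) | a <;> rfl
  all_goals
    have hN : ∀ a b c, inN a && inN b && inN c → T a b c = 0 := by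
      have hr : ∀ a, inN a = true → ∃ a', a = ν a' := by
        rintro (((a | a) | a) | a) h
        · exact ⟨.inl (.inl a), rfl⟩
        · simp [inN, notMid] at h
        · exact ⟨.inl (.inr a), rfl⟩
        · exact ⟨.inr a, rfl⟩
      intro a b c h
      rw [Bool.and_eq_true, Bool.and_eq_true] at h
      obtain ⟨a, rfl⟩ := hr a h.1.1
      obtain ⟨b, rfl⟩ := hr b h.1.2
      obtain ⟨c, rfl⟩ := hr c h.2
      exact congrFun (congrFun (congrFun h0 a) b) c
    have hL : ∀ a b c, a.isLeft && b.isLeft && c.isLeft → T a b c = 0 := fun a b c h =>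
      hT.2.1 a b c (by simp only [h, Bool.true_or])
    have hM : ∀ a b c, notMid a && notMid b && notMid c → T a b c = 0 := fun a b c h =>
      hT.2.1 a b c (by simp only [h, Bool.or_true])
  · rw [mem_singT] at hT ⊢
    refine ⟨fun i j k => hT.1 _ _ _, fun a b c h => ?_, fun i c => ?_⟩
    · rw [Bool.or_eq_true, Bool.or_eq_true] at h
      rcases h with (h | h) | h
      · refine hL _ _ _ ?_
        rcases a with (a | a) | a <;> rcases b with (b | b) | b <;> rcases c with (c | c) | c <;>
          exact h
      · refine hM _ _ _ ?_
        rcases a with (a | a) | a <;> rcases b with (b | b) | b <;> rcases c with (c | c) | c <;>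
          first | rfl | exact h
      · refine hN _ _ _ ?_
        rcases a with (a | a) | a <;> rcases b with (b | b) | b <;> rcases c with (c | c) | c <;>
          exact h
    · have := hT.2.2 (Sum.map (Sum.map Sum.inr Sum.inr) id i) (ρ c)
      rw [contr3_comp hρ _ _ _ fun a b h => by
        rcases i with (i | i) | i
        · rcases a with ((a | a) | a) | a <;> rcases b with ((b | b) | b) | b <;>
            simp [mask, s, notFirst, inR, ρ] at h ⊢
        · rcases a with ((a | a) | a) | a <;> rcases b with ((b | b) | b) | b <;>
            simp [mask, s, notFirst, inR, ρ] at h ⊢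
        · rcases a with ((a | a) | a) | a <;> rcases b with ((b | b) | b) | b <;>
            rcases c with (c | c) | c <;>
            first
              | rw [hL _ _ _ rfl, mul_zero]
              | rw [hM _ _ _ rfl, mul_zero]
              | rw [hN _ _ _ rfl, mul_zero]
              | simp [ρ] at h] at this
      rw [← this]
      congr 2
      ext a
      rcases i with (i | i) | i <;> rcases a with (a | a) | a <;> rfl
  · have hR : ∀ a b c, inR a && inR b && inR c → T a b c = 0 := by
      have hr : ∀ a, inR a = true → ∃ a', a = ρ a' := by
        rintro (((a | a) | a) | a) h
        · simp [inR, notFirst] at h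
        · exact ⟨.inl (.inl a), rfl⟩
        · exact ⟨.inl (.inr a), rfl⟩
        · exact ⟨.inr a, rfl⟩
      intro a b c h
      rw [Bool.and_eq_true, Bool.and_eq_true] at h
      obtain ⟨a, rfl⟩ := hr a h.1.1
      obtain ⟨b, rfl⟩ := hr b h.1.2
      obtain ⟨c, rfl⟩ := hr c h.2
      exact congrFun (congrFun (congrFun h0' a) b) c
    ext a b c
    rcases a with ((a | a) | a) | a <;> rcases b with ((b | b) | b) | b <;>
      rcases c with ((c | c) | c) | c <;>
      first
        | exact hL _ _ _ rfl
        | exact hM _ _ _ rfl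
        | exact hN _ _ _ rfl
        | exact hR _ _ _ rfl

end CubicInduction

section Certification
variable {K : Type} [Field K] {σ ι : Type} [Fintype σ] [DecidableEq σ]

/-- The vector with the coordinates listed in `p`. -/
def vecOf (K : Type) [Field K] (dec : ℕ → σ) (p : List (ℕ × ℤ)) (a : σ) : K :=
  (p.map fun t => if dec t.1 = a then (t.2 : K) else 0).sum

theorem sum_vecOf_mul (dec : ℕ → σ) (p : List (ℕ × ℤ)) (g : σ → K) :
    ∑ a, vecOf K dec p a * g a = (p.map fun t => (t.2 : K) * g (dec t.1)).sum := by
  induction p with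
  | nil => simp [vecOf]
  | cons t p ih =>
    simp only [vecOf, List.map_cons, List.sum_cons, add_mul, Finset.sum_add_distrib] at ih ⊢
    rw [ih]
    simp

/-- The entries of a cubic tensor as a function on lists of indices. -/
def entry (dec : ℕ → σ) (T : σ → σ → σ → K) : List ℕ → K
  | [a, b, c] => T (dec a) (dec b) (dec c)
  | _ => 0

theorem contr_entry (dec : ℕ → σ) (T : σ → σ → σ → K) (p : List (ℕ × ℤ)) (k : ℕ) :
    contr (entry dec T) p 2 [k] = contr3 (vecOf K dec p) (dec k) (fun a b c => T b a c) := by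
  simp only [contr, entry, contr3_apply, mul_assoc, ← Finset.mul_sum]
  rw [sum_vecOf_mul]
  simp only [sum_vecOf_mul]

theorem entry_perm {σ : Type} (dec : ℕ → σ) {T : σ → σ → σ → K}
    (hT : ∀ i j k, T i j k = T j i k ∧ T i j k = T i k j) {l l' : List ℕ} (h : l.Perm l') :
    entry dec T l = entry dec T l' := by
  by_cases hl : l.length = 3
  · obtain ⟨a, b, c, rfl⟩ := List.length_eq_three.1 hl
    have h1 := List.mem_permutations.2 h.symm
    have h12 := fun i j k => (hT i j k).1
    have h23 := fun i j k => (hT i j k).2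
    simp [List.permutations, List.permutationsAux, List.permutationsAux.rec,
      List.permutationsAux2] at h1
    rcases h1 with rfl | rfl | rfl | rfl | rfl | rfl <;> simp only [entry] <;> grind
  · have hl' : l'.length ≠ 3 := by rwa [← h.length_eq]
    have : ∀ l : List ℕ, l.length ≠ 3 → entry dec T l = 0 := by
      intro l hl
      unfold entry
      split
      · simp at hl
      · rfl
    rw [this l hl, this l' hl']

/-- Certify a dimension bound for spaces of cubics by elimination. -/
theorem TBd.of_checkZero [CharZero K] (n : ℕ) (dec : ℕ → σ) (hdec : ∀ a, ∃ k < n, dec k = a)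
    {s : ι → σ → Bool} {z : σ → σ → σ → Bool} (pt : ι → List (ℕ × ℤ)) (L : List (List (ℕ × ℤ)))
    (extra : List (List ℕ)) (hL : ∀ p ∈ L, ∃ i, pt i = p) (hlt : ∀ p ∈ L, ∀ t ∈ p, t.1 < n)
    (hs : ∀ i, ∀ t ∈ pt i, s i (dec t.1) = true) (zl : List ℕ → Bool)
    (hz : ∀ a < n, ∀ b < n, ∀ c < n, zl [a, b, c] = true →
      z (dec a) (dec b) (dec c) = true ∨ [a, b, c] ∈ extra)
    (h : checkZero n 2 zl L = true) : TBd K s z extra.length := by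
  refine ⟨fun i => vecOf K dec (pt i), fun i a h0 => ?_,
    finrank_le_of_functionals _ (LinearMap.pi fun i => ?_) fun T hT h0 => ?_⟩
  · unfold vecOf
    refine List.sum_eq_zero fun x hx => ?_
    obtain ⟨t, ht, rfl⟩ := List.mem_map.1 hx
    rw [if_neg]
    rintro rfl
    rw [hs i t ht] at h0
    exact absurd h0 (by simp)
  · exact
      { toFun := fun T => entry dec T (extra.get i)
        map_add' := fun T T' => by unfold entry; split <;> simp
        map_smul' := fun c T => by unfold entry; split <;> simp }
  · rw [mem_singT] at hT
    have key := eq_zero_of_checkZero (y := entry dec T) hlt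
      (fun l l' h => entry_perm dec hT.1 h) (fun l hl hln hzl => ?_) (fun p hp k hk => ?_) h
    · ext i j k
      obtain ⟨a, ha, rfl⟩ := hdec i
      obtain ⟨b, hb, rfl⟩ := hdec j
      obtain ⟨c, hc, rfl⟩ := hdec k
      exact key [a, b, c] rfl (by simp [ha, hb, hc])
    · obtain ⟨a, b, c, rfl⟩ := List.length_eq_three.1 hl
      simp only [List.mem_cons, List.not_mem_nil, or_false, forall_eq_or_imp, forall_eq] at hln
      rcases hz a hln.1 b hln.2.1 c hln.2.2 hzl with h1 | h1
      · exact hT.2.1 _ _ _ h1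
      · obtain ⟨i, hi⟩ := List.get_of_mem h1
        rw [← hi]
        exact congrFun h0 i
    · obtain ⟨i, rfl⟩ := hL p hp
      rw [contr_entry]
      convert hT.2.2 i (dec k) using 2
      ext a b c
      exact (hT.1 _ _ _).1

end Certification

section Certificates
variable {K : Type} [Field K] [CharZero K]

/-- The numbering of the coordinates of a space with a subspace of codimension three. -/
def numberOne (n i : ℕ) : Fin n ⊕ Fin 3 :=
  if h : i < n then .inl ⟨i, h⟩ else .inr (Fin.ofNat 3 (i - n))

/-- The numbering of the coordinates of a space with two subspaces of codimension three. -/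
def numberTwo (n i : ℕ) : (Fin n ⊕ Fin 3) ⊕ Fin 3 :=
  if i < n + 3 then .inl (numberOne n i) else .inr (Fin.ofNat 3 (i - (n + 3)))

theorem Cub.of_checkZero {n : ℕ} [NeZero n] (L : List (List (ℕ × ℤ))) (extra : List (List ℕ))
    (hlt : ∀ p ∈ L, ∀ t ∈ p, t.1 < n) (h : checkZero n 2 (fun l => extra.contains l) L = true) :
    Cub K n L.length extra.length :=
  TBd.of_checkZero n (Fin.ofNat n) (fun a => ⟨a, a.2, Fin.ofNat_val_eq_self a⟩)
    (fun i => L.get i) L extra (fun p hp => List.get_of_mem hp) hlt (fun _ _ _ => rfl) _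
    (fun a _ b _ c _ h => Or.inr (by simpa using h)) h

theorem CubOn.of_checkZero {n : ℕ} (L M : List (List (ℕ × ℤ))) (extra : List (List ℕ))
    (hL : ∀ p ∈ L, ∀ t ∈ p, t.1 < n) (hM : ∀ p ∈ M, ∀ t ∈ p, t.1 < n + 3)
    (h : checkZero (n + 3) 2 (fun l => l.all (Nat.blt · n) || extra.contains l) (L ++ M) = true) :
    CubOn K n L.length M.length extra.length := by
  refine TBd.of_checkZero (n + 3) (numberOne n) ?_ (Sum.elim (fun i => L.get i) fun i => M.get i)
    (L ++ M) extra ?_ ?_ ?_ _ ?_ h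
  · rintro (a | a)
    · exact ⟨a, by omega, by simp [numberOne]⟩
    · exact ⟨n + a, by omega, by simp [numberOne]⟩
  · intro p hp
    rcases List.mem_append.1 hp with hp | hp
    · obtain ⟨i, hi⟩ := List.get_of_mem hp
      exact ⟨.inl i, hi⟩
    · obtain ⟨i, hi⟩ := List.get_of_mem hp
      exact ⟨.inr i, hi⟩
  · intro p hp t ht
    rcases List.mem_append.1 hp with hp | hp
    · exact (hL p hp t ht).trans_le (by omega)
    · exact hM p hp t ht
  · rintro (i | i) t ht
    · simp [numberOne, hL _ (List.get_mem L i) t ht]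
    · rfl
  · intro a _ b _ c _ h
    rw [Bool.or_eq_true] at h
    refine h.imp (fun h => ?_) fun h => by simpa using h
    simp only [List.all_cons, List.all_nil, Nat.blt_eq, Bool.and_eq_true, and_true] at h
    simp [numberOne, h.1, h.2.1, h.2.2]

theorem CubOnTwo.of_checkZero {n : ℕ} (L M R : List (List (ℕ × ℤ))) (hR' : R.length = 3)
    (hL : ∀ p ∈ L, ∀ t ∈ p, t.1 < n + 3) (hM : ∀ p ∈ M, ∀ t ∈ p, t.1 < n + 6)
    (hM' : ∀ p ∈ M, ∀ t ∈ p, notMid (numberTwo n t.1) = true)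
    (hR : ∀ p ∈ R, ∀ t ∈ p, t.1 < n + 6)
    (h : checkZero (n + 6) 2 (fun l => l.all (fun i => (numberTwo n i).isLeft) ||
      l.all fun i => notMid (numberTwo n i)) (L ++ (M ++ R)) = true) :
    CubOnTwo K n L.length M.length := by
  refine TBd.of_checkZero (n + 6) (numberTwo n) ?_
    (Sum.elim (Sum.elim (fun i => L.get i) fun i => M.get i) fun i => R.get (i.cast hR'.symm))
    (L ++ (M ++ R)) [] ?_ ?_ ?_ _ ?_ h
  · rintro ((a | a) | a)
    · exact ⟨a, by omega, by simp [numberOne, numberTwo]; omega⟩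
    · exact ⟨n + a, by omega, by simp [numberOne, numberTwo]⟩
    · exact ⟨n + 3 + a, by omega, by simp [numberTwo]⟩
  · intro p hp
    rcases List.mem_append.1 hp with hp | hp
    · obtain ⟨i, hi⟩ := List.get_of_mem hp
      exact ⟨.inl (.inl i), hi⟩
    rcases List.mem_append.1 hp with hp | hp
    · obtain ⟨i, hi⟩ := List.get_of_mem hp
      exact ⟨.inl (.inr i), hi⟩
    · obtain ⟨i, hi⟩ := List.get_of_mem hp
      exact ⟨.inr (i.cast hR'), hi⟩
  · intro p hp t ht
    rcases List.mem_append.1 hp with hp | hp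
    · exact (hL p hp t ht).trans_le (by omega)
    rcases List.mem_append.1 hp with hp | hp
    · exact hM p hp t ht
    · exact hR p hp t ht
  · rintro ((i | i) | i) t ht
    · simp [numberTwo, hL _ (List.get_mem L i) t ht]
    · exact hM' _ (List.get_mem M i) t ht
    · rfl
  · intro a _ b _ c _ h
    left
    simpa only [List.all_cons, List.all_nil, Bool.and_true, Bool.and_assoc] using h

set_option maxRecDepth 100000 in
theorem cub_3_4 : Cub K 3 4 0 :=
  Cub.of_checkZero
    [[(2, 1)],
     [(1, 1)],
     [(0, 1)],
     [(0, 1), (2, 1)]]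
    [] (by decide +kernel) (by decide +kernel)

set_option maxRecDepth 100000 in
theorem cub_5_7 : Cub K 5 7 2 :=
  Cub.of_checkZero
    [[(0, 2)],
     [(4, 1)],
     [(2, 2)],
     [(0, 1), (1, 2)],
     [(2, 1), (4, 1)],
     [(3, 1), (4, 1)],
     [(1, 2), (3, 2)]]
    [[0, 2, 3], [1, 2, 3]] (by decide +kernel) (by decide +kernel)

set_option maxRecDepth 100000 in
theorem cub_5_6 : Cub K 5 6 5 :=
  Cub.of_checkZero
    [[(3, 2)],
     [(4, 2)],
     [(0, 2)],
     [(0, 1), (1, 2)],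
     [(2, 2), (3, 2)],
     [(1, 1), (2, 2)]]
    [[0, 2, 4], [1, 2, 4], [0, 3, 4], [1, 3, 4], [2, 3, 4]] (by decide +kernel) (by decide +kernel)

set_option maxRecDepth 100000 in
theorem cub_1_1 : Cub K 1 1 0 :=
  Cub.of_checkZero
    [[(0, 1)]]
    [] (by decide +kernel) (by decide +kernel)

set_option maxRecDepth 100000 in
theorem cubOn_1 : CubOn K 1 1 4 0 :=
  CubOn.of_checkZero
    [[(0, 2)]]
    [[(3, 2)],
     [(0, 2), (1, 2)],
     [(2, 1), (3, 2)],
     [(1, 1), (2, 2)]]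
    [] (by decide +kernel) (by decide +kernel) (by decide +kernel)

set_option maxRecDepth 100000 in
theorem cubOn_0 : CubOn K 0 0 3 1 :=
  CubOn.of_checkZero
    []
    [[(1, 2)],
     [(2, 2)],
     [(0, 1)]]
    [[0, 1, 2]] (by decide +kernel) (by decide +kernel) (by decide +kernel)

set_option maxRecDepth 100000 in
theorem cubOn_3 : CubOn K 3 4 6 0 :=
  CubOn.of_checkZero
    [[(2, 2)],
     [(0, 1)],
     [(1, 1)],
     [(0, 1), (1, 1), (2, 2)]]
    [[(3, 1)],
     [(4, 1)],
     [(3, 1), (4, 1)],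
     [(0, 1), (5, 2)],
     [(1, 1), (4, 1), (5, 2)],
     [(2, 1), (3, 2), (5, 1)]]
    [] (by decide +kernel) (by decide +kernel) (by decide +kernel)

set_option maxRecDepth 100000 in
theorem cubOn_5 : CubOn K 5 7 8 0 :=
  CubOn.of_checkZero
    [[(4, 2)],
     [(2, 1)],
     [(0, 3)],
     [(1, 2)],
     [(0, 1), (2, 1)],
     [(2, 1), (4, 1)],
     [(0, 2), (4, 3)]]
    [[(5, 3), (7, 3)],
     [(3, 1), (5, 3)],
     [(6, 1), (7, 1)],
     [(0, 1), (6, 1)],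
     [(4, 1), (5, 2), (7, 3)],
     [(1, 1), (2, 1), (7, 2)],
     [(1, 2), (5, 1), (6, 1)],
     [(3, 3), (6, 1), (7, 3)]]
    [] (by decide +kernel) (by decide +kernel) (by decide +kernel)

set_option maxRecDepth 100000 in
theorem cubOnTwo_0 : CubOnTwo K 0 3 3 :=
  CubOnTwo.of_checkZero
    [[(0, 1)],
     [(1, 2)],
     [(0, 1), (1, 2)]]
    [[(4, 1)],
     [(3, 1), (4, 2)],
     [(4, 1), (5, 2)]]
    [[(2, 2), (3, 2), (5, 1)],
     [(0, 2), (2, 2), (5, 1)],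
     [(1, 2), (2, 2), (3, 2)]]
    rfl (by decide +kernel) (by decide +kernel) (by decide +kernel) (by decide +kernel)
    (by decide +kernel)

set_option maxRecDepth 100000 in
theorem cubOnTwo_1 : CubOnTwo K 1 4 4 :=
  CubOnTwo.of_checkZero
    [[(1, 1)],
     [(1, 2), (3, 2)],
     [(0, 1), (1, 1)],
     [(1, 1), (2, 2)]]
    [[(4, 2), (6, 2)],
     [(4, 2), (5, 2)],
     [(5, 1), (6, 2)],
     [(4, 2), (5, 2), (6, 2)]]
    [[(3, 1), (4, 2)],
     [(2, 1), (5, 2)],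
     [(0, 1), (2, 2), (3, 1), (6, 2)]]
    rfl (by decide +kernel) (by decide +kernel) (by decide +kernel) (by decide +kernel)
    (by decide +kernel)

set_option maxRecDepth 100000 in
theorem cubOnTwo_2 : CubOnTwo K 2 5 5 :=
  CubOnTwo.of_checkZero
    [[(3, 2)],
     [(1, 2), (3, 1)],
     [(3, 1), (4, 2)],
     [(2, 1), (4, 2)],
     [(1, 1), (2, 1), (4, 2)]]
    [[(5, 1)],
     [(5, 1), (6, 2)],
     [(5, 1), (7, 2)],
     [(6, 1), (7, 1)],
     [(6, 1), (7, 2)]]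
    [[(0, 1), (4, 1), (7, 1)],
     [(0, 2), (2, 2), (6, 1)],
     [(2, 1), (3, 1), (5, 2), (7, 2)]]
    rfl (by decide +kernel) (by decide +kernel) (by decide +kernel) (by decide +kernel)
    (by decide +kernel)

set_option maxRecDepth 100000 in
theorem cubOnThree : CubOnThree K := by
  refine TBd.of_checkZero 9 (numberTwo 3) (by decide +kernel)
    (Sum.elim (Sum.elim
    ![[(1, 1), (4, 2)],
     [(2, 2), (3, 2), (5, 1)],
     [(1, 2), (2, 2), (5, 2)]]
    ![[(0, 2), (7, 2)],
     [(1, 2), (2, 1), (7, 1)],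
     [(0, 2), (6, 2), (8, 1)]])
    ![[(3, 1), (6, 2)],
     [(4, 1), (5, 1), (8, 1)],
     [(3, 2), (4, 2), (6, 1), (8, 2)]])
    [[(1, 1), (4, 2)],
     [(2, 2), (3, 2), (5, 1)],
     [(1, 2), (2, 2), (5, 2)],
     [(0, 2), (7, 2)],
     [(1, 2), (2, 1), (7, 1)],
     [(0, 2), (6, 2), (8, 1)],
     [(3, 1), (6, 2)],
     [(4, 1), (5, 1), (8, 1)],
     [(3, 2), (4, 2), (6, 1), (8, 2)]]
    [] (by decide +kernel) (by decide +kernel) (by decide +kernel)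
    (fun l => l.all (fun i => (numberTwo 3 i).isLeft) || l.all (fun i => notMid (numberTwo 3 i)) ||
      l.all fun i => notFirst (numberTwo 3 i)) (fun a _ b _ c _ h => Or.inl ?_) (by decide +kernel)
  simpa only [List.all_cons, List.all_nil, Bool.and_true, Bool.and_assoc] using h

end Certificates

section CubicSat
variable {K : Type} [Field K]

theorem Cub.zero : Cub K 0 0 0 :=
  ⟨fun i => i.elim0, fun i => i.elim0, le_of_eq (by
    rw [Submodule.finrank_eq_zero, Submodule.eq_bot_iff]
    intro T _
    ext i
    exact i.elim0)⟩

theorem CubOn.drop {n k x r : ℕ} (h : CubOn K n (k + 1) x r) : CubOn K n k x (r + 3) := by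
  obtain ⟨P, hP, hr⟩ := h
  refine ⟨fun i => P (Sum.map Fin.castSucc id i), fun i a h => hP _ _ ?_,
    (finrank_le_inf_iInf_ker_add _ fun c : Fin 3 =>
      contr3 (P (.inl (Fin.last k))) (.inr c)).trans ?_⟩
  · rcases i with i | i
    · exact h
    · exact h
  · rw [Fintype.card_fin]
    refine Nat.add_le_add_right (le_trans (Submodule.finrank_mono fun T hT => ?_) hr) 3
    simp only [Submodule.mem_inf, Submodule.mem_iInf, LinearMap.mem_ker] at hT
    obtain ⟨⟨hT1, hT2, hT3⟩, hT4⟩ := hT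
    refine ⟨hT1, hT2, fun i c => ?_⟩
    rcases i with i | i
    · rcases Fin.eq_castSucc_or_eq_last i with ⟨j, rfl⟩ | rfl
      · exact hT3 (.inl j) c
      · rcases c with c | c
        · rw [contr3_apply]
          refine Finset.sum_eq_zero fun a _ => Finset.sum_eq_zero fun b _ => ?_
          rcases a with a | a
          · rcases b with b | b
            · rw [hT2 _ _ _ rfl, mul_zero]
            · rw [hP _ (.inr b) rfl, mul_zero, zero_mul]
          · rw [hP _ (.inr a) rfl, zero_mul, zero_mul]
        · exact hT4 c
    · exact hT3 (.inr i) c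

theorem cubOnTwo [CharZero K] (n : ℕ) : CubOnTwo K n (n + 3) (n + 3) := by
  induction n using Nat.strong_induction_on with
  | _ n ih =>
    match n, ih with
    | 0, _ => exact cubOnTwo_0
    | 1, _ => exact cubOnTwo_1
    | 2, _ => exact cubOnTwo_2
    | n + 3, ih => exact (ih n (by omega)).step cubOnThree

theorem Cub.add_three_mul [CharZero K] {n k r₀ r₁ : ℕ} (hA : Cub K n k r₀)
    (hP : CubOn K n k (n + 3) r₁) (s k' : ℕ) (hk : 2 * k' = 2 * k + s * (2 * n + 3 * s + 3)) :
    Cub K (n + 3 * s) k' (r₀ + s * r₁) := by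
  suffices h : ∃ k', 2 * k' = 2 * k + s * (2 * n + 3 * s + 3) ∧
      Cub K (n + 3 * s) k' (r₀ + s * r₁) ∧ CubOn K (n + 3 * s) k' (n + 3 * s + 3) r₁ by
    obtain ⟨k'', h1, h2, -⟩ := h
    obtain rfl : k' = k'' := by omega
    exact h2
  clear hk k'
  induction s with
  | zero => exact ⟨k, by simp, by simpa using hA, by simpa using hP⟩
  | succ s ih =>
    obtain ⟨k', h1, h2, h3⟩ := ih
    refine ⟨k' + (n + 3 * s + 3), by ring_nf at h1 ⊢; omega, ?_, h3.step (cubOnTwo _)⟩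
    have := h2.step h3
    rwa [add_assoc r₀, ← add_one_mul s r₁] at this

end CubicSat

section Euler
variable {K : Type} [Field K] {σ : Type} [Fintype σ]

theorem sum_mul_eval_pderiv {e : ℕ} {f : MvPolynomial σ K} (hf : f.IsHomogeneous e) (p : σ → K) :
    ∑ j, p j * eval p (pderiv j f) = e * eval p f := by
  simpa using congrArg (eval p) hf.sum_X_mul_pderiv

theorem eval_eq_eval_of_isHomogeneous_zero {σ : Type} {f : MvPolynomial σ K}
    (hf : f.IsHomogeneous 0) (p q : σ → K) : eval p f = eval q f := by
  rw [totalDegree_eq_zero_iff_eq_C.1 (Nat.le_zero.1 hf.totalDegree_le), eval_C, eval_C]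

theorem eq_zero_of_forall_iterate_pderiv [CharZero K] {e : ℕ} {f : MvPolynomial σ K}
    (hf : f.IsHomogeneous e)
    (h : ∀ l : List σ, l.length = e → eval 0 (l.foldr (fun j g => pderiv j g) f) = 0) : f = 0 := by
  induction e generalizing f with
  | zero =>
    have h0 := h [] rfl
    rw [List.foldr_nil, totalDegree_eq_zero_iff_eq_C.1 (Nat.le_zero.1 hf.totalDegree_le),
      eval_C] at h0
    rw [totalDegree_eq_zero_iff_eq_C.1 (Nat.le_zero.1 hf.totalDegree_le), h0, C_0]
  | succ e ih =>
    have h1 : ∀ j, pderiv j f = 0 := fun j => ih hf.pderiv fun l hl => by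
      have := h (l ++ [j]) (by simp [hl])
      rwa [List.foldr_append] at this
    have := hf.sum_X_mul_pderiv
    simp only [h1, mul_zero, Finset.sum_const_zero] at this
    have h2 : ((e + 1 : ℕ) : MvPolynomial σ K) ≠ 0 := by exact_mod_cast e.succ_ne_zero
    rw [eq_comm, nsmul_eq_mul] at this
    exact (mul_eq_zero.1 this).resolve_left h2

theorem pderiv_comm {σ : Type} (i j : σ) (f : MvPolynomial σ K) :
    pderiv i (pderiv j f) = pderiv j (pderiv i f) := by
  classical
  have : ⁅(pderiv i : Derivation K (MvPolynomial σ K) (MvPolynomial σ K)), pderiv j⁆ = 0 :=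
    derivation_ext fun k => by
      rw [Derivation.commutator_apply]
      simp [pderiv_X, Pi.single_apply, apply_ite]
  have := congrArg (fun D => D f) this
  simpa [Derivation.commutator_apply, sub_eq_zero] using this

theorem contr_iterate_pderiv [DecidableEq σ] (dec : ℕ → σ) (p : List (ℕ × ℤ))
    {f : MvPolynomial σ K} (e : ℕ) (l : List ℕ) (hf : f.IsHomogeneous (e + l.length)) :
    contr (fun l => eval 0 ((l.map dec).foldr (fun j g => pderiv j g) f)) p e l =
      e.factorial * eval (vecOf K dec p) ((l.map dec).foldr (fun j g => pderiv j g) f) := by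
  have hl : ∀ (l : List σ) (e : ℕ), f.IsHomogeneous (e + l.length) →
      (l.foldr (fun j g => pderiv j g) f).IsHomogeneous e := by
    intro l
    induction l with
    | nil => exact fun e h => h
    | cons j l ih => exact fun e h => (ih (e + 1) (by rwa [add_right_comm, add_assoc])).pderiv
  induction e generalizing l with
  | zero =>
    simp only [contr, Nat.factorial_zero, Nat.cast_one, one_mul]
    exact eval_eq_eval_of_isHomogeneous_zero (hl _ 0 (by simpa using hf)) _ _
  | succ e ih =>
    have h1 := fun k => ih (k :: l) (by rwa [List.length_cons, add_comm l.length, ← add_assoc])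
    simp only [contr, h1, List.map_cons, List.foldr_cons]
    rw [← sum_vecOf_mul dec p fun a => (e.factorial : K) * eval (vecOf K dec p)
      (pderiv a ((l.map dec).foldr (fun j g => pderiv j g) f))]
    have h2 := sum_mul_eval_pderiv (hl (l.map dec) (e + 1) (by simpa using hf)) (vecOf K dec p)
    simp only [mul_left_comm _ (e.factorial : K), ← Finset.mul_sum]
    rw [h2, Nat.factorial_succ]
    push_cast
    ring

variable (K) in
theorem quartic_certificate [CharZero K] (L : List (List (ℕ × ℤ))) {n d : ℕ} [NeZero n]
    (hlt : ∀ p ∈ L, ∀ t ∈ p, t.1 < n) (h : checkZero n d (fun _ => false) L = true) :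
    Bd K n (d + 1) L.length 0 := by
  refine ⟨fun i => vecOf K (Fin.ofNat n) (L.get i), le_of_eq ?_⟩
  rw [Submodule.finrank_eq_zero, Submodule.eq_bot_iff]
  intro f hf
  rw [mem_singForms] at hf
  refine eq_zero_of_forall_iterate_pderiv hf.1 fun l hl => ?_
  have key := eq_zero_of_checkZero
    (y := fun l => eval 0 ((l.map (Fin.ofNat n)).foldr (fun j g => pderiv j g) f)) hlt
    (fun l l' h => ?_) (fun l _ _ h => by simp at h) (fun p hp k hk => ?_) h
    (l.map Fin.val) (by simpa using hl) (by simp)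
  · simpa [Function.comp_def] using key
  · have : LeftCommutative fun (j : Fin n) (g : MvPolynomial (Fin n) K) => pderiv j g :=
      ⟨fun i j g => pderiv_comm i j g⟩
    exact congrArg (eval 0) ((h.map _).foldr_eq _)
  · obtain ⟨i, rfl⟩ := List.get_of_mem hp
    rw [contr_iterate_pderiv _ _ _ _ hf.1]
    simp only [List.map_cons, List.map_nil, List.foldr_cons, List.foldr_nil]
    rw [(hf.2 i).2, mul_zero]

theorem Cub.bd [CharZero K] {n k r : ℕ} (h : Cub K n k r) : Bd K n 3 k r := by
  obtain ⟨P, -, hr⟩ := h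
  refine ⟨P, le_trans ?_ hr⟩
  let D (i : Fin n) : MvPolynomial (Fin n) K →ₗ[K] MvPolynomial (Fin n) K :=
    (pderiv i).toLinearMap
  refine finrank_le_of_mapsTo (LinearMap.pi fun i => LinearMap.pi fun j => LinearMap.pi fun k =>
    (aeval (0 : Fin n → K)).toLinearMap ∘ₗ D i ∘ₗ D j ∘ₗ D k) (fun f hf => ?_) fun f hf h0 => ?_
  · rw [mem_singForms] at hf
    refine ⟨fun i j k => ⟨?_, ?_⟩, fun i j k h => by simp at h, fun i k => ?_⟩
    · simp [D, pderiv_comm i j]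
    · simp [D, pderiv_comm j k]
    · rw [contr3_apply, Finset.sum_comm]
      have h1 : ∀ a b, eval 0 (pderiv a (pderiv b (pderiv k f))) =
          eval (P i) (pderiv a (pderiv b (pderiv k f))) := fun a b =>
        eval_eq_eval_of_isHomogeneous_zero (hf.1.pderiv.pderiv.pderiv) _ _
      have h2 : ∀ b, ∑ a, P i a * eval (P i) (pderiv a (pderiv b (pderiv k f))) =
          eval (P i) (pderiv b (pderiv k f)) := fun b => by
        rw [sum_mul_eval_pderiv hf.1.pderiv.pderiv, Nat.cast_one, one_mul]
      have h3 : ∀ a b, P i a * P i b * eval 0 (pderiv a (pderiv b (pderiv k f))) =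
          P i b * (P i a * eval (P i) (pderiv a (pderiv b (pderiv k f)))) := fun a b => by
        rw [h1]
        ring
      refine Eq.trans (Finset.sum_congr rfl fun b _ => Finset.sum_congr rfl fun a _ => h3 a b) ?_
      simp only [← Finset.mul_sum, h2]
      rw [sum_mul_eval_pderiv hf.1.pderiv, (hf.2 i).2, mul_zero]
  · rw [mem_singForms] at hf
    refine eq_zero_of_forall_iterate_pderiv hf.1 fun l hl => ?_
    obtain ⟨a, b, c, rfl⟩ := List.length_eq_three.1 hl
    simpa [D] using congrFun (congrFun (congrFun h0 a) b) c

end Euler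

section DegreeInduction
variable {K : Type} [Field K]

theorem six_mul_choose_three (n : ℕ) : 6 * (n + 2).choose 3 = n * (n + 1) * (n + 2) := by
  have := Nat.descFactorial_eq_factorial_mul_choose (n + 2) 3
  simp [Nat.descFactorial_succ, Nat.factorial] at this
  linarith

theorem Sat.cubic_one [CharZero K] (s : ℕ) (hs : s ≠ 0) : Sat K (3 * s + 1) 3 := by
  obtain ⟨k, hk⟩ : ∃ k, 2 * k = (3 * s + 2) * (s + 1) := by
    obtain ⟨c, hc⟩ := (Nat.even_mul_succ_self s)
    exact ⟨3 * c + s + 1, by nlinarith⟩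
  have hC : (3 * s + 1 + 3 - 1).choose 3 = (3 * s + 1) * k := by
    have := six_mul_choose_three (3 * s + 1)
    rw [show 3 * s + 1 + 3 - 1 = 3 * s + 1 + 2 by omega]
    nlinarith
  have hb : Bd K (3 * s + 1) 3 k 0 := by
    have := (cub_1_1 (K := K)).add_three_mul cubOn_1 s k (by rw [hk]; ring)
    rw [add_comm 1] at this
    simpa using this.bd
  have hk1 : 1 ≤ k := by nlinarith
  refine Sat.of_critical (by omega) (by omega) (by
    rw [hC]
    exact le_trans (by omega) (Nat.le_mul_of_pos_right _ hk1)) fun q h1 h2 => ?_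
  rw [hC] at h1 h2 ⊢
  have h3 : k ≤ q + 1 := by
    by_contra! h
    nlinarith [Nat.mul_le_mul_left (3 * s + 1) (show q + 2 ≤ k from h)]
  have h4 : q ≤ k := by
    by_contra! h
    nlinarith [Nat.mul_le_mul_left (3 * s + 1) (show k + 1 ≤ q from h)]
  obtain rfl | rfl : q = k ∨ k = q + 1 := by omega
  · exact hb.mono (by omega)
  · refine (hb.drop_points (by omega)).mono (le_max_of_le_left ?_)
    rw [mul_add]
    omega

theorem Sat.cubic_zero [CharZero K] (s : ℕ) : Sat K (3 * (s + 1)) 3 := by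
  obtain ⟨k, hk⟩ : ∃ k, 2 * k = (s + 1) * (3 * s + 6) := by
    obtain ⟨c, hc⟩ := (Nat.even_mul_succ_self s)
    exact ⟨3 * s + 3 + 3 * c, by nlinarith⟩
  have hC : (3 * (s + 1) + 3 - 1).choose 3 = 3 * (s + 1) * k + (s + 1) := by
    have := six_mul_choose_three (3 * (s + 1))
    rw [show 3 * (s + 1) + 3 - 1 = 3 * (s + 1) + 2 by omega]
    nlinarith
  have hb : Bd K (3 * (s + 1)) 3 k (s + 1) := by
    have := (Cub.zero (K := K)).add_three_mul cubOn_0 (s + 1) k (by rw [hk]; ring)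
    simpa using this.bd
  have hb' : Bd K (3 * (s + 1)) 3 (k + 1) 0 := by
    have := (cub_3_4 (K := K)).add_three_mul cubOn_3 s (k + 1) (by rw [mul_add, hk]; ring)
    rw [show 3 + 3 * s = 3 * (s + 1) by ring] at this
    simpa using this.bd
  have hk1 : 1 ≤ k := by nlinarith
  refine Sat.of_critical (by omega) (by omega) (by rw [hC]; nlinarith) fun q h1 h2 => ?_
  rw [hC] at h1 h2 ⊢
  have h3 : k ≤ q + 1 := by
    by_contra! h
    nlinarith [Nat.mul_le_mul_left (3 * (s + 1)) (show q + 2 ≤ k from h)]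
  have h4 : q ≤ k + 1 := by
    by_contra! h
    nlinarith [Nat.mul_le_mul_left (3 * (s + 1)) (show k + 2 ≤ q from h)]
  obtain rfl | rfl | rfl : q = k ∨ k = q + 1 ∨ q = k + 1 := by omega
  · exact hb.mono (by omega)
  · refine (hb.drop_points (by omega)).mono (le_max_of_le_left ?_)
    rw [mul_add _ q]
    omega
  · exact hb'.mono (by omega)

theorem Sat.cubic_two [CharZero K] (s : ℕ) : Sat K (5 + 3 * s) 3 := by
  obtain ⟨k, hk⟩ : ∃ k, 2 * k + 2 = (s + 2) * (3 * s + 7) + 2 := by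
    obtain ⟨c, hc⟩ := (Nat.even_mul_succ_self s)
    exact ⟨5 * s + 7 + 3 * c, by nlinarith⟩
  obtain ⟨k, rfl⟩ : ∃ k', k = k' + 1 := ⟨k - 1, by
    have : 1 ≤ k := by nlinarith
    omega⟩
  have hC : (5 + 3 * s + 3 - 1).choose 3 = (5 + 3 * s) * (k + 1) := by
    have := six_mul_choose_three (5 + 3 * s)
    rw [show 5 + 3 * s + 3 - 1 = 5 + 3 * s + 2 by omega]
    nlinarith
  have hb : Bd K (5 + 3 * s) 3 (k + 1) 2 := by
    have := (cub_5_7 (K := K)).add_three_mul cubOn_5 s (k + 1) (by linarith)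
    simpa using this.bd
  have hb' : Bd K (5 + 3 * s) 3 k (5 + 3 * s) := by
    have := (cub_5_6 (K := K)).add_three_mul cubOn_5.drop s k (by linarith)
    rw [zero_add, mul_comm s] at this
    exact this.bd
  refine Sat.of_critical (by omega) (by omega) (by rw [hC]; nlinarith) fun q h1 h2 => ?_
  rw [hC] at h1 h2 ⊢
  have h3 : k ≤ q := by
    by_contra! h
    nlinarith [Nat.mul_le_mul_left (5 + 3 * s) (show q + 1 ≤ k from h)]
  have h4 : q ≤ k + 1 := by
    by_contra! h
    nlinarith [Nat.mul_le_mul_left (5 + 3 * s) (show k + 2 ≤ q from h)]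
  obtain rfl | rfl : q = k + 1 ∨ q = k := by omega
  · exact hb.mono (by omega)
  · refine hb'.mono (le_max_of_le_left ?_)
    rw [mul_add]
    omega

theorem Sat.cubic [CharZero K] {n : ℕ} (hn : 2 ≤ n) : Sat K n 3 := by
  obtain rfl | hn : n = 2 ∨ 3 ≤ n := by omega
  · exact Sat.binary 3
  · obtain ⟨s, rfl | rfl | rfl⟩ : ∃ s, n = 3 * (s + 1) ∨ n = 3 * (s + 1) + 1 ∨ n = 5 + 3 * s :=
      ⟨n / 3 - 1, by omega⟩
    exacts [Sat.cubic_zero s, Sat.cubic_one _ s.succ_ne_zero, Sat.cubic_two s]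

set_option maxRecDepth 100000 in
theorem bd_quartic [CharZero K] : Bd K 6 4 21 0 :=
  quartic_certificate K (d := 3)
    [[(0, 1)], [(1, 1)], [(2, 1)], [(3, 1)], [(4, 1)], [(5, 1)], [(0, 1), (3, 1), (5, 1)],
      [(0, 1), (4, 1), (5, 1)], [(0, 3), (2, 2), (5, 2)], [(2, 1), (4, 2), (5, 1)],
      [(0, 1), (3, 1), (4, 1)], [(1, 1), (4, 1), (5, 2)], [(3, 1), (4, 2), (5, 3)],
      [(1, 3), (3, 2), (5, 1)], [(2, 1), (3, 1), (5, 1)], [(0, 1), (1, 1), (5, 2)],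
      [(1, 1), (2, 2), (5, 2)], [(0, 1), (1, 1), (2, 1), (5, 3)],
      [(2, 1), (3, 1), (4, 2), (5, 2)], [(0, 2), (1, 2), (4, 1), (5, 3)],
      [(1, 1), (2, 2), (3, 2), (5, 1)]] (by decide +kernel) (by decide +kernel)

theorem Sat.of_three_le [CharZero K] {n d : ℕ} (hn : 2 ≤ n) (hd : 3 ≤ d) : Sat K n d :=
  Sat.of_cubic (fun _ => Sat.cubic) bd_quartic hn hd

end DegreeInduction

section Bridge
variable {K : Type} [Field K] {σ : Type}

theorem eval_eq_zero_of_mem_linIdeal {p : σ → K} {f : MvPolynomial σ K} (hf : f ∈ linIdeal K {p}) :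
    eval p f = 0 := by
  have : linIdeal K {p} ≤ RingHom.ker (eval p) := Ideal.span_le.2 fun g hg => hg.2 p rfl
  exact this hf

theorem eval_pderiv_eq_zero_of_mem_linIdeal_sq {p : σ → K} {f : MvPolynomial σ K}
    (hf : f ∈ linIdeal K {p} ^ 2) (j : σ) : eval p (pderiv j f) = 0 := by
  rw [pow_two] at hf
  refine Submodule.mul_induction_on hf (fun a ha b hb => ?_) fun a b ha hb => ?_
  · rw [Derivation.leibniz, map_add, smul_eq_mul, smul_eq_mul, map_mul, map_mul,
      eval_eq_zero_of_mem_linIdeal ha, eval_eq_zero_of_mem_linIdeal hb, zero_mul, zero_mul,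
      add_zero]
  · rw [map_add, map_add, ha, hb, add_zero]

/-- Projection of affine space onto the line through `p`, in terms of the coordinate `c`. -/
def lineProj (p : σ → K) (c : σ) : MvPolynomial σ K →ₐ[K] MvPolynomial σ K :=
  aeval fun j => C (p j / p c) * X c

theorem X_sub_lineProj_mem {p : σ → K} {c : σ} (hc : p c ≠ 0) (j : σ) :
    X j - lineProj p c (X j) ∈ linIdeal K {p} := by
  refine Ideal.subset_span ⟨?_, fun x hx => ?_⟩
  · rw [lineProj, aeval_X]
    exact (isHomogeneous_X K j).sub (by simpa using (isHomogeneous_C σ _).mul (isHomogeneous_X K c))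
  · obtain rfl : x = p := hx
    simp [lineProj, hc]

theorem lineProj_of_isHomogeneous {p : σ → K} (c : σ) {f : MvPolynomial σ K} {d : ℕ}
    (hf : f.IsHomogeneous d) : lineProj p c f = C (eval p f) * (C (p c)⁻¹ * X c) ^ d := by
  rw [lineProj, aeval_def, eval₂_eq, eval_eq, map_sum, Finset.sum_mul]
  refine Finset.sum_congr rfl fun m hm => ?_
  have : d = ∑ i ∈ m.support, m i := by
    rw [← hf (mem_support_iff.1 hm)]
    simp [Finsupp.weight_apply, Finsupp.sum]
  rw [this, ← Finset.prod_pow_eq_pow_sum, map_mul, map_prod, mul_assoc, ← Finset.prod_mul_distrib,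
    algebraMap_eq]
  congr 1
  refine Finset.prod_congr rfl fun i _ => ?_
  rw [C_pow, ← mul_pow, ← mul_assoc, ← C_mul, div_eq_mul_inv]

theorem sub_lineProj_mem {p : σ → K} {c : σ} (hc : p c ≠ 0) (f : MvPolynomial σ K) :
    f - lineProj p c f ∈ linIdeal K {p} := by
  induction f using MvPolynomial.induction_on with
  | C a => simp [lineProj]
  | add f g hf hg =>
    rw [map_add, add_sub_add_comm]
    exact add_mem hf hg
  | mul_X f i hf =>
    rw [map_mul, show f * X i - lineProj p c f * lineProj p c (X i) =
      X i * (f - lineProj p c f) + lineProj p c f * (X i - lineProj p c (X i)) by ring]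
    exact add_mem (Ideal.mul_mem_left _ _ hf) (Ideal.mul_mem_left _ _ (X_sub_lineProj_mem hc i))

theorem taylor_lineProj_mem [Fintype σ] {p : σ → K} {c : σ} (hc : p c ≠ 0)
    (f : MvPolynomial σ K) :
    f - lineProj p c f - ∑ j, (X j - lineProj p c (X j)) * lineProj p c (pderiv j f) ∈
      linIdeal K {p} ^ 2 := by
  classical
  induction f using MvPolynomial.induction_on with
  | C a => simp [lineProj]
  | add f g hf hg =>
    simp only [map_add, mul_add, Finset.sum_add_distrib]
    convert add_mem hf hg using 1
    ring
  | mul_X f i hf =>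
    have h1 : ∑ j, (X j - lineProj p c (X j)) * lineProj p c (pderiv j f) ∈ linIdeal K {p} :=
      sum_mem fun j _ => Ideal.mul_mem_right _ _ (X_sub_lineProj_mem hc j)
    have h2 : ∑ j, (X j - lineProj p c (X j)) * lineProj p c (pderiv j (f * X i)) =
        (∑ j, (X j - lineProj p c (X j)) * lineProj p c (pderiv j f)) * lineProj p c (X i) +
          (X i - lineProj p c (X i)) * lineProj p c f := by
      rw [Finset.sum_mul]
      have : ∀ j, (X j - lineProj p c (X j)) * lineProj p c (pderiv j (f * X i)) =
          (X j - lineProj p c (X j)) * lineProj p c (pderiv j f) * lineProj p c (X i) +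
            if j = i then (X i - lineProj p c (X i)) * lineProj p c f else 0 := fun j => by
        rw [Derivation.leibniz, pderiv_X, map_add, smul_eq_mul, smul_eq_mul, map_mul, map_mul]
        split_ifs with h
        · subst h
          simp
          ring
        · rw [Pi.single_eq_of_ne (Ne.symm h)]
          simp
          ring
      simp only [this, Finset.sum_add_distrib, Finset.sum_ite_eq', Finset.mem_univ, if_true]
    rw [h2, map_mul]
    have h3 := Ideal.mul_mem_mul h1 (X_sub_lineProj_mem hc i)
    rw [← pow_two] at h3
    convert add_mem (Ideal.mul_mem_right (X i) _ hf) h3 using 1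
    ring

theorem mem_linIdeal_iff {p : σ → K} {c : σ} (hc : p c ≠ 0) {f : MvPolynomial σ K} {d : ℕ}
    (hf : f.IsHomogeneous d) : f ∈ linIdeal K {p} ↔ eval p f = 0 := by
  refine ⟨eval_eq_zero_of_mem_linIdeal, fun h => ?_⟩
  simpa [lineProj_of_isHomogeneous c hf, h] using sub_lineProj_mem hc f

theorem mem_linIdeal_sq_iff [Fintype σ] {p : σ → K} {c : σ} (hc : p c ≠ 0) {f : MvPolynomial σ K}
    {d : ℕ} (hf : f.IsHomogeneous d) :
    f ∈ linIdeal K {p} ^ 2 ↔ eval p f = 0 ∧ ∀ j, eval p (pderiv j f) = 0 := by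
  refine ⟨fun h => ⟨eval_eq_zero_of_mem_linIdeal (Ideal.pow_le_self two_ne_zero h),
    eval_pderiv_eq_zero_of_mem_linIdeal_sq h⟩, fun h => ?_⟩
  simpa [lineProj_of_isHomogeneous c hf, lineProj_of_isHomogeneous c hf.pderiv, h.1, h.2]
    using taylor_lineProj_mem hc f

theorem piece_eq_singForms_inf [Fintype σ] {ι κ : Type} {P : ι → σ → K} {S : κ → σ → K} (c : σ)
    (hP : ∀ i, P i c ≠ 0) (hS : ∀ i, S i c ≠ 0) (d : ℕ) :
    piece K ((⨅ i, linIdeal K {P i} ^ 2) ⊓ ⨅ i, linIdeal K {S i}) d =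
      singForms d P ⊓ ⨅ i, LinearMap.ker (jet (S i) none) := by
  ext f
  by_cases hf : f.IsHomogeneous d
  · simp [piece, mem_singForms, hf, mem_linIdeal_iff (hS _) hf,
      mem_linIdeal_sq_iff (hP _) hf]
  · simp [piece, mem_singForms, hf]

theorem le_finrank_singForms [CharZero K] {n d q : ℕ} (hd : d ≠ 0) (P : Fin q → Fin n → K) :
    (n + d - 1).choose d ≤ Module.finrank K (singForms d P) + q * n := by
  rw [← finrank_homogeneousSubmodule (K := K)]
  refine (finrank_le_inf_iInf_ker_add _ fun x : Fin q × Fin n => jet (P x.1) (some x.2)).trans ?_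
  simp only [Fintype.card_prod, Fintype.card_fin]
  refine Nat.add_le_add_right (Submodule.finrank_mono fun f hf => ?_) _
  simp only [Submodule.mem_inf, Submodule.mem_iInf, LinearMap.mem_ker, jet_some, Prod.forall,
    mem_homogeneousSubmodule] at hf
  exact mem_singForms.2 ⟨hf.1, fun i => ⟨eval_eq_zero_of_pderiv hd hf.1 (hf.2 i), hf.2 i⟩⟩

theorem exists_finrank_singForms_inf_le [Infinite K] {n d q h : ℕ} (hb : Bd K n d q h) (r : ℕ) :
    ∃ (P : Fin q → Fin n → K) (S : Fin r → Fin n → K),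
      Module.finrank K (singForms d P ⊓ ⨅ i, LinearMap.ker (jet (S i) none) :
        Submodule K (MvPolynomial (Fin n) K)) ≤ h - r := by
  obtain ⟨P, hP⟩ := hb
  obtain ⟨S, hS⟩ := exists_finrank_inf_ker_le (singForms d P) (fun p : Fin n → K => jet p none)
    hP (c := 0) (by
      rw [Nat.le_zero, Submodule.finrank_eq_zero, Submodule.eq_bot_iff]
      intro f hf
      simp only [Submodule.mem_inf, Submodule.mem_iInf, LinearMap.mem_ker, jet_none] at hf
      exact MvPolynomial.funext fun x => by simpa using hf.2 x) r
  exact ⟨P, S, by simpa using hS⟩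

theorem Gen.finrank_singForms_inf_le [Infinite K] {n d q h : ℕ} (hb : Bd K n d q h) (r : ℕ) :
    Gen K fun P : ℕ × ℕ → K =>
      Module.finrank K (singForms d (fun (i : Fin q) (c : Fin n) => P (i, c)) ⊓
        ⨅ i : Fin r, LinearMap.ker (jet (fun c : Fin n => P (q + i, c)) none) :
        Submodule K (MvPolynomial (Fin n) K)) ≤ h - r := by
  obtain ⟨D, S, hDS⟩ := exists_finrank_singForms_inf_le hb r
  let P₀ : ℕ × ℕ → K := fun x => if hc : x.2 < n then
    if hi : x.1 < q then D ⟨x.1, hi⟩ ⟨x.2, hc⟩ else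
      if hi : x.1 - q < r then S ⟨x.1 - q, hi⟩ ⟨x.2, hc⟩ else 0 else 0
  let Φ : (Fin q × Option (Fin n)) ⊕ Fin r → (ℕ × ℕ → K) → MvPolynomial (Fin n) K →ₗ[K] K :=
    Sum.elim (fun y P => jet (fun c : Fin n => P (y.1, c)) y.2)
      (fun i P => jet (fun c : Fin n => P (q + i, c)) none)
  have key : ∀ P : ℕ × ℕ → K, (singForms d (fun (i : Fin q) (c : Fin n) => P (i, c)) ⊓
        ⨅ i : Fin r, LinearMap.ker (jet (fun c : Fin n => P (q + i, c)) none) :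
        Submodule K (MvPolynomial (Fin n) K)) =
      homogeneousSubmodule (Fin n) K d ⊓ ⨅ x, LinearMap.ker (Φ x P) := fun P => by
    rw [singForms, iInf_sum, inf_assoc]
    rfl
  have hΦ : Gen K fun P => Module.finrank K (homogeneousSubmodule (Fin n) K d ⊓
      ⨅ x, LinearMap.ker (Φ x P) : Submodule K (MvPolynomial (Fin n) K)) ≤ h - r := by
    refine Gen.finrank_inf_le _ Φ (fun x f _ => ?_) P₀ ?_
    · rcases x with ⟨i, _ | j⟩ | i
      · simp only [Φ, Sum.elim_inl, jet_none]
        exact PolyFun.eval (fun c : Fin n => PolyFun.coord ((i : ℕ), (c : ℕ))) f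
      · simp only [Φ, Sum.elim_inl, jet_some]
        exact PolyFun.eval (fun c : Fin n => PolyFun.coord ((i : ℕ), (c : ℕ))) (pderiv j f)
      · simp only [Φ, Sum.elim_inr, jet_none]
        exact PolyFun.eval (fun c : Fin n => PolyFun.coord (q + (i : ℕ), (c : ℕ))) f
    · rw [← key P₀]
      have h1 : (fun (i : Fin q) (c : Fin n) => P₀ (i, c)) = D := by
        ext i c
        simp [P₀]
      have h2 : ∀ i : Fin r, (fun c : Fin n => P₀ (q + i, c)) = S i := fun i => by
        ext c
        simp [P₀]
      have h3 : (singForms d (fun (i : Fin q) (c : Fin n) => P₀ (i, c)) ⊓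
          ⨅ i : Fin r, LinearMap.ker (jet (fun c : Fin n => P₀ (q + i, c)) none) :
          Submodule K (MvPolynomial (Fin n) K)) =
          singForms d D ⊓ ⨅ i, LinearMap.ker (jet (S i) none) := by
        simp only [h1, h2]
      rwa [h3]
  exact hΦ.mono fun P hP => by rwa [key P]

end Bridge

/-- **(Alexander–Hirschowitz, as used in the paper.)**  Let `d ≥ 3`, `m ≥ 1`, `q ≥ 0`
and `r > 1`.  A generic scheme `Y ⊂ P^m` consisting of `q` double points and `r` simple
points satisfies `dim (I_Y)_d = max { C(m+d,d) − q(m+1) − r ; 0 }`. -/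
theorem stmt15 (K : Type) [Field K] [IsAlgClosed K] [CharZero K]
    (m d q r : ℕ) (hd : 3 ≤ d) (hm : 1 ≤ m) (hr : 1 < r) :
    ∃ g : MvPolynomial (ℕ × ℕ) K, g ≠ 0 ∧
      ∀ P : ℕ → ℕ → K, MvPolynomial.eval (fun ij => P ij.1 ij.2) g ≠ 0 →
        let dbl : Fin q → (Fin (m + 1) → K) := fun i c => P (i : ℕ) (c : ℕ)
        let simp : Fin r → (Fin (m + 1) → K) := fun i c => P (q + (i : ℕ)) (c : ℕ)
        let IY : Ideal (MvPolynomial (Fin (m + 1)) K) :=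
          (⨅ i : Fin q, (linIdeal K {dbl i}) ^ 2) ⊓ (⨅ i : Fin r, linIdeal K {simp i})
        (Module.finrank K (piece K IY d) : ℤ)
          = max (((m + d).choose d) - q * (m + 1) - r : ℤ) 0 := by
  have hb : Bd K (m + 1) d q _ := Sat.of_three_le (K := K) (by omega) hd q
  obtain ⟨g, hg, h⟩ := (Gen.finrank_singForms_inf_le hb r).and
    (Gen.forall_fin fun i : Fin (q + r) => Gen.ne_zero ((i : ℕ), 0))
  refine ⟨g, hg, fun P hP => ?_⟩
  intro dbl simp IY
  obtain ⟨h1, h2⟩ := h _ hP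
  have h3 : piece K IY d = _ := piece_eq_singForms_inf (P := dbl) (S := simp) 0
    (fun i => h2 (Fin.castAdd r i)) (fun i => h2 (Fin.natAdd q i)) d
  have h4 := le_finrank_singForms (by omega : d ≠ 0) dbl
  have h5 := finrank_le_inf_iInf_ker_add (singForms d dbl) fun i => jet (simp i) none
  rw [← h3] at h5
  replace h1 : Module.finrank K (piece K IY d) ≤ _ := h3 ▸ h1
  rw [Fintype.card_fin] at h5
  rw [show m + 1 + d - 1 = m + d by omega] at h1 h4
  rw [mul_comm (m + 1) q] at h1
  generalize Module.finrank K (piece K IY d) = a at *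
  have h6 : ((q * (m + 1) : ℕ) : ℤ) = q * (m + 1) := by push_cast; ring
  rw [← h6]
  omega
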